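/- arXiv:2211.08548 — 4 statements merged into one kernel-verified Lean document; each statement's English description precedes it below -/
import Mathlib

section
/- Every covering system whose moduli are distinct squarefree positive integers contains a congruence whose modulus m satisfies m ≤ 118. Equivalently, the minimum modulus of a covering system with distinct squarefree moduli is at most 118. -/
open Finset

/-- `HasWeight N a ν Q L` says that there is a nonnegative weight of period `Q` which vanishes on
the classes `a d (mod d)` for `d ∣ Q`, `N ≤ d`, which has mean at least `L`, and which gives mean
at most `ν d` to every residue class modulo a divisor `d` of `Q`. -/
def HasWeight (N : ℕ) (a : ℕ → ℕ) (ν : ℕ → ℝ) (Q : ℕ) (L : ℝ) : Prop :=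
  ∃ w : ℕ → ℝ, (∀ x, 0 ≤ w x) ∧ Function.Periodic w Q ∧
    (∀ d, d ∣ Q → N ≤ d → ∀ x, x ≡ a d [MOD d] → w x = 0) ∧
    (∀ d, d ∣ Q → ∀ r, ∑ x ∈ range Q, (if x ≡ r [MOD d] then w x else 0) ≤ Q * ν d) ∧
    Q * L ≤ ∑ x ∈ range Q, w x

lemma sum_range_mul_eq (Q p : ℕ) (f : ℕ → ℝ) :
    ∑ z ∈ range (Q * p), f z = ∑ x ∈ range Q, ∑ y ∈ range p, f (x + Q * y) := by
  induction p with
  | zero => simp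
  | succ p ih =>
    rw [Nat.mul_succ, sum_range_add, ih, ← sum_add_distrib]
    refine sum_congr rfl fun x _ => ?_
    rw [sum_range_succ, add_comm (Q * p) x]

lemma dvd_mul_prime {Q p d : ℕ} (hp : p.Prime) (h : d ∣ Q * p) :
    d ∣ Q ∨ ∃ e, e ∣ Q ∧ d = e * p := by
  by_cases hpd : p ∣ d
  · obtain ⟨e, rfl⟩ := hpd
    right
    refine ⟨e, ?_, mul_comm _ _⟩
    rw [mul_comm] at h
    exact Nat.dvd_of_mul_dvd_mul_right hp.pos h
  · left
    exact (Nat.Coprime.dvd_of_dvd_mul_right ((hp.coprime_iff_not_dvd.2 hpd).symm) h)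

lemma modEq_add_mul {Q d : ℕ} (h : d ∣ Q) (x y r : ℕ) :
    x + Q * y ≡ r [MOD d] ↔ x ≡ r [MOD d] := by
  have : x + Q * y ≡ x [MOD d] := by
    obtain ⟨e, rfl⟩ := h
    simp [Nat.ModEq, mul_assoc]
  exact ⟨fun h => this.symm.trans h, fun h => this.trans h⟩

lemma card_fibre_le {Q p : ℕ} (hp : p.Prime) (hpQ : ¬ p ∣ Q) (x r : ℕ) :
    #{y ∈ range p | x + Q * y ≡ r [MOD p]} ≤ 1 := by
  rw [card_le_one]
  intro y hy z hz
  simp only [mem_filter, mem_range] at hy hz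
  have h : Q * y ≡ Q * z [MOD p] := Nat.ModEq.add_left_cancel' x (hy.2.trans hz.2.symm)
  have h2 : y ≡ z [MOD p] :=
    Nat.ModEq.cancel_left_of_coprime ((hp.coprime_iff_not_dvd).2 hpQ) h
  rwa [Nat.ModEq, Nat.mod_eq_of_lt hy.1, Nat.mod_eq_of_lt hz.1] at h2

lemma sum_fibre_le {Q p d : ℕ} (hp : p.Prime) (hpQ : ¬ p ∣ Q) (hd : d ∣ Q) (x r : ℕ)
    {f : ℕ → ℝ} {C : ℝ} (hC : 0 ≤ C) (hf : ∀ y, f y ≤ C) :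
    ∑ y ∈ range p, (if x + Q * y ≡ r [MOD d * p] then f y else 0)
      ≤ if x ≡ r [MOD d] then C else 0 := by
  split_ifs with hx
  · calc _ ≤ ∑ y ∈ range p, (if x + Q * y ≡ r [MOD p] then C else 0) := by
          refine sum_le_sum fun y _ => ?_
          split_ifs with h1 h2 h2
          · exact hf y
          · exact absurd (Nat.ModEq.of_mul_left _ h1) h2
          · exact hC
          · exact le_rfl
      _ = #{y ∈ range p | x + Q * y ≡ r [MOD p]} * C := by
          rw [← sum_filter, sum_const, nsmul_eq_mul]
      _ ≤ 1 * C := by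
          gcongr
          exact_mod_cast card_fibre_le hp hpQ x r
      _ = C := one_mul C
  · refine le_of_eq (sum_eq_zero fun y _ => if_neg fun h => hx ?_)
    exact (modEq_add_mul hd x y r).1 (Nat.ModEq.of_mul_right _ h)

/-- The pointwise inequality behind the second moment bound of the distortion method. -/
lemma distortion_ineq {α s t δ : ℝ} (hδ0 : 0 < δ) (hδ1 : δ < 1) (ht : 0 ≤ t)
    (h : α ≤ s + t) :
    1 - (s ^ 2 / (4 * δ) + t) / (1 - δ) ≤ (1 - α) / max (1 - α) (1 - δ) := by
  have h1 : 0 < 1 - δ := by linarith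
  have hs : 0 ≤ s ^ 2 / (4 * δ) := by positivity
  rcases le_total α δ with hα | hα
  · rw [max_eq_left (by linarith), div_self (by linarith)]
    have : 0 ≤ (s ^ 2 / (4 * δ) + t) / (1 - δ) := by positivity
    linarith
  · rw [max_eq_right (by linarith)]
    have h2 : s - δ ≤ s ^ 2 / (4 * δ) := by
      rw [le_div_iff₀ (by positivity)]
      nlinarith [sq_nonneg (s - 2 * δ)]
    have h3 : (1 - α) / (1 - δ) = 1 - (α - δ) / (1 - δ) := by
      field_simp
      ring
    rw [h3]
    gcongr
    linarith

lemma sum_inter_le {ν : ℕ → ℝ} {Q : ℕ} {w : ℕ → ℝ} (hν : ∀ d, 0 ≤ ν d)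
    (hw : ∀ d, d ∣ Q → ∀ r, ∑ x ∈ range Q, (if x ≡ r [MOD d] then w x else 0) ≤ Q * ν d)
    {d e : ℕ} (hd : d ∣ Q) (he : e ∣ Q) (r s : ℕ) :
    ∑ x ∈ range Q, w x * ((if x ≡ r [MOD d] then 1 else 0) * (if x ≡ s [MOD e] then 1 else 0))
      ≤ Q * ν (Nat.lcm d e) := by
  by_cases h : ∃ y, y ≡ r [MOD d] ∧ y ≡ s [MOD e]
  · obtain ⟨y, hy1, hy2⟩ := h
    refine le_trans (le_of_eq (sum_congr rfl fun x _ => ?_)) (hw _ (Nat.lcm_dvd hd he) y)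
    have key : x ≡ y [MOD Nat.lcm d e] ↔ x ≡ r [MOD d] ∧ x ≡ s [MOD e] := by
      constructor
      · intro h
        exact ⟨(h.of_dvd (Nat.dvd_lcm_left d e)).trans hy1,
          (h.of_dvd (Nat.dvd_lcm_right d e)).trans hy2⟩
      · rintro ⟨h1, h2⟩
        exact Nat.modEq_iff_dvd.2 (by
          have e1 := Nat.modEq_iff_dvd.1 (h1.trans hy1.symm)
          have e2 := Nat.modEq_iff_dvd.1 (h2.trans hy2.symm)
          rw [Int.natCast_dvd] at *
          exact Nat.lcm_dvd e1 e2)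
    by_cases h1 : x ≡ r [MOD d] <;> by_cases h2 : x ≡ s [MOD e] <;> simp [h1, h2, key]
  · push Not at h
    refine le_trans (le_of_eq (sum_eq_zero fun x _ => ?_))
      (mul_nonneg (Nat.cast_nonneg Q) (hν _))
    by_cases h1 : x ≡ r [MOD d]
    · simp [h x h1]
    · simp [h1]

/-- One step of the distortion method: passing from modulus `Q` to `Q * p`. The moduli `D i * p`
with `i ∈ S` are treated by a second moment bound, those with `i ∈ R` by a first moment bound. -/
lemma HasWeight.step {N : ℕ} {a : ℕ → ℕ} {ν : ℕ → ℝ} {Q p : ℕ} {L δ : ℝ}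
    (h : HasWeight N a ν Q L) (hν0 : ∀ d, 0 ≤ ν d) (hp : p.Prime) (hpQ : ¬ p ∣ Q)
    (hδ0 : 0 < δ) (hδ1 : δ < 1) {ι : Type*} (D : ι → ℕ) (S R : Finset ι)
    (hS : ∀ i ∈ S, D i ∣ Q) (hR : ∀ i ∈ R, D i ∣ Q)
    (hcov : ∀ d, d ∣ Q → N ≤ d * p → (∃ i ∈ S, D i = d) ∨ ∃ i ∈ R, D i = d)
    (hν : ∀ d, d ∣ Q → ν (d * p) = ν d / ((1 - δ) * p)) :
    HasWeight N a ν (Q * p) (L - ((∑ i ∈ S, ∑ j ∈ S, ν (Nat.lcm (D i) (D j))) / (p ^ 2 * (4 * δ))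
      + (∑ i ∈ R, ν (D i)) / p) / (1 - δ)) := by
  classical
  obtain ⟨w, hw0, hwp, hwz, hwν, hwL⟩ := h
  have hQ : 0 < Q := Nat.pos_of_ne_zero (by rintro rfl; exact hpQ (dvd_zero _))
  have hp0 : (0 : ℝ) < p := by exact_mod_cast hp.pos
  have hδ' : 0 < 1 - δ := by linarith
  set Bad : ℕ → Prop := fun z => ∃ d, d ∣ Q ∧ N ≤ d * p ∧ z ≡ a (d * p) [MOD d * p] with hBad
  set al : ℕ → ℝ := fun x => (#{y ∈ range p | Bad (x + Q * y)} : ℝ) / p with hal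
  set m : ℕ → ℝ := fun x => max (1 - al x) (1 - δ) with hm
  have hm0 : ∀ x, 0 < m x := fun x => lt_of_lt_of_le hδ' (le_max_right _ _)
  set w' : ℕ → ℝ := fun z => if Bad z then 0 else w z / m (z % Q) with hw'
  have hfib : ∀ x ∈ range Q, ∀ y,
      w' (x + Q * y) = if Bad (x + Q * y) then 0 else w x / m x := by
    intro x hx y
    have h1 : (x + Q * y) % Q = x := by
      rw [Nat.add_mul_mod_self_left, Nat.mod_eq_of_lt (mem_range.1 hx)]
    have h2 : w (x + Q * y) = w x := by
      rw [← hwp.map_mod_nat, h1]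
    simp only [hw', h1, h2]
  have hal1 : ∀ x, al x ≤ 1 := by
    intro x
    rw [hal]
    refine div_le_one_of_le₀ ?_ hp0.le
    exact_mod_cast (card_filter_le _ _).trans (card_range p).le
  have hfsum : ∀ x ∈ range Q,
      ∑ y ∈ range p, w' (x + Q * y) = p * (w x * ((1 - al x) / m x)) := by
    intro x hx
    rw [sum_congr rfl fun y _ => hfib x hx y]
    have h1 : ∀ y, (if Bad (x + Q * y) then 0 else w x / m x)
        = w x / m x - (if Bad (x + Q * y) then w x / m x else 0) := by
      intro y; split_ifs <;> simp
    simp only [h1]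
    rw [sum_sub_distrib, ← sum_filter, sum_const, sum_const, card_range, nsmul_eq_mul,
      nsmul_eq_mul]
    simp only [hal]
    have := (hm0 x).ne'
    field_simp
  refine ⟨w', ?_, ?_, ?_, ?_, ?_⟩
  · intro z
    simp only [hw']
    split_ifs
    · exact le_rfl
    · exact div_nonneg (hw0 _) (hm0 _).le
  · intro z
    have h1 : Bad (z + Q * p) ↔ Bad z := by
      refine exists_congr fun d => and_congr_right fun hd => and_congr_right fun _ => ?_
      have := modEq_add_mul (mul_dvd_mul_right hd p) z 1 (a (d * p))
      simpa using this
    have h2 : w (z + Q * p) = w z := by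
      have := hwp.nat_mul p z
      rwa [Nat.cast_id, mul_comm] at this
    simp only [hw', h1, h2, Nat.add_mul_mod_self_left]
  · intro d hd hN z hz
    rcases dvd_mul_prime hp hd with h1 | ⟨e, he, rfl⟩
    · simp only [hw', hwz d h1 hN z hz, zero_div, ite_self]
    · simp only [hw']
      rw [if_pos ⟨e, he, hN, hz⟩]
  · intro d hd r
    rw [sum_range_mul_eq]
    rcases dvd_mul_prime hp hd with h1 | ⟨e, he, rfl⟩
    · calc _ ≤ ∑ x ∈ range Q, p * (if x ≡ r [MOD d] then w x else 0) := by
            refine sum_le_sum fun x hx => ?_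
            simp only [modEq_add_mul h1]
            split_ifs
            · rw [hfsum x hx]
              gcongr
              refine mul_le_of_le_one_right (hw0 x) (div_le_one_of_le₀ (le_max_left _ _) (hm0 x).le)
            · simp
        _ ≤ p * (Q * ν d) := by
            rw [← mul_sum]
            gcongr
            exact hwν d h1 r
        _ = _ := by push_cast; ring
    · calc _ ≤ ∑ x ∈ range Q, (1 / (1 - δ)) * (if x ≡ r [MOD e] then w x else 0) := by
            refine sum_le_sum fun x hx => ?_
            refine (sum_fibre_le hp hpQ he x r (f := fun y => w' (x + Q * y)) (C := w x / (1 - δ))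
              (div_nonneg (hw0 x) hδ'.le) fun y => ?_).trans (le_of_eq ?_)
            · rw [hfib x hx]
              split_ifs
              · exact div_nonneg (hw0 x) hδ'.le
              · exact div_le_div_of_nonneg_left (hw0 x) hδ' (le_max_right _ _)
            · split_ifs <;> ring
        _ ≤ (1 / (1 - δ)) * (Q * ν e) := by
            rw [← mul_sum]
            gcongr
            exact hwν e he r
        _ = _ := by
            rw [hν e he]
            push_cast
            field_simp
  · rw [sum_range_mul_eq]
    set X : ι → ℕ → ℝ := fun i x => if x ≡ a (D i * p) [MOD D i] then 1 else 0 with hX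
    have hX0 : ∀ i x, 0 ≤ X i x := fun i x => by simp only [hX]; split_ifs <;> simp
    have hals : ∀ x, al x ≤ (∑ i ∈ S, X i x) / p + (∑ i ∈ R, X i x) / p := by
      intro x
      rw [← add_div]
      simp only [hal]
      gcongr
      have h1 : ∀ i, D i ∣ Q →
          ∑ y ∈ range p, (if x + Q * y ≡ a (D i * p) [MOD D i * p] then (1 : ℝ) else 0) ≤ X i x :=
        fun i hi => sum_fibre_le hp hpQ hi x _ zero_le_one fun _ => le_rfl
      calc (#{y ∈ range p | Bad (x + Q * y)} : ℝ)
          = ∑ y ∈ range p, if Bad (x + Q * y) then (1 : ℝ) else 0 := by simp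
        _ ≤ ∑ y ∈ range p,
            (∑ i ∈ S, (if x + Q * y ≡ a (D i * p) [MOD D i * p] then (1 : ℝ) else 0)
            + ∑ i ∈ R, (if x + Q * y ≡ a (D i * p) [MOD D i * p] then (1 : ℝ) else 0)) := by
            refine sum_le_sum fun y _ => ?_
            have n1 : ∀ T : Finset ι, 0 ≤
                ∑ i ∈ T, (if x + Q * y ≡ a (D i * p) [MOD D i * p] then (1 : ℝ) else 0) :=
              fun T => sum_nonneg fun i _ => by split_ifs <;> simp
            have n2 : ∀ T : Finset ι, ∀ i ∈ T, x + Q * y ≡ a (D i * p) [MOD D i * p] → 1 ≤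
                ∑ i ∈ T, (if x + Q * y ≡ a (D i * p) [MOD D i * p] then (1 : ℝ) else 0) := by
              intro T i hi h
              refine le_trans (by rw [if_pos h]) (single_le_sum
                (f := fun i => if x + Q * y ≡ a (D i * p) [MOD D i * p] then (1 : ℝ) else 0)
                (fun j _ => ?_) hi)
              split_ifs <;> simp
            split_ifs with hb
            · obtain ⟨d, hd, hN, hz⟩ := hb
              rcases hcov d hd hN with ⟨i, hi, rfl⟩ | ⟨i, hi, rfl⟩
              · linarith [n1 R, n2 S i hi hz]
              · linarith [n1 S, n2 R i hi hz]
            · linarith [n1 S, n1 R]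
        _ ≤ _ := by
            rw [sum_add_distrib, sum_comm, sum_comm (t := R)]
            exact add_le_add (sum_le_sum fun i hi => h1 i (hS i hi))
              (sum_le_sum fun i hi => h1 i (hR i hi))
    have hmain : ∀ x ∈ range Q, p * (w x - (1 / (1 - δ)) *
        ((1 / (p ^ 2 * (4 * δ))) * (∑ i ∈ S, ∑ j ∈ S, w x * (X i x * X j x))
          + (1 / p) * ∑ i ∈ R, w x * X i x)) ≤ ∑ y ∈ range p, w' (x + Q * y) := by
      intro x hx
      rw [hfsum x hx]
      gcongr
      have h1 := distortion_ineq hδ0 hδ1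
        (div_nonneg (sum_nonneg fun i _ => hX0 i x) hp0.le) (hals x) (t := (∑ i ∈ R, X i x) / p)
      refine le_trans (le_of_eq ?_) (mul_le_mul_of_nonneg_left h1 (hw0 x))
      simp only [← mul_sum]
      rw [← sum_mul]
      field_simp
    refine le_trans ?_ (sum_le_sum hmain)
    have e1 : ∑ x ∈ range Q, ∑ i ∈ S, ∑ j ∈ S, w x * (X i x * X j x)
        ≤ Q * ∑ i ∈ S, ∑ j ∈ S, ν (Nat.lcm (D i) (D j)) := by
      simp only [mul_sum]
      rw [sum_comm]
      refine sum_le_sum fun i hi => ?_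
      rw [sum_comm]
      exact sum_le_sum fun j hj => sum_inter_le hν0 hwν (hS i hi) (hS j hj) _ _
    have e2 : ∑ x ∈ range Q, ∑ i ∈ R, w x * X i x ≤ Q * ∑ i ∈ R, ν (D i) := by
      rw [mul_sum, sum_comm]
      refine sum_le_sum fun i hi => ?_
      refine le_trans (le_of_eq (sum_congr rfl fun x _ => ?_)) (hwν _ (hR i hi) (a (D i * p)))
      simp only [hX, mul_ite, mul_one, mul_zero]
    rw [← mul_sum, sum_sub_distrib, ← mul_sum, sum_add_distrib, ← mul_sum, ← mul_sum]
    calc _ = p * (Q * L - (1 / (1 - δ)) * ((1 / (p ^ 2 * (4 * δ))) *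
            (Q * ∑ i ∈ S, ∑ j ∈ S, ν (Nat.lcm (D i) (D j)))
            + (1 / p) * (Q * ∑ i ∈ R, ν (D i)))) := by
          push_cast
          field_simp
      _ ≤ _ := by gcongr

lemma HasWeight.mono {N : ℕ} {a : ℕ → ℕ} {ν ν' : ℕ → ℝ} {Q : ℕ} {L L' : ℝ}
    (h : HasWeight N a ν Q L) (hν : ∀ d, d ∣ Q → ν d ≤ ν' d) (hL : L' ≤ L) :
    HasWeight N a ν' Q L' := by
  obtain ⟨w, hw0, hwp, hwz, hwν, hwL⟩ := h
  refine ⟨w, hw0, hwp, hwz, fun d hd r => (hwν d hd r).trans ?_, le_trans ?_ hwL⟩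
  · exact mul_le_mul_of_nonneg_left (hν d hd) (Nat.cast_nonneg Q)
  · exact mul_le_mul_of_nonneg_left hL (Nat.cast_nonneg Q)

/-- The multiplicative function on squarefree numbers with value `f q` at the prime `q`. -/
noncomputable def sqfreeMul (f : ℕ → ℝ) (d : ℕ) : ℝ := ∏ q ∈ d.primeFactors, f q

lemma sqfreeMul_nonneg {f : ℕ → ℝ} (hf : ∀ q, 0 ≤ f q) (d : ℕ) : 0 ≤ sqfreeMul f d :=
  prod_nonneg fun q _ => hf q

lemma sqfreeMul_eq_inv {f : ℕ → ℝ} {Q d : ℕ} (hQ : Squarefree Q)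
    (hf : ∀ q, q.Prime → q ∣ Q → f q = 1 / q) (hd : d ∣ Q) : sqfreeMul f d = 1 / d := by
  have h : ∀ q ∈ d.primeFactors, f q = (q : ℝ)⁻¹ := fun q hq => by
    rw [hf q (Nat.prime_of_mem_primeFactors hq) ((Nat.dvd_of_mem_primeFactors hq).trans hd),
      one_div]
  rw [sqfreeMul, prod_congr rfl h, prod_inv_distrib, ← Nat.cast_prod,
    Nat.prod_primeFactors_of_squarefree (hQ.squarefree_of_dvd hd), one_div]

lemma sqfreeMul_update_of_not_dvd (f : ℕ → ℝ) {p d : ℕ} (g : ℝ) (h : ¬ p ∣ d) :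
    sqfreeMul (Function.update f p g) d = sqfreeMul f d :=
  prod_congr rfl fun q hq => Function.update_of_ne
    (by rintro rfl; exact h (Nat.dvd_of_mem_primeFactors hq)) _ _

lemma sqfreeMul_mul_prime (f : ℕ → ℝ) {p d : ℕ} (hp : p.Prime) (hd : d ≠ 0) (h : ¬ p ∣ d) :
    sqfreeMul f (d * p) = sqfreeMul f d * f p := by
  rw [sqfreeMul, Nat.primeFactors_mul hd hp.ne_zero, hp.primeFactors, union_comm,
    prod_union, prod_singleton, mul_comm, sqfreeMul]
  rw [disjoint_singleton_left]
  exact fun hq => h (Nat.dvd_of_mem_primeFactors hq)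

lemma exists_subset_of_dvd_mul_prod {Q d : ℕ} {P : Finset ℕ} (hP : ∀ q ∈ P, q.Prime)
    (h : d ∣ Q * ∏ q ∈ P, q) : ∃ b T, b ∣ Q ∧ T ⊆ P ∧ d = b * ∏ q ∈ T, q := by
  induction P using Finset.induction_on generalizing d with
  | empty => exact ⟨d, ∅, by simpa using h, by simp, by simp⟩
  | insert p P hpP ih =>
    rw [prod_insert hpP, mul_left_comm, mul_comm] at h
    have hP' : ∀ q ∈ P, q.Prime := fun q hq => hP q (mem_insert_of_mem hq)
    rcases dvd_mul_prime (hP p (mem_insert_self _ _)) h with h1 | ⟨e, he, rfl⟩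
    · obtain ⟨b, T, hb, hT, rfl⟩ := ih hP' h1
      exact ⟨b, T, hb, hT.trans (subset_insert _ _), rfl⟩
    · obtain ⟨b, T, hb, hT, rfl⟩ := ih hP' he
      refine ⟨b, insert p T, hb, insert_subset_insert _ hT, ?_⟩
      rw [prod_insert fun hp => hpP (hT hp)]
      ring

lemma primeFactors_mul_prod {b : ℕ} {T : Finset ℕ} (hb : b ≠ 0) (hT : ∀ q ∈ T, q.Prime) :
    (b * ∏ q ∈ T, q).primeFactors = b.primeFactors ∪ T := by
  rw [Nat.primeFactors_mul hb (prod_ne_zero_iff.2 fun q hq => (hT q hq).ne_zero),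
    Nat.primeFactors_prod hT]

lemma primeFactors_lcm {b c : ℕ} (hb : b ≠ 0) (hc : c ≠ 0) :
    (Nat.lcm b c).primeFactors = b.primeFactors ∪ c.primeFactors := by
  ext q
  simp only [Nat.mem_primeFactors, mem_union, ne_eq, Nat.lcm_eq_zero_iff, hb, hc, or_self,
    not_false_eq_true, and_true]
  rw [← and_or_left]
  exact and_congr_right fun hq => hq.dvd_lcm

lemma sqfreeMul_lcm {f : ℕ → ℝ} {Q : ℕ} {P : Finset ℕ} (hQ : Squarefree Q)
    (hf : ∀ q, q.Prime → q ∣ Q → f q = 1 / q) (hP : ∀ q ∈ P, q.Prime) (hPQ : ∀ q ∈ P, ¬ q ∣ Q)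
    {b c : ℕ} {T U : Finset ℕ} (hb : b ∣ Q) (hc : c ∣ Q) (hT : T ⊆ P) (hU : U ⊆ P) :
    sqfreeMul f (Nat.lcm (b * ∏ q ∈ T, q) (c * ∏ q ∈ U, q))
      = 1 / (Nat.lcm b c : ℕ) * ∏ q ∈ T ∪ U, f q := by
  have hb0 := ne_zero_of_dvd_ne_zero hQ.ne_zero hb
  have hc0 := ne_zero_of_dvd_ne_zero hQ.ne_zero hc
  have h0 : ∀ V ⊆ P, ∏ q ∈ V, q ≠ 0 :=
    fun V hV => prod_ne_zero_iff.2 fun q hq => (hP q (hV hq)).ne_zero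
  have hlcm : Nat.lcm b c ∣ Q := Nat.lcm_dvd hb hc
  rw [sqfreeMul, primeFactors_lcm (mul_ne_zero hb0 (h0 T hT)) (mul_ne_zero hc0 (h0 U hU)),
    primeFactors_mul_prod hb0 fun q hq => hP q (hT hq),
    primeFactors_mul_prod hc0 fun q hq => hP q (hU hq), union_union_union_comm,
    ← primeFactors_lcm hb0 hc0, prod_union, ← sqfreeMul_eq_inv hQ hf hlcm, sqfreeMul]
  rw [disjoint_left]
  exact fun q hq hq' => hPQ q (union_subset hT hU hq') ((Nat.dvd_of_mem_primeFactors hq).trans hlcm)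

lemma sum_powerset_prod_union (P : Finset ℕ) (f : ℕ → ℝ) :
    ∑ T ∈ P.powerset, ∑ U ∈ P.powerset, ∏ q ∈ T ∪ U, f q = ∏ q ∈ P, (1 + 3 * f q) := by
  induction P using Finset.induction_on with
  | empty => simp
  | insert p P hp ih =>
    have key : ∀ T ∈ P.powerset, ∑ U ∈ (insert p P).powerset, ∏ q ∈ T ∪ U, f q
        = (1 + f p) * ∑ U ∈ P.powerset, ∏ q ∈ T ∪ U, f q := by
      intro T hT
      rw [sum_powerset_insert hp, add_mul, one_mul, mul_sum]
      congr 1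
      refine sum_congr rfl fun U hU => ?_
      rw [union_insert, prod_insert]
      exact fun h => hp (union_subset (mem_powerset.1 hT) (mem_powerset.1 hU) h)
    have key2 : ∀ T ∈ P.powerset, ∑ U ∈ (insert p P).powerset, ∏ q ∈ insert p T ∪ U, f q
        = 2 * f p * ∑ U ∈ P.powerset, ∏ q ∈ T ∪ U, f q := by
      intro T hT
      rw [sum_powerset_insert hp, mul_sum, ← sum_add_distrib]
      refine sum_congr rfl fun U hU => ?_
      rw [union_insert, insert_union, insert_idem, prod_insert]
      · ring
      · exact fun h => hp (union_subset (mem_powerset.1 hT) (mem_powerset.1 hU) h)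
    rw [sum_powerset_insert hp, sum_congr rfl key, sum_congr rfl key2, ← mul_sum, ← mul_sum, ih,
      prod_insert hp]
    ring

lemma sum_sdiff_sdiff {ι : Type*} [DecidableEq ι] {S T : Finset ι} (hTS : T ⊆ S)
    {F : ι → ι → ℝ} (hF : ∀ i j, F i j = F j i) :
    ∑ i ∈ S \ T, ∑ j ∈ S \ T, F i j
      = ∑ i ∈ S, ∑ j ∈ S, F i j - 2 * ∑ i ∈ T, ∑ j ∈ S, F i j + ∑ i ∈ T, ∑ j ∈ T, F i j := by
  have h : ∀ g : ι → ℝ, ∑ i ∈ S \ T, g i = ∑ i ∈ S, g i - ∑ i ∈ T, g i := fun g => by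
    rw [← sum_sdiff hTS]; ring
  simp only [h, sum_sub_distrib]
  rw [sum_comm (s := S) (t := T)]
  simp only [hF]
  ring

/-- The primes `q` with `17 < q < n`. -/
def primesFrom19 (n : ℕ) : Finset ℕ := {q ∈ range n | q.Prime ∧ 19 ≤ q}

/-- The sum of the reciprocals of the least common multiples of pairs from `G × H`. -/
noncomputable def lcmSum (G H : Finset ℕ) : ℝ := ∑ b ∈ G, ∑ c ∈ H, 1 / (Nat.lcm b c : ℝ)

/-- The state of the distortion method after all primes below `n` have been treated. -/
def Reached (a : ℕ → ℕ) (n : ℕ) (lo hi B L : ℝ) : Prop :=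
  ∃ f : ℕ → ℝ, (∀ q, 0 ≤ f q) ∧ (∀ q, q.Prime → q ∣ 510510 → f q = 1 / q) ∧
    HasWeight 119 a (sqfreeMul f) (510510 * ∏ q ∈ primesFrom19 n, q) L ∧
    lo ≤ ∏ q ∈ primesFrom19 n, (1 + f q) ∧ ∏ q ∈ primesFrom19 n, (1 + f q) ≤ hi ∧
    ∏ q ∈ primesFrom19 n, (1 + 3 * f q) ≤ B

lemma Reached.mono {a : ℕ → ℕ} {n : ℕ} {lo hi B L lo' hi' B' L' : ℝ} (h : Reached a n lo hi B L)
    (hlo : lo' ≤ lo) (hhi : hi ≤ hi') (hB : B ≤ B') (hL : L' ≤ L) :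
    Reached a n lo' hi' B' L' := by
  obtain ⟨f, h0, h1, h2, h3, h4, h5⟩ := h
  exact ⟨f, h0, h1, h2.mono (fun _ _ => le_rfl) hL, hlo.trans h3, h4.trans hhi, h5.trans hB⟩

lemma squarefree_510510 : Squarefree 510510 := by
  have h : ∀ p : ℕ, p.Prime → Squarefree p := fun p hp => Irreducible.squarefree hp
  rw [show 510510 = 2 * 3 * 5 * 7 * 11 * 13 * 17 by norm_num]
  simp only [Nat.squarefree_mul_iff]
  norm_num [h]

lemma dvd_510510_of_lt {q : ℕ} (hq : q.Prime) (h : q < 19) : q ∣ 510510 := by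
  interval_cases q <;> first | decide | (exfalso; revert hq; decide)

lemma not_dvd_510510 {q : ℕ} (hq : q.Prime) (h : 19 ≤ q) : ¬ q ∣ 510510 := by
  intro hd
  have h1 : (510510 : ℕ) = 2 * 3 * 5 * 7 * 11 * 13 * 17 := by norm_num
  rw [h1] at hd
  simp only [hq.dvd_mul] at hd
  have key : ∀ k, 0 < k → k < 19 → ¬ q ∣ k := fun k hk hk' hd =>
    absurd (Nat.le_of_dvd hk hd) (by omega)
  rcases hd with (((((hd | hd) | hd) | hd) | hd) | hd) | hd <;>
    exact key _ (by norm_num) (by norm_num) hd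

lemma primesFrom19_succ_of_prime {p : ℕ} (hp : p.Prime) (h : 19 ≤ p) :
    primesFrom19 (p + 1) = insert p (primesFrom19 p) := by
  rw [primesFrom19, range_add_one, filter_insert, if_pos ⟨hp, h⟩, primesFrom19]

lemma Reached.succ_of_not_prime {a : ℕ → ℕ} {n : ℕ} {lo hi B L : ℝ} (h : Reached a n lo hi B L)
    (hn : ¬ n.Prime) : Reached a (n + 1) lo hi B L := by
  have : primesFrom19 (n + 1) = primesFrom19 n := by
    rw [primesFrom19, range_add_one, filter_insert, if_neg fun h => hn h.1, primesFrom19]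
  rwa [Reached, this]

lemma mem_primesFrom19 {n q : ℕ} : q ∈ primesFrom19 n ↔ q < n ∧ q.Prime ∧ 19 ≤ q := by
  simp [primesFrom19]

lemma sum_pairs_eq {f : ℕ → ℝ} {n : ℕ}
    (hf : ∀ q, q.Prime → q ∣ 510510 → f q = 1 / q)
    {G H : Finset ℕ} (hG : ∀ b ∈ G, b ∣ 510510) (hH : ∀ b ∈ H, b ∣ 510510)
    {W Z : Finset (Finset ℕ)} (hW : W ⊆ (primesFrom19 n).powerset)
    (hZ : Z ⊆ (primesFrom19 n).powerset) :
    ∑ i ∈ G ×ˢ W, ∑ j ∈ H ×ˢ Z,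
      sqfreeMul f (Nat.lcm (i.1 * ∏ q ∈ i.2, q) (j.1 * ∏ q ∈ j.2, q))
      = lcmSum G H * ∑ T ∈ W, ∑ U ∈ Z, ∏ q ∈ T ∪ U, f q := by
  have hP : ∀ q ∈ primesFrom19 n, q.Prime := fun q hq => (mem_primesFrom19.1 hq).2.1
  have hPQ : ∀ q ∈ primesFrom19 n, ¬ q ∣ 510510 := fun q hq =>
    not_dvd_510510 (hP q hq) (mem_primesFrom19.1 hq).2.2
  have key : ∀ i ∈ G ×ˢ W, ∀ j ∈ H ×ˢ Z,
      sqfreeMul f (Nat.lcm (i.1 * ∏ q ∈ i.2, q) (j.1 * ∏ q ∈ j.2, q))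
      = 1 / (Nat.lcm i.1 j.1 : ℕ) * ∏ q ∈ i.2 ∪ j.2, f q := by
    intro i hi j hj
    rw [mem_product] at hi hj
    exact sqfreeMul_lcm squarefree_510510 hf hP hPQ (hG _ hi.1) (hH _ hj.1)
      (mem_powerset.1 (hW hi.2)) (mem_powerset.1 (hZ hj.2))
  rw [sum_congr rfl fun i hi => sum_congr rfl fun j hj => key i hi j hj]
  simp only [sum_product]
  rw [lcmSum, sum_mul]
  refine sum_congr rfl fun b _ => ?_
  rw [sum_mul_sum, sum_comm]
  simp only [mul_sum]

lemma Reached.step {a : ℕ → ℕ} {p : ℕ} {lo hi B L u v : ℝ} (h : Reached a p lo hi B L)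
    (hp : p.Prime) (hp19 : 19 ≤ p) (hv : 0 < v) (huv : v < u) {G H T : Finset ℕ}
    (hG : ∀ b ∈ G, b ∣ 510510) (hH : ∀ b ∈ H, b ∣ 510510)
    (hGH : ∀ b, b ∣ 510510 → b ∈ G ∨ b ∈ H) (hTG : T ⊆ G) (hT : ∀ b ∈ T, b * p < 119) :
    Reached a (p + 1) (lo + lo * u / (v * p)) (hi + hi * u / (v * p)) (B + B * 3 * u / (v * p))
      (L - ((lcmSum G G * B + lcmSum T T - 2 * lcmSum T G * lo) * (u * u)
        / (4 * (u - v) * (v * p * p)) + (∑ b ∈ H, 1 / (b : ℝ)) * hi * u / (v * p))) := by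
  obtain ⟨f, hf0, hf, hw, hlo, hhi, hB⟩ := h
  have hu : 0 < u := hv.trans huv
  have hp0 : (0 : ℝ) < p := by exact_mod_cast hp.pos
  set P := primesFrom19 p with hPdef
  have hP : ∀ q ∈ P, q.Prime := fun q hq => (mem_primesFrom19.1 hq).2.1
  have hpP : p ∉ P := fun h => lt_irrefl _ (mem_primesFrom19.1 h).1
  have hPQ : ∀ q ∈ P, ¬ q ∣ 510510 := fun q hq =>
    not_dvd_510510 (hP q hq) (mem_primesFrom19.1 hq).2.2
  set Q := 510510 * ∏ q ∈ P, q with hQdef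
  have hpQ : ¬ p ∣ Q := by
    rw [hQdef, hp.dvd_mul, hp.prime.dvd_finsetProd_iff]
    rintro (h | ⟨q, hq, h⟩)
    · exact not_dvd_510510 hp hp19 h
    · exact hpP ((Nat.prime_dvd_prime_iff_eq hp (hP q hq)).1 h ▸ hq)
  have hQ0 : Q ≠ 0 := by rintro h; exact hpQ (h ▸ dvd_zero p)
  set g : ℝ := u / (v * p) with hg
  have hg0 : 0 ≤ g := by positivity
  set f' := Function.update f p g with hf'
  have hf'0 : ∀ q, 0 ≤ f' q := by
    intro q
    rw [hf', Function.update_apply]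
    split_ifs
    exacts [hg0, hf0 q]
  have hf'P : ∀ q ∈ P, f' q = f q := fun q hq =>
    Function.update_of_ne (by rintro rfl; exact hpP hq) _ _
  have hf'Q : ∀ q, q.Prime → q ∣ 510510 → f' q = 1 / q := by
    intro q hq hd
    rw [hf', Function.update_of_ne, hf q hq hd]
    rintro rfl
    exact not_dvd_510510 hp hp19 hd
  have hnot : ∀ d, d ∣ Q → ¬ p ∣ d := fun d hd h => hpQ (h.trans hd)
  set S := (G ×ˢ P.powerset) \ (T ×ˢ {∅}) with hS
  set R := H ×ˢ P.powerset with hR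
  set D : ℕ × Finset ℕ → ℕ := fun i => i.1 * ∏ q ∈ i.2, q with hD
  have hdvd : ∀ b U, b ∣ 510510 → U ∈ P.powerset → b * ∏ q ∈ U, q ∣ Q := fun b U hb hU =>
    mul_dvd_mul hb (prod_dvd_prod_of_subset _ _ _ (mem_powerset.1 hU))
  have h1 := (hw.mono (ν' := sqfreeMul f')
    (fun d hd => (sqfreeMul_update_of_not_dvd f g (hnot d hd)).ge) le_rfl).step
    (sqfreeMul_nonneg hf'0) hp hpQ (δ := 1 - v / u)
    (by rw [sub_pos, div_lt_one hu]; exact huv) (by rw [sub_lt_self_iff]; positivity) D S R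
    (by
      rintro ⟨b, U⟩ hi
      rw [hS, mem_sdiff, mem_product] at hi
      exact hdvd b U (hG b hi.1.1) hi.1.2)
    (by
      rintro ⟨b, U⟩ hi
      rw [hR, mem_product] at hi
      exact hdvd b U (hH b hi.1) hi.2)
    (by
      intro d hd hN
      obtain ⟨b, U, hb, hU, rfl⟩ := exists_subset_of_dvd_mul_prod hP hd
      rcases hGH b hb with h | h
      · left
        refine ⟨(b, U), ?_, rfl⟩
        rw [hS, mem_sdiff, mem_product, mem_product]
        refine ⟨⟨h, mem_powerset.2 hU⟩, ?_⟩
        rintro ⟨hbT, hUe⟩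
        rw [mem_singleton] at hUe
        simp only at hUe hbT
        have := hT b hbT
        rw [hUe, prod_empty, mul_one] at hN
        omega
      · right
        exact ⟨(b, U), mem_product.2 ⟨h, mem_powerset.2 hU⟩, rfl⟩)
    (by
      intro d hd
      rw [sqfreeMul_mul_prime f' hp (ne_zero_of_dvd_ne_zero hQ0 hd) (hnot d hd), hf',
        Function.update_self, hg, sub_sub_cancel]
      field_simp)
  have e1 : ∏ q ∈ P, (1 + f' q) = ∏ q ∈ P, (1 + f q) :=
    prod_congr rfl fun q hq => by rw [hf'P q hq]
  have e3 : ∏ q ∈ P, (1 + 3 * f' q) = ∏ q ∈ P, (1 + 3 * f q) :=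
    prod_congr rfl fun q hq => by rw [hf'P q hq]
  have hemp : ({∅} : Finset (Finset ℕ)) ⊆ P.powerset := by simp
  have hTd : ∀ b ∈ T, b ∣ 510510 := fun b hb => hG b (hTG hb)
  have hSS : ∑ i ∈ S, ∑ j ∈ S, sqfreeMul f' (Nat.lcm (D i) (D j))
      ≤ lcmSum G G * B + lcmSum T T - 2 * lcmSum T G * lo := by
    rw [hS, sum_sdiff_sdiff (product_subset_product hTG hemp)
      (F := fun i j => sqfreeMul f' (Nat.lcm (D i) (D j))) fun i j => by rw [Nat.lcm_comm]]
    rw [sum_pairs_eq hf'Q hG hG subset_rfl subset_rfl, sum_pairs_eq hf'Q hTd hG hemp subset_rfl,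
      sum_pairs_eq hf'Q hTd hTd hemp hemp, sum_powerset_prod_union]
    simp only [sum_singleton, empty_union, prod_empty, mul_one, ← prod_one_add]
    rw [e1, e3]
    have n1 : 0 ≤ lcmSum G G := sum_nonneg fun _ _ => sum_nonneg fun _ _ => by positivity
    have n2 : 0 ≤ lcmSum T G := sum_nonneg fun _ _ => sum_nonneg fun _ _ => by positivity
    nlinarith [mul_le_mul_of_nonneg_left hB n1, mul_le_mul_of_nonneg_left hlo n2]
  have hRR : ∑ i ∈ R, sqfreeMul f' (D i) ≤ (∑ b ∈ H, 1 / (b : ℝ)) * hi := by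
    have h2 := sum_pairs_eq (n := p) (G := H) (H := {1}) (W := P.powerset) (Z := {∅}) hf'Q hH
      (by simp) subset_rfl hemp
    simp only [sum_product, sum_singleton, lcmSum, prod_empty, mul_one, Nat.lcm_one_right,
      union_empty] at h2
    rw [← prod_one_add, e1] at h2
    rw [hR, sum_product, h2]
    exact mul_le_mul_of_nonneg_left hhi (sum_nonneg fun _ _ => by positivity)
  refine ⟨f', hf'0, hf'Q, ?_, ?_, ?_, ?_⟩
  · rw [primesFrom19_succ_of_prime hp hp19, prod_insert hpP, mul_comm p, ← mul_assoc]
    refine h1.mono (fun _ _ => le_rfl) ?_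
    gcongr ?_ - ?_
    have e5 : 1 - (1 - v / u) = v / u := by ring
    have e6 : 1 - v / u = (u - v) / u := by field_simp
    have huv' : 0 < u - v := sub_pos.2 huv
    rw [e5, e6]
    calc _ ≤ ((lcmSum G G * B + lcmSum T T - 2 * lcmSum T G * lo) / (p ^ 2 * (4 * ((u - v) / u)))
          + ((∑ b ∈ H, 1 / (b : ℝ)) * hi) / p) / (v / u) := by gcongr
      _ = _ := by field_simp
  all_goals
    rw [primesFrom19_succ_of_prime hp hp19, prod_insert hpP]
    first | rw [e1] | rw [e3]
    rw [hf', Function.update_self]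
  · have : lo + lo * u / (v * p) = (1 + g) * lo := by rw [hg]; ring
    rw [this]
    gcongr
  · have : hi + hi * u / (v * p) = (1 + g) * hi := by rw [hg]; ring
    rw [this]
    gcongr
  · have : B + B * 3 * u / (v * p) = (1 + 3 * g) * B := by rw [hg]; ring
    rw [this]
    gcongr

/-- The divisors of `510510`, each paired with its number of prime factors. -/
def baseDivisors : List (ℕ × ℕ) :=
  [2, 3, 5, 7, 11, 13, 17].foldr (fun p l => l ++ l.map fun x => (x.1 * p, x.2 + 1)) [(1, 0)]

/-- The divisors of `510510` with at most `w` prime factors. -/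
def divisorsLE (w : ℕ) : List ℕ := (baseDivisors.filter fun x => x.2 ≤ w).map Prod.fst

/-- The divisors of `510510` with more than `w` prime factors. -/
def divisorsGT (w : ℕ) : List ℕ := (baseDivisors.filter fun x => w < x.2).map Prod.fst

/-- The divisors `b` of `510510` with at most `w` prime factors and `b * p < 119`. -/
def divisorsTiny (w p : ℕ) : List ℕ := (divisorsLE w).filter fun b => b * p < 119

/-- `510510` times the sum of the reciprocals of the least common multiples of pairs. -/
def lcmCount (l l' : List ℕ) : ℕ := (l.map fun b => (l'.map fun c => 510510 / Nat.lcm b c).sum).sum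

/-- `510510` times the sum of the reciprocals. -/
def invCount (l : List ℕ) : ℕ := (l.map fun b => 510510 / b).sum

lemma mem_foldr_divisors {ps : List ℕ} (hps : ∀ p ∈ ps, p.Prime) {d : ℕ} (hd : d ∣ ps.prod) :
    d ∈ (ps.foldr (fun p l => l ++ l.map fun x => (x.1 * p, x.2 + 1)) [(1, 0)]).map Prod.fst := by
  induction ps generalizing d with
  | nil => simpa using hd
  | cons p ps ih =>
    rw [List.prod_cons, mul_comm] at hd
    have ih' := @ih fun q hq => hps q (List.mem_cons_of_mem _ hq)
    rw [List.foldr_cons, List.map_append, List.mem_append]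
    rcases dvd_mul_prime (hps p List.mem_cons_self) hd with h | ⟨e, he, rfl⟩
    · exact Or.inl (ih' h)
    · obtain ⟨x, hx, rfl⟩ := List.mem_map.1 (ih' he)
      right
      rw [List.map_map]
      exact List.mem_map.2 ⟨x, hx, rfl⟩

lemma exists_mem_baseDivisors {d : ℕ} (hd : d ∣ 510510) : ∃ x ∈ baseDivisors, x.1 = d := by
  refine List.mem_map.1 (mem_foldr_divisors (ps := [2, 3, 5, 7, 11, 13, 17]) ?_ ?_)
  · norm_num
  · simpa using hd

lemma nodup_baseDivisors : (baseDivisors.map Prod.fst).Nodup := by decide +kernel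

lemma dvd_of_mem_baseDivisors : ∀ x ∈ baseDivisors, x.1 ∣ 510510 := by decide +kernel

lemma nodup_divisorsLE (w : ℕ) : (divisorsLE w).Nodup :=
  nodup_baseDivisors.sublist (List.filter_sublist.map _)

lemma nodup_divisorsGT (w : ℕ) : (divisorsGT w).Nodup :=
  nodup_baseDivisors.sublist (List.filter_sublist.map _)

lemma nodup_divisorsTiny (w p : ℕ) : (divisorsTiny w p).Nodup :=
  (nodup_divisorsLE w).sublist List.filter_sublist

lemma dvd_of_mem_divisorsLE {w b : ℕ} (hb : b ∈ divisorsLE w) : b ∣ 510510 := by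
  obtain ⟨x, hx, rfl⟩ := List.mem_map.1 hb
  exact dvd_of_mem_baseDivisors x (List.mem_of_mem_filter hx)

lemma dvd_of_mem_divisorsGT {w b : ℕ} (hb : b ∈ divisorsGT w) : b ∣ 510510 := by
  obtain ⟨x, hx, rfl⟩ := List.mem_map.1 hb
  exact dvd_of_mem_baseDivisors x (List.mem_of_mem_filter hx)

lemma mem_divisorsLE_or_mem_divisorsGT (w : ℕ) {b : ℕ} (hb : b ∣ 510510) :
    b ∈ divisorsLE w ∨ b ∈ divisorsGT w := by
  obtain ⟨x, hx, rfl⟩ := exists_mem_baseDivisors hb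
  rcases le_or_gt x.2 w with h | h
  · exact Or.inl (List.mem_map_of_mem (List.mem_filter.2 ⟨hx, decide_eq_true h⟩))
  · exact Or.inr (List.mem_map_of_mem (List.mem_filter.2 ⟨hx, decide_eq_true h⟩))

lemma cast_invCount {l : List ℕ} (hl : l.Nodup) (hd : ∀ b ∈ l, b ∣ 510510) :
    ∑ b ∈ l.toFinset, 1 / (b : ℝ) = invCount l / 510510 := by
  rw [invCount, ← List.sum_toFinset _ hl, Nat.cast_sum, sum_div]
  refine sum_congr rfl fun b hb => ?_
  have h := hd b (List.mem_toFinset.1 hb)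
  have h0 : (b : ℝ) ≠ 0 := Nat.cast_ne_zero.2 (ne_zero_of_dvd_ne_zero (by norm_num) h)
  rw [Nat.cast_div h h0]
  push_cast
  field_simp

lemma lcmSum_toFinset {l l' : List ℕ} (hl : l.Nodup) (hl' : l'.Nodup)
    (hd : ∀ b ∈ l, b ∣ 510510) (hd' : ∀ b ∈ l', b ∣ 510510) :
    lcmSum l.toFinset l'.toFinset = lcmCount l l' / 510510 := by
  rw [lcmCount, ← List.sum_toFinset _ hl, Nat.cast_sum, sum_div, lcmSum]
  refine sum_congr rfl fun b hb => ?_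
  rw [← List.sum_toFinset _ hl', Nat.cast_sum, sum_div]
  refine sum_congr rfl fun c hc => ?_
  have h := Nat.lcm_dvd (hd b (List.mem_toFinset.1 hb)) (hd' c (List.mem_toFinset.1 hc))
  have h0 : ((Nat.lcm b c : ℕ) : ℝ) ≠ 0 :=
    Nat.cast_ne_zero.2 (ne_zero_of_dvd_ne_zero (by norm_num) h)
  rw [Nat.cast_div h h0]
  push_cast
  field_simp

/-- Fixed point bounds, with denominator `10 ^ 12`, for the data in `Reached`. -/
structure Bounds where
  lo : ℕ
  hi : ℕ
  B : ℕ
  used : ℕ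

/-- The statement that the given fixed point bounds are valid once all primes below `n` have been
treated. -/
def Bounds.Valid (a : ℕ → ℕ) (n : ℕ) (s : Bounds) : Prop :=
  Reached a n (s.lo / 10 ^ 12) (s.hi / 10 ^ 12) (s.B / 10 ^ 12) (1 - s.used / 10 ^ 12)

/-- The value `k n`, written so that the kernel evaluates `n` first. -/
def force {α : Type} (n : ℕ) (k : ℕ → α) : α :=
  Nat.rec (k 0) (fun m _ => k (Nat.succ m)) n

lemma force_eq {α : Type} (n : ℕ) (k : ℕ → α) : force n k = k n := by
  cases n <;> rfl

/-- The bounds after treating the prime `p`, with `1 / (1 - δ) = u / v`. -/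
def Bounds.next (u v C C₁ C₂ V p : ℕ) (s : Bounds) : Bounds :=
  force (Nat.mul v p) fun q =>
  force (Nat.add s.lo (Nat.div (Nat.mul s.lo u) q)) fun lo =>
  force (Nat.succ (Nat.add s.hi (Nat.div (Nat.mul s.hi u) q))) fun hi =>
  force (Nat.succ (Nat.add s.B (Nat.div (Nat.mul (Nat.mul s.B 3) u) q))) fun B =>
  force (Nat.add s.used (Nat.succ (Nat.succ (Nat.add
    (Nat.div (Nat.mul (Nat.sub (Nat.add (Nat.mul C s.B) (Nat.mul C₂ 1000000000000))
      (Nat.mul (Nat.mul 2 C₁) s.lo)) (Nat.mul u u))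
      (Nat.mul (Nat.mul (Nat.mul 4 (Nat.sub u v)) (Nat.mul q p)) 510510))
    (Nat.div (Nat.mul (Nat.mul V s.hi) u) (Nat.mul q 510510)))))) fun used =>
  ⟨lo, hi, B, used⟩

lemma cast_div_le_succ (m n : ℕ) : (m : ℝ) / n ≤ (m / n : ℕ) + 1 := by
  rw [← Nat.floor_div_eq_div (K := ℝ)]
  exact (Nat.lt_floor_add_one _).le

lemma Bounds.Valid.next {a : ℕ → ℕ} {p : ℕ} {s : Bounds} (h : s.Valid a p) (hp : p.Prime)
    (hp19 : 19 ≤ p) {u v w C C₁ C₂ V : ℕ} (hv : 0 < v) (huv : v < u)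
    (hC : lcmCount (divisorsLE w) (divisorsLE w) = C)
    (hC₁ : lcmCount (divisorsTiny w p) (divisorsLE w) = C₁)
    (hC₂ : lcmCount (divisorsTiny w p) (divisorsTiny w p) = C₂)
    (hV : invCount (divisorsGT w) = V) : (s.next u v C C₁ C₂ V p).Valid a (p + 1) := by
  have hu : 0 < u := hv.trans huv
  have hp0 : 0 < p := hp.pos
  have hT : ∀ b ∈ divisorsTiny w p, b ∣ 510510 := fun b hb =>
    dvd_of_mem_divisorsLE (List.mem_of_mem_filter hb)
  have key := Reached.step h hp hp19 (u := u) (v := v) (by exact_mod_cast hv)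
    (by exact_mod_cast huv) (G := (divisorsLE w).toFinset) (H := (divisorsGT w).toFinset)
    (T := (divisorsTiny w p).toFinset)
    (fun b hb => dvd_of_mem_divisorsLE (List.mem_toFinset.1 hb))
    (fun b hb => dvd_of_mem_divisorsGT (List.mem_toFinset.1 hb))
    (fun b hb => by
      simpa only [List.mem_toFinset] using mem_divisorsLE_or_mem_divisorsGT w hb)
    (fun b hb => List.mem_toFinset.2 (List.mem_of_mem_filter (List.mem_toFinset.1 hb)))
    (fun b hb => of_decide_eq_true (List.mem_filter.1 (List.mem_toFinset.1 hb)).2)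
  rw [lcmSum_toFinset (nodup_divisorsLE w) (nodup_divisorsLE w)
      (fun b => dvd_of_mem_divisorsLE) (fun b => dvd_of_mem_divisorsLE), hC,
    lcmSum_toFinset (nodup_divisorsTiny w p) (nodup_divisorsLE w) hT
      (fun b => dvd_of_mem_divisorsLE), hC₁,
    lcmSum_toFinset (nodup_divisorsTiny w p) (nodup_divisorsTiny w p) hT hT, hC₂,
    cast_invCount (nodup_divisorsGT w) (fun b => dvd_of_mem_divisorsGT), hV] at key
  have huv' : (0 : ℝ) < u - v := by
    rw [sub_pos]
    exact_mod_cast huv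
  have hvR : (0 : ℝ) < v := by exact_mod_cast hv
  have hpR : (0 : ℝ) < p := by exact_mod_cast hp0
  have hdiv : ∀ m n, Nat.div m n = m / n := fun _ _ => rfl
  simp only [Bounds.Valid, Bounds.next, force_eq, Nat.add_eq, Nat.mul_eq, Nat.sub_eq,
    hdiv, Nat.succ_eq_add_one]
  refine key.mono ?_ ?_ ?_ ?_
  · have h1 : ((s.lo * u / (v * p) : ℕ) : ℝ) ≤ (s.lo * u : ℕ) / (v * p : ℕ) := Nat.cast_div_le
    push_cast at h1 ⊢
    calc _ ≤ ((s.lo : ℝ) + s.lo * u / (v * p)) / 10 ^ 12 := by gcongr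
      _ = _ := by ring
  · have h1 := cast_div_le_succ (s.hi * u) (v * p)
    push_cast at h1 ⊢
    calc _ = ((s.hi : ℝ) + s.hi * u / (v * p)) / 10 ^ 12 := by ring
      _ ≤ _ := by rw [add_assoc]; gcongr
  · have h1 := cast_div_le_succ (s.B * 3 * u) (v * p)
    push_cast at h1 ⊢
    calc _ = ((s.B : ℝ) + s.B * 3 * u / (v * p)) / 10 ^ 12 := by ring
      _ ≤ _ := by rw [add_assoc]; gcongr
  · have h3 : (C * s.B + C₂ * 1000000000000 - 2 * C₁ * s.lo : ℝ)
        ≤ (C * s.B + C₂ * 1000000000000 - 2 * C₁ * s.lo : ℕ) := by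
      have : C * s.B + C₂ * 1000000000000 ≤
        (C * s.B + C₂ * 1000000000000 - 2 * C₁ * s.lo) + 2 * C₁ * s.lo := by omega
      have h4 : (C * s.B + C₂ * 1000000000000 : ℝ) ≤
        (C * s.B + C₂ * 1000000000000 - 2 * C₁ * s.lo : ℕ) + 2 * C₁ * s.lo := by
        exact_mod_cast this
      linarith
    generalize C * s.B + C₂ * 1000000000000 - 2 * C₁ * s.lo = X at h3 ⊢
    have h1 := cast_div_le_succ (X * (u * u)) (4 * (u - v) * (v * p * p) * 510510)
    have h2 := cast_div_le_succ (V * s.hi * u) (v * p * 510510)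
    generalize X * (u * u) / (4 * (u - v) * (v * p * p) * 510510) = E at h1 ⊢
    generalize V * s.hi * u / (v * p * 510510) = F at h2 ⊢
    push_cast [Nat.cast_sub huv.le] at h1 h2 ⊢
    have h5 : ((C : ℝ) * s.B + C₂ * 1000000000000 - 2 * C₁ * s.lo) * (u * u)
        / (4 * (u - v) * (v * p * p) * 510510) ≤ E + 1 := by
      refine le_trans ?_ h1
      gcongr
    have h6 : ((C : ℝ) / 510510 * (s.B / 10 ^ 12) + C₂ / 510510
          - 2 * (C₁ / 510510) * (s.lo / 10 ^ 12)) * (u * u) / (4 * (u - v) * (v * p * p))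
        + V / 510510 * (s.hi / 10 ^ 12) * u / (v * p)
        = (((C : ℝ) * s.B + C₂ * 1000000000000 - 2 * C₁ * s.lo) * (u * u)
        / (4 * (u - v) * (v * p * p) * 510510) + V * s.hi * u / (v * p * 510510)) / 10 ^ 12 := by
      field_simp
      ring
    rw [h6]
    linarith

lemma Bounds.lo_next {s : Bounds} (h : s.lo = 0) (u v C C₁ C₂ V p : ℕ) :
    (s.next u v C C₁ C₂ V p).lo = 0 := by
  have hdiv : ∀ m n, Nat.div m n = m / n := fun _ _ => rfl
  simp [Bounds.next, force_eq, h, hdiv]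

lemma Bounds.Valid.mono {a : ℕ → ℕ} {n : ℕ} {s t : Bounds} (h : s.Valid a n) (hlo : t.lo ≤ s.lo)
    (hhi : s.hi ≤ t.hi) (hB : s.B ≤ t.B) (hu : s.used ≤ t.used) : t.Valid a n := by
  refine Reached.mono h ?_ ?_ ?_ ?_ <;> gcongr

lemma Bounds.Valid.next_of_not_prime {a : ℕ → ℕ} {n : ℕ} {s : Bounds} (h : s.Valid a n)
    (hs : s.lo = 0) (hn : ¬ n.Prime) (u v C C₁ C₂ V : ℕ) :
    (s.next u v C C₁ C₂ V n).Valid a (n + 1) := by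
  refine (Bounds.Valid.mono (s := s) (h.succ_of_not_prime hn) (by rw [lo_next hs, hs])
    ?_ ?_ ?_)
  all_goals
    simp only [Bounds.next, force_eq, Nat.add_eq, Nat.succ_eq_add_one]
    omega

lemma divisorsTiny_eq_nil {p : ℕ} (w : ℕ) (hp : 119 ≤ p) : divisorsTiny w p = [] := by
  rw [divisorsTiny, List.filter_eq_nil_iff]
  intro b hb h
  have h1 : 0 < b := Nat.pos_of_dvd_of_pos (dvd_of_mem_divisorsLE hb) (by norm_num)
  have h2 := of_decide_eq_true h
  nlinarith

lemma not_prime_of_gcd_factorial {K n : ℕ} (hK : K < n) (h : Nat.gcd K.factorial n ≠ 1) :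
    ¬ n.Prime := fun hn => h <| Nat.Coprime.symm <|
  (hn.coprime_iff_not_dvd).2 fun hd => absurd (hn.dvd_factorial.1 hd) (by omega)

lemma prime_of_gcd_factorial {n : ℕ} (hn : 1 < n) (hn' : n < 361)
    (h : Nat.gcd (Nat.factorial 18) n = 1) : n.Prime := by
  by_contra hp
  have h1 : n.minFac ^ 2 ≤ n := Nat.minFac_sq_le_self (by omega) hp
  have h2 : n.minFac ≤ 18 := by nlinarith
  have h3 := Nat.dvd_gcd ((Nat.minFac_prime hn.ne').dvd_factorial.2 h2) n.minFac_dvd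
  rw [h, Nat.dvd_one] at h3
  exact (Nat.minFac_prime hn.ne').one_lt.ne' h3

/-- The bounds after treating `2 * m + 1` as a prime if it is coprime to `P`. -/
noncomputable def Bounds.nextOdd (u v C V P m : ℕ) (s : Bounds) : Bounds :=
  Bool.rec s (s.next u v C 0 0 V (Nat.succ (Nat.mul 2 m)))
    (Nat.beq (Nat.gcd P (Nat.succ (Nat.mul 2 m))) 1)

lemma Bounds.Valid.nextOdd {a : ℕ → ℕ} {m : ℕ} {s : Bounds} (h : s.Valid a (2 * m + 1))
    (hs : s.lo = 0) {u v w C V K : ℕ} (hv : 0 < v) (huv : v < u)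
    (hC : lcmCount (divisorsLE w) (divisorsLE w) = C) (hV : invCount (divisorsGT w) = V)
    (hK : K < 2 * m + 1) (hm : 64 ≤ m) :
    (s.nextOdd u v C V K.factorial m).Valid a (2 * (m + 1) + 1)
      ∧ (s.nextOdd u v C V K.factorial m).lo = 0 := by
  have heven : ¬ (2 * m + 1 + 1).Prime := fun hp => by
    have := hp.eq_one_or_self_of_dvd 2 ⟨m + 1, by ring⟩
    omega
  rw [Bounds.nextOdd]
  cases hb : Nat.beq (Nat.gcd K.factorial (Nat.succ (Nat.mul 2 m))) 1
  · exact ⟨(h.succ_of_not_prime (not_prime_of_gcd_factorial hK (Nat.ne_of_beq_eq_false hb))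
      ).succ_of_not_prime heven, hs⟩
  · refine ⟨?_, lo_next hs _ _ _ _ _ _ _⟩
    refine Reached.succ_of_not_prime (n := 2 * m + 1 + 1) ?_ heven
    by_cases hp : (2 * m + 1).Prime
    · have ht := divisorsTiny_eq_nil w (p := 2 * m + 1) (by omega)
      exact h.next hp (by omega) hv huv hC (by rw [ht]; rfl) (by rw [ht]; rfl) hV
    · exact h.next_of_not_prime hs hp _ _ _ _ _ _

/-- The bounds after treating the odd numbers `2 * m' + 1` with `m ≤ m' < m + 2 ^ k`. -/
noncomputable def Bounds.run (u v C V P k : ℕ) : ℕ → Bounds → Bounds :=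
  Nat.rec (Bounds.nextOdd u v C V P)
    (fun k ih m s => force m fun m =>
      Bounds.rec (fun lo hi B used => ih (Nat.add m (Nat.pow 2 k)) ⟨lo, hi, B, used⟩) (ih m s)) k

lemma Bounds.Valid.run {a : ℕ → ℕ} {u v w C V K : ℕ} (hv : 0 < v) (huv : v < u)
    (hC : lcmCount (divisorsLE w) (divisorsLE w) = C) (hV : invCount (divisorsGT w) = V) (k : ℕ)
    {m : ℕ} {s : Bounds} (h : s.Valid a (2 * m + 1)) (hs : s.lo = 0)
    (hK : K < 2 * m + 1) (hm : 64 ≤ m) :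
    (s.run u v C V K.factorial k m).Valid a (2 * (m + 2 ^ k) + 1)
      ∧ (s.run u v C V K.factorial k m).lo = 0 := by
  induction k generalizing m s with
  | zero => exact h.nextOdd hs hv huv hC hV hK hm
  | succ k ih =>
    have h1 := ih h hs hK hm
    have h2 := ih h1.1 h1.2 (hK.trans_le (by gcongr; exact Nat.le_add_right _ _))
      (hm.trans (Nat.le_add_right _ _))
    have e1 : s.run u v C V K.factorial (k + 1) m
        = (s.run u v C V K.factorial k m).run u v C V K.factorial k (m + 2 ^ k) := by
      clear * -
      cases m <;> rfl
    rw [e1, pow_succ, mul_two, ← add_assoc]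
    exact h2

/-- The bounds after treating the odd numbers between `2 ^ (j + 1)` and `2 ^ (i + j + 1)`. -/
noncomputable def Bounds.runDyadic (u v C V P j i : ℕ) (s : Bounds) : Bounds :=
  Nat.rec s (fun i t => Bounds.rec (fun lo hi B used =>
    Bounds.run u v C V P (Nat.add i j) (Nat.pow 2 (Nat.add i j)) ⟨lo, hi, B, used⟩) t) i

lemma Bounds.Valid.runDyadic {a : ℕ → ℕ} {u v w C V K j : ℕ} (hv : 0 < v) (huv : v < u)
    (hC : lcmCount (divisorsLE w) (divisorsLE w) = C) (hV : invCount (divisorsGT w) = V) (i : ℕ)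
    {s : Bounds} (h : s.Valid a (2 ^ (j + 1) + 1)) (hs : s.lo = 0)
    (hK : K < 2 ^ (j + 1)) (hj : 6 ≤ j) :
    (s.runDyadic u v C V K.factorial j i).Valid a (2 ^ (i + j + 1) + 1)
      ∧ (s.runDyadic u v C V K.factorial j i).lo = 0 := by
  induction i with
  | zero => simpa [Bounds.runDyadic] using ⟨h, hs⟩
  | succ i ih =>
    have h1 : 2 ^ (i + j + 1) = 2 * 2 ^ (i + j) := by rw [pow_succ, mul_comm]
    have h2 : 2 ^ (j + 1) ≤ 2 ^ (i + j + 1) := Nat.pow_le_pow_right (by norm_num) (by omega)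
    have h3 : 2 ^ 6 ≤ 2 ^ (i + j) := Nat.pow_le_pow_right (by norm_num) (by omega)
    rw [h1] at ih
    have h4 := Bounds.Valid.run hv huv hC hV (i + j) ih.1 ih.2 (hK.trans_le (by omega)) h3
    have h5 : 2 ^ (i + 1 + j + 1) = 2 * (2 ^ (i + j) + 2 ^ (i + j)) := by ring
    rw [h5]
    exact h4

/-- The bounds after treating `n < 128`. -/
noncomputable def Bounds.nextSmall (n : ℕ) (s : Bounds) : Bounds :=
  if Nat.gcd (Nat.factorial 18) n = 1 then
    if n < 37 then s.next 7 6 (lcmCount (divisorsLE 2) (divisorsLE 2))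
      (lcmCount (divisorsTiny 2 n) (divisorsLE 2)) (lcmCount (divisorsTiny 2 n) (divisorsTiny 2 n))
      (invCount (divisorsGT 2)) n
    else s.next 4 3 (lcmCount (divisorsLE 3) (divisorsLE 3))
      (lcmCount (divisorsTiny 3 n) (divisorsLE 3)) (lcmCount (divisorsTiny 3 n) (divisorsTiny 3 n))
      (invCount (divisorsGT 3)) n
  else s

lemma Bounds.Valid.nextSmall {a : ℕ → ℕ} {n : ℕ} {s : Bounds} (h : s.Valid a n) (hn : 19 ≤ n)
    (hn' : n < 128) : (s.nextSmall n).Valid a (n + 1) := by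
  rw [Bounds.nextSmall]
  split_ifs with h1 h2
  · exact h.next (prime_of_gcd_factorial (by omega) (by omega) h1) hn (by norm_num) (by norm_num)
      rfl rfl rfl rfl
  · exact h.next (prime_of_gcd_factorial (by omega) (by omega) h1) hn (by norm_num) (by norm_num)
      rfl rfl rfl rfl
  · exact h.succ_of_not_prime (not_prime_of_gcd_factorial (by omega) h1)

/-- The bounds after treating `n` with `19 ≤ n < 19 + k`. -/
noncomputable def Bounds.runSmall (s : Bounds) (k : ℕ) : Bounds :=
  Nat.rec s (fun k t => Bounds.rec (fun lo hi B used =>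
    Bounds.nextSmall (Nat.add k 19) ⟨lo, hi, B, used⟩) t) k

lemma Bounds.Valid.runSmall {a : ℕ → ℕ} {s : Bounds} (h : s.Valid a 19) {k : ℕ} (hk : k ≤ 109) :
    (s.runSmall k).Valid a (k + 19) := by
  induction k with
  | zero => simpa [Bounds.runSmall] using h
  | succ k ih =>
    rw [add_right_comm]
    exact (ih (by omega)).nextSmall (by omega) (by omega)

/-- The bounds before treating the primes from `19` on. -/
def Bounds.initial : Bounds :=
  ⟨10 ^ 12, 10 ^ 12, 10 ^ 12,
    10 ^ 12 * invCount ((divisorsLE 7).filter fun d => 119 ≤ d) / 510510 + 1⟩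

/-- The bounds after treating the primes below `128`. -/
noncomputable def Bounds.upTo128 : Bounds :=
  Bounds.rec (fun _ hi B used => ⟨0, hi, B, used⟩) (Bounds.initial.runSmall 109)

/-- The bounds after treating the primes below `2 ^ 18`. -/
noncomputable def Bounds.upToPow : Bounds :=
  force (Nat.factorial 127) fun P => force (Nat.factorial 511) fun P' =>
    (Bounds.upTo128.runDyadic 7 5 10637834 1408 P 6 2).runDyadic 10 7 10752000 0 P' 8 9

/-- The test that the bounds suffice for treating all primes from `2 ^ 18` on. -/
noncomputable def Bounds.suffices (s : Bounds) : Bool :=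
  Bounds.rec (fun _ _ B used => Nat.blt
    (Nat.add (Nat.mul used (Nat.mul 51051000 (Nat.pow 2 18))) (Nat.mul (Nat.mul 110 10752000) B))
    (Nat.mul (Nat.pow 10 12) (Nat.mul 51051000 (Nat.pow 2 18)))) s

lemma lcmCount_divisorsLE_four : lcmCount (divisorsLE 4) (divisorsLE 4) = 10637834 := by
  decide +kernel

lemma lcmCount_divisorsLE_seven : lcmCount (divisorsLE 7) (divisorsLE 7) = 10752000 := by
  decide +kernel

lemma invCount_divisorsGT_four : invCount (divisorsGT 4) = 1408 := by decide +kernel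

lemma invCount_divisorsGT_seven : invCount (divisorsGT 7) = 0 := by decide +kernel

lemma suffices_upToPow : Bounds.upToPow.suffices = true := by decide +kernel

lemma sum_residue_le {Q d : ℕ} (hd : d ∣ Q) (r : ℕ) :
    ∑ x ∈ range Q, (if x ≡ r [MOD d] then (1 : ℝ) else 0) ≤ Q * (1 / d) := by
  obtain ⟨e, rfl⟩ := hd
  rcases Nat.eq_zero_or_pos d with rfl | h0
  · simp
  have h0' : (d : ℝ) ≠ 0 := Nat.cast_ne_zero.2 h0.ne'
  rw [sum_range_mul_eq]
  simp only [modEq_add_mul dvd_rfl, sum_const, card_range, nsmul_eq_mul]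
  rw [← mul_sum]
  have h1 : ∑ x ∈ range d, (if x ≡ r [MOD d] then (1 : ℝ) else 0) ≤ 1 := by
    rw [← sum_filter, sum_const, nsmul_eq_mul, mul_one]
    have : #{x ∈ range d | x ≡ r [MOD d]} ≤ 1 := by
      rw [card_le_one]
      intro y hy z hz
      simp only [mem_filter, mem_range] at hy hz
      have h2 := hy.2.trans hz.2.symm
      rwa [Nat.ModEq, Nat.mod_eq_of_lt hy.1, Nat.mod_eq_of_lt hz.1] at h2
    exact_mod_cast this
  calc _ ≤ (e : ℝ) * 1 := by gcongr
    _ = _ := by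
      push_cast
      field_simp

/-- The indicator function of the uncovered set, as a weight. -/
lemma hasWeight_indicator (N : ℕ) (a : ℕ → ℕ) (Q : ℕ) (S : Finset ℕ)
    (hS : ∀ d ∈ S, d ∣ Q) (hS' : ∀ d, d ∣ Q → N ≤ d → d ∈ S) :
    HasWeight N a (fun d => 1 / d) Q (1 - ∑ d ∈ S, 1 / (d : ℝ)) := by
  classical
  set Bad : ℕ → Prop := fun x => ∃ d ∈ S, x ≡ a d [MOD d] with hBad
  refine ⟨fun x => if Bad x then 0 else 1, fun x => ?_, fun x => ?_, fun d hd hN x hx => ?_,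
    fun d hd r => ?_, ?_⟩
  · beta_reduce
    split_ifs <;> norm_num
  · have : Bad (x + Q) ↔ Bad x := exists_congr fun d => and_congr_right fun hd => by
      simpa using modEq_add_mul (hS d hd) x 1 (a d)
    simp only [this]
  · exact if_pos ⟨d, hS' d hd hN, hx⟩
  · refine le_trans (sum_le_sum fun x _ => ?_) (sum_residue_le hd r)
    have : (if Bad x then (0 : ℝ) else 1) ≤ 1 := by split_ifs <;> norm_num
    split_ifs with h
    · exact this
    · simp
  · have h1 : ∀ x, 1 - ∑ d ∈ S, (if x ≡ a d [MOD d] then (1 : ℝ) else 0)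
        ≤ if Bad x then 0 else 1 := by
      intro x
      have h2 : ∀ d ∈ S, (0 : ℝ) ≤ if x ≡ a d [MOD d] then (1 : ℝ) else 0 := fun d _ => by
        split_ifs <;> norm_num
      split_ifs with hx
      · obtain ⟨d, hd, hx⟩ := hx
        have h3 := single_le_sum h2 hd
        rw [if_pos hx] at h3
        linarith
      · linarith [sum_nonneg h2]
    refine le_trans ?_ (sum_le_sum fun x _ => h1 x)
    rw [sum_sub_distrib, sum_const, card_range, nsmul_eq_mul, sum_comm, mul_sub, mul_sum]
    gcongr with d hd
    exact sum_residue_le (hS d hd) _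

lemma valid_initial (a : ℕ → ℕ) : Bounds.initial.Valid a 19 := by
  have hemp : primesFrom19 19 = ∅ := by
    ext q
    rw [mem_primesFrom19]
    simp only [notMem_empty, iff_false]
    omega
  set l := (divisorsLE 7).filter fun d => 119 ≤ d with hl
  have hd : ∀ b ∈ l, b ∣ 510510 := fun b hb => dvd_of_mem_divisorsLE (List.mem_of_mem_filter hb)
  have h7 : ∀ b, b ∣ 510510 → b ∈ divisorsLE 7 := fun b hb =>
    (mem_divisorsLE_or_mem_divisorsGT 7 hb).resolve_right (by
      rw [show divisorsGT 7 = [] by decide +kernel]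
      exact List.not_mem_nil)
  have h := hasWeight_indicator 119 a 510510 l.toFinset
    (fun b hb => hd b (List.mem_toFinset.1 hb)) (fun b hb hN =>
      List.mem_toFinset.2 (List.mem_filter.2 ⟨h7 b hb, decide_eq_true hN⟩))
  rw [cast_invCount ((nodup_divisorsLE 7).sublist List.filter_sublist) hd] at h
  refine ⟨fun q => 1 / q, fun q => by positivity, fun _ _ _ => rfl, ?_, ?_, ?_, ?_⟩
  · rw [hemp, prod_empty, mul_one]
    refine h.mono (fun d hd => (sqfreeMul_eq_inv squarefree_510510 (fun _ _ _ => rfl) hd).ge) ?_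
    have h1 := cast_div_le_succ (10 ^ 12 * invCount l) 510510
    simp only [Bounds.initial, ← hl]
    push_cast at h1 ⊢
    linarith
  all_goals
    rw [hemp]
    norm_num [Bounds.initial]

lemma mul_card_primes_le {k : ℕ} :
    k * #{q ∈ Ioc (2 ^ k) (2 ^ (k + 1)) | q.Prime} ≤ 2 ^ (k + 1) := by
  set s := {q ∈ Ioc (2 ^ k) (2 ^ (k + 1)) | q.Prime} with hs
  have h1 : ∏ q ∈ s, q ∣ (2 ^ k + 2 ^ k).choose (2 ^ k) := by
    refine prod_primes_dvd _ (fun q hq => (mem_filter.1 hq).2.prime) fun q hq => ?_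
    obtain ⟨h, hp⟩ := mem_filter.1 hq
    rw [mem_Ioc] at h
    exact hp.dvd_choose_add h.1 h.1 (h.2.trans (by rw [pow_succ, mul_two]))
  have h2 : (2 ^ k) ^ #s ≤ ∏ q ∈ s, q :=
    pow_card_le_prod _ _ _ fun q hq => (mem_Ioc.1 (mem_filter.1 hq).1).1.le
  have h3 := Nat.le_of_dvd (Nat.choose_pos (Nat.le_add_left _ _)) h1
  have h4 := (h2.trans h3).trans (Nat.choose_le_two_pow _ _)
  rw [← pow_mul, ← mul_two, ← pow_succ] at h4
  exact (Nat.pow_le_pow_iff_right (by norm_num)).1 h4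

lemma one_add_pow_le {k r : ℕ} (hr : (r : ℝ) ≤ 2 ^ k / 9) :
    (1 + 4 / 2 ^ k : ℝ) ^ r ≤ 11 / 7 := by
  have h1 : (1 + 4 / 2 ^ k : ℝ) ≤ Real.exp (4 / 2 ^ k) := by
    rw [add_comm]
    exact Real.add_one_le_exp _
  have h2 : Real.exp (1 / 36) ≤ 36 / 35 := by
    have h3 := Real.add_one_le_exp (-(1 / 36))
    rw [Real.exp_neg] at h3
    rw [show (36 / 35 : ℝ) = (35 / 36)⁻¹ by norm_num]
    rw [le_inv_comm₀ (Real.exp_pos _) (by norm_num)]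
    linarith
  calc _ ≤ Real.exp (4 / 2 ^ k) ^ r := by gcongr
    _ = Real.exp (r * (4 / 2 ^ k)) := (Real.exp_nat_mul _ _).symm
    _ ≤ Real.exp (2 ^ k / 9 * (4 / 2 ^ k)) := by gcongr
    _ = Real.exp ((16 : ℕ) * (1 / 36)) := by
      congr 1
      field_simp
      norm_num
    _ ≤ (36 / 35) ^ 16 := by
      rw [Real.exp_nat_mul]
      gcongr
    _ ≤ 11 / 7 := by norm_num

lemma Reached.step_large {a : ℕ → ℕ} {k p : ℕ} {hi B L : ℝ} (h : Reached a p 0 hi B L)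
    (hp : p.Prime) (hk : 18 ≤ k) (hkp : 2 ^ k < p) :
    ∃ hi', Reached a (p + 1) 0 hi' (B * (1 + 4 / 2 ^ k))
      (L - 4 / 3 * (10752000 / 510510) * B / (2 ^ k) ^ 2) := by
  have hp19 : 19 ≤ p := le_trans (by norm_num)
    ((Nat.pow_le_pow_right (show 0 < 2 by norm_num) hk).trans hkp.le)
  have hB : 0 ≤ B := by
    obtain ⟨f, hf, -, -, -, -, h⟩ := h
    exact (prod_nonneg fun q _ => by linarith [hf q]).trans h
  have key := h.step hp hp19 (u := 4) (v := 3) (by norm_num) (by norm_num)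
    (G := (divisorsLE 7).toFinset) (H := (divisorsGT 7).toFinset) (T := ∅)
    (fun b hb => dvd_of_mem_divisorsLE (List.mem_toFinset.1 hb))
    (fun b hb => dvd_of_mem_divisorsGT (List.mem_toFinset.1 hb))
    (fun b hb => by
      simpa only [List.mem_toFinset] using mem_divisorsLE_or_mem_divisorsGT 7 hb)
    (empty_subset _) (by simp)
  rw [lcmSum_toFinset (nodup_divisorsLE 7) (nodup_divisorsLE 7)
      (fun b => dvd_of_mem_divisorsLE) (fun b => dvd_of_mem_divisorsLE), lcmCount_divisorsLE_seven,
    cast_invCount (nodup_divisorsGT 7) (fun b => dvd_of_mem_divisorsGT),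
    invCount_divisorsGT_seven] at key
  have hkp' : (2 : ℝ) ^ k ≤ p := by exact_mod_cast hkp.le
  have hp0 : (0 : ℝ) < p := by exact_mod_cast hp.pos
  refine ⟨_, key.mono (by simp) le_rfl ?_ ?_⟩
  · calc _ = B * (1 + 4 / p) := by
          field_simp
      _ ≤ _ := by gcongr
  · gcongr ?_ - ?_
    simp only [lcmSum, sum_empty]
    calc _ = 4 / 3 * (10752000 / 510510) * B / p ^ 2 := by
          push_cast
          field_simp
          ring
      _ ≤ _ := by gcongr

lemma Reached.dyadic {a : ℕ → ℕ} {k : ℕ} {hi B L : ℝ} (h : Reached a (2 ^ k + 1) 0 hi B L)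
    (hk : 18 ≤ k) (hL : 11 / 10 * (10752000 / 510510) * B / 2 ^ k < L) :
    ∃ hi' B' L', Reached a (2 ^ (k + 1) + 1) 0 hi' B' L'
      ∧ 11 / 10 * (10752000 / 510510) * B' / 2 ^ (k + 1) < L' := by
  have hB : 0 ≤ B := by
    obtain ⟨f, hf, -, -, -, -, h⟩ := h
    exact (prod_nonneg fun q _ => by linarith [hf q]).trans h
  set t : ℕ → ℕ := fun n => #{q ∈ Ioc (2 ^ k) n | q.Prime} with ht
  have hr : (t (2 ^ (k + 1)) : ℝ) ≤ 2 ^ k / 9 := by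
    have h1 := (Nat.mul_le_mul_right _ hk).trans (mul_card_primes_le (k := k))
    have h2 : (18 : ℝ) * t (2 ^ (k + 1)) ≤ 2 ^ (k + 1) := by exact_mod_cast h1
    have h3 : (2 : ℝ) ^ (k + 1) = 2 ^ k * 2 := pow_succ _ _
    linarith
  have htle : ∀ n ≤ 2 ^ (k + 1), (t n : ℝ) ≤ 2 ^ k / 9 := fun n hn => by
    refine le_trans ?_ hr
    exact_mod_cast card_le_card (filter_subset_filter _ (Ioc_subset_Ioc_right hn))
  have main : ∀ n, 2 ^ k ≤ n → n ≤ 2 ^ (k + 1) → ∃ hi', Reached a (n + 1) 0 hi'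
      (B * (1 + 4 / 2 ^ k) ^ t n)
      (L - t n * (4 / 3 * (10752000 / 510510) * (B * (11 / 7)) / (2 ^ k) ^ 2)) := by
    intro n hn
    induction n, hn using Nat.le_induction with
    | base =>
      intro _
      refine ⟨hi, ?_⟩
      simpa [ht] using h
    | succ n hn ih =>
      intro hn'
      obtain ⟨hi', h'⟩ := ih (by omega)
      have h1 : Ioc (2 ^ k) (n + 1) = insert (n + 1) (Ioc (2 ^ k) n) :=
        (insert_Ioc_right_eq_Ioc_add_one hn).symm
      by_cases hp : (n + 1).Prime
      · have h2 : t (n + 1) = t n + 1 := by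
          simp only [ht]
          rw [h1, filter_insert, if_pos hp, card_insert_of_notMem (by simp)]
        obtain ⟨hi₂, hr₂⟩ := h'.step_large hp hk (by omega)
        refine ⟨hi₂, hr₂.mono le_rfl le_rfl (by rw [h2, pow_succ, mul_assoc]) ?_⟩
        rw [h2, Nat.cast_succ, add_mul, one_mul, ← sub_sub]
        gcongr
        exact one_add_pow_le (htle n (by omega))
      · have h2 : t (n + 1) = t n := by
          simp only [ht]
          rw [h1, filter_insert, if_neg hp]
        rw [h2]
        exact ⟨hi', h'.succ_of_not_prime hp⟩
  obtain ⟨hi', h'⟩ := main _ (Nat.pow_le_pow_right (by norm_num) (Nat.le_succ k)) le_rfl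
  refine ⟨hi', B * (11 / 7), L - 4 / 27 * (10752000 / 510510) * (B * (11 / 7)) / 2 ^ k,
    h'.mono le_rfl le_rfl ?_ ?_, ?_⟩
  · gcongr
    exact one_add_pow_le hr
  · gcongr ?_ - ?_
    calc _ ≤ 2 ^ k / 9 * (4 / 3 * (10752000 / 510510) * (B * (11 / 7)) / (2 ^ k) ^ 2) := by gcongr
      _ = _ := by
        field_simp
        ring
  · have h3 : 0 ≤ B / 2 ^ k := by positivity
    have e1 : ∀ c d : ℝ, c * d * B / 2 ^ k = c * d * (B / 2 ^ k) := fun c d => by ring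
    have e2 : (11 / 10 * (10752000 / 510510) * (B * (11 / 7)) / 2 ^ (k + 1) : ℝ)
        = 121 / 140 * (10752000 / 510510) * (B / 2 ^ k) := by
      rw [pow_succ]
      field_simp
      ring
    have e3 : (4 / 27 * (10752000 / 510510) * (B * (11 / 7)) / 2 ^ k : ℝ)
        = 44 / 189 * (10752000 / 510510) * (B / 2 ^ k) := by
      field_simp
      ring
    rw [e1] at hL
    rw [e2, e3]
    linarith

/-- Forget the lower bound and pass a composite number. -/
lemma Bounds.Valid.forget_lo {a : ℕ → ℕ} {n : ℕ} {s : Bounds} (h : s.Valid a n)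
    (hn : ¬ n.Prime) :
    (Bounds.rec (fun _ hi B used => ⟨0, hi, B, used⟩) s : Bounds).Valid a (n + 1)
      ∧ (Bounds.rec (fun _ hi B used => ⟨0, hi, B, used⟩) s : Bounds).lo = 0 := by
  cases s
  exact ⟨Reached.succ_of_not_prime (h.mono (Nat.zero_le _) le_rfl le_rfl le_rfl) hn, rfl⟩

lemma valid_upTo128 (a : ℕ → ℕ) :
    Bounds.upTo128.Valid a (109 + 19 + 1) ∧ Bounds.upTo128.lo = 0 := by
  have h : (Bounds.initial.runSmall 109).Valid a (109 + 19) :=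
    (valid_initial a).runSmall (Nat.le_refl _)
  unfold Bounds.upTo128
  generalize Bounds.initial.runSmall 109 = s at h ⊢
  have hp : ¬ (109 + 19).Prime := by norm_num
  exact h.forget_lo hp

lemma reached_two_pow_eighteen (a : ℕ → ℕ) : ∃ hi B L, Reached a (2 ^ 18 + 1) 0 hi B L
    ∧ 11 / 10 * (10752000 / 510510) * B / 2 ^ 18 < L := by
  have h1 := valid_upTo128 a
  rw [show 109 + 19 + 1 = 2 ^ (6 + 1) + 1 by norm_num] at h1
  have h2 := Bounds.Valid.runDyadic (K := 127) (u := 7) (v := 5) (by norm_num) (by norm_num)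
    lcmCount_divisorsLE_four invCount_divisorsGT_four 2 h1.1 h1.2 (by norm_num) le_rfl
  have h3 := Bounds.Valid.runDyadic (K := 511) (u := 10) (v := 7) (j := 8) (by norm_num)
    (by norm_num) lcmCount_divisorsLE_seven invCount_divisorsGT_seven 9 h2.1 h2.2 (by norm_num)
    (by norm_num)
  have h4 : Bounds.upToPow.Valid a (2 ^ 18 + 1) ∧ Bounds.upToPow.lo = 0 := by
    rw [Bounds.upToPow, force_eq, force_eq]
    exact h3
  have h5 := suffices_upToPow
  generalize Bounds.upToPow = s at h4 h5
  refine ⟨_, _, _, Reached.mono h4.1 ?_ le_rfl le_rfl le_rfl, ?_⟩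
  · rw [h4.2]
    simp
  · have h6 : s.used * (51051000 * 2 ^ 18) + 110 * 10752000 * s.B
        < 10 ^ 12 * (51051000 * 2 ^ 18) := by
      rw [← Nat.blt_eq]
      exact h5
    have h7 : (s.used * (51051000 * 2 ^ 18) + 110 * 10752000 * s.B : ℝ)
        < 10 ^ 12 * (51051000 * 2 ^ 18) := by exact_mod_cast h6
    linarith

lemma exists_reached_pos (a : ℕ → ℕ) (k : ℕ) (hk : 18 ≤ k) :
    ∃ hi B L, Reached a (2 ^ k + 1) 0 hi B L
      ∧ 11 / 10 * (10752000 / 510510) * B / 2 ^ k < L := by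
  induction k, hk using Nat.le_induction with
  | base => exact reached_two_pow_eighteen a
  | succ k hk ih =>
    obtain ⟨hi, B, L, h, hL⟩ := ih
    exact h.dyadic hk hL

/-- If `a` assigns a residue to every squarefree number, then for every `K` there is an integer
avoiding the classes `a d (mod d)` for all squarefree `d` with `119 ≤ d ≤ K`. -/
lemma exists_not_modEq (a : ℕ → ℕ) (K : ℕ) :
    ∃ x, ∀ d, Squarefree d → 119 ≤ d → d ≤ K → ¬ x ≡ a d [MOD d] := by
  obtain ⟨hi, B, L, h, hL⟩ := exists_reached_pos a (K + 18) (by omega)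
  obtain ⟨f, hf, -, ⟨w, hw0, -, hwz, -, hwL⟩, -, -, hB⟩ := h
  have hB0 : 0 ≤ B := (prod_nonneg fun q _ => by linarith [hf q]).trans hB
  have hL0 : 0 < L := lt_of_le_of_lt
    (div_nonneg (mul_nonneg (by norm_num) hB0) (pow_nonneg (by norm_num) _)) hL
  set Q := 510510 * ∏ q ∈ primesFrom19 (2 ^ (K + 18) + 1), q with hQ
  have hQ0 : 0 < Q := mul_pos (by norm_num) (prod_pos fun q hq => (mem_primesFrom19.1 hq).2.1.pos)
  have hpos : 0 < ∑ x ∈ range Q, w x :=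
    lt_of_lt_of_le (mul_pos (Nat.cast_pos.2 hQ0) hL0) hwL
  obtain ⟨x, -, hx⟩ := exists_ne_zero_of_sum_ne_zero hpos.ne'
  refine ⟨x, fun d hsq hN hK hxd => hx (hwz d ?_ hN x hxd)⟩
  rw [← Nat.prod_primeFactors_of_squarefree hsq]
  refine prod_primes_dvd _ (fun q hq => (Nat.prime_of_mem_primeFactors hq).prime) fun q hq => ?_
  have hp := Nat.prime_of_mem_primeFactors hq
  rcases lt_or_ge q 19 with h | h
  · exact (dvd_510510_of_lt hp h).mul_right _
  · refine (dvd_prod_of_mem _ (mem_primesFrom19.2 ⟨?_, hp, h⟩)).mul_left _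
    have h1 : q ≤ K := (Nat.le_of_mem_primeFactors hq).trans hK
    have h2 : K < 2 ^ K := Nat.lt_two_pow_self
    have h3 : 2 ^ K ≤ 2 ^ (K + 18) := Nat.pow_le_pow_right (by norm_num) (by omega)
    omega

/-- **Theorem 1 (Cummings–Filaseta–Trifonov).**
Every covering system `x ≡ a j (mod m j)`, `j : Fin r`, whose moduli are
distinct squarefree positive integers contains a congruence whose modulus is
at most `118`. -/
theorem minimum_modulus_squarefree_covering_le_118
    (r : ℕ) (a : Fin r → ℤ) (m : Fin r → ℕ)
    (hpos : ∀ j, 0 < m j)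
    (hsf : ∀ j, Squarefree (m j))
    (hdist : Function.Injective m)
    (hcov : ∀ x : ℤ, ∃ j, x ≡ a j [ZMOD (m j)]) :
    ∃ j, m j ≤ 118 := by
  by_contra! hm
  obtain ⟨x, hx⟩ := exists_not_modEq
    (Function.extend m (fun j => (a j % m j).toNat) fun _ => 0) (∑ j, m j)
  obtain ⟨j, hj⟩ := hcov x
  refine hx (m j) (hsf j) (hm j) (single_le_sum (fun _ _ => Nat.zero_le _) (mem_univ j)) ?_
  have h0 : ((a j % m j).toNat : ℤ) = a j % m j :=
    Int.toNat_of_nonneg (Int.emod_nonneg _ (by exact_mod_cast (hpos j).ne'))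
  rw [hdist.extend_apply, ← Int.natCast_modEq_iff, h0]
  exact hj.trans (Int.mod_modEq _ _).symm
end

section
/- For every nonnegative integer k there exists a constant B(k+1) with the following property: whenever x ≡ a_j (mod m_j), 1 ≤ j ≤ r, is a covering system with distinct moduli m_1 < m_2 < ⋯ < m_r, r ≥ k+1, such that the first k congruences x ≡ a_j (mod m_j), 1 ≤ j ≤ k, do not by themselves cover all integers, one has m_{k+1} ≤ B(k+1). -/
namespace CoveringSystem

open Finset

/-- The multiplicative function `m ↦ c ^ ω(m) / m`. -/
noncomputable def omegaWeight (c : ℝ) (m : ℕ) : ℝ := c ^ m.primeFactors.card / m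

lemma omegaWeight_nonneg {c : ℝ} (hc : 0 ≤ c) (m : ℕ) : 0 ≤ omegaWeight c m := by
  unfold omegaWeight; positivity

lemma omegaWeight_one (c : ℝ) : omegaWeight c 1 = 1 := by simp [omegaWeight]

lemma omegaWeight_mul_of_coprime (c : ℝ) {m n : ℕ} (h : m.Coprime n) :
    omegaWeight c (m * n) = omegaWeight c m * omegaWeight c n := by
  unfold omegaWeight
  rw [h.primeFactors_mul, card_union_of_disjoint h.disjoint_primeFactors, pow_add]
  push_cast
  rw [mul_div_mul_comm]

lemma omegaWeight_prime_pow (c : ℝ) {p k : ℕ} (hp : p.Prime) (hk : k ≠ 0) :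
    omegaWeight c (p ^ k) = c / (p : ℝ) ^ k := by
  simp [omegaWeight, Nat.primeFactors_prime_pow hk hp]

lemma hasSum_omegaWeight_prime_pow (c : ℝ) {p : ℕ} (hp : p.Prime) :
    HasSum (fun k : ℕ ↦ omegaWeight c (p ^ k)) (1 + c / (p - 1)) := by
  have hp1 : (1 : ℝ) < p := by exact_mod_cast hp.one_lt
  have h0 : (p : ℝ) ≠ 0 := by positivity
  have h1 : (p : ℝ) - 1 ≠ 0 := by linarith
  have h := (hasSum_geometric_of_lt_one (r := (p : ℝ)⁻¹) (by positivity)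
    (inv_lt_one_of_one_lt₀ hp1)).mul_left (c / p)
  have hval : c / p * (1 - (p : ℝ)⁻¹)⁻¹ = c / (p - 1) := by
    have : 1 - (p : ℝ)⁻¹ = (p - 1) / p := by field_simp
    rw [this, inv_div]; field_simp
  rw [hval] at h
  have htail : HasSum (fun k : ℕ ↦ omegaWeight c (p ^ (k + 1))) (c / (p - 1)) := by
    have heq : (fun k : ℕ ↦ omegaWeight c (p ^ (k + 1))) = fun k ↦ c / p * (p : ℝ)⁻¹ ^ k := by
      funext k
      rw [omegaWeight_prime_pow c hp (by omega), pow_succ, inv_pow]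
      field_simp
    rw [heq]
    exact h
  have h2 := (hasSum_nat_add_iff (f := fun k : ℕ ↦ omegaWeight c (p ^ k)) 1).1 htail
  rwa [sum_range_one, pow_zero, omegaWeight_one, add_comm] at h2

lemma summable_hasSum_omegaWeight_smoothNumbers (c : ℝ) (N : ℕ) :
    Summable (fun m : N.smoothNumbers ↦ omegaWeight c m) ∧
      HasSum (fun m : N.smoothNumbers ↦ omegaWeight c m)
        (∏ p ∈ N.primesBelow, (1 + c / ((p : ℝ) - 1))) := by
  have h := EulerProduct.summable_and_hasSum_smoothNumbers_prod_primesBelow_tsum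
    (f := omegaWeight c) (omegaWeight_one c) (fun h ↦ omegaWeight_mul_of_coprime c h)
    (fun hp ↦ (hasSum_omegaWeight_prime_pow c hp).summable.norm) N
  refine ⟨h.2.summable, ?_⟩
  rw [prod_congr rfl fun p hp ↦
    (hasSum_omegaWeight_prime_pow c (Nat.prime_of_mem_primesBelow hp)).tsum_eq.symm]
  exact h.2

lemma sum_omegaWeight_le_prod {c : ℝ} (hc : 0 ≤ c) (N : ℕ) (D : Finset ℕ)
    (hD : ∀ d ∈ D, d ∈ N.smoothNumbers) :
    ∑ d ∈ D, omegaWeight c d ≤ ∏ p ∈ N.primesBelow, (1 + c / ((p : ℝ) - 1)) := by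
  have h := sum_le_hasSum (D.subtype (· ∈ N.smoothNumbers))
    (fun m _ ↦ omegaWeight_nonneg hc m) (summable_hasSum_omegaWeight_smoothNumbers c N).2
  rwa [sum_subtype_of_mem _ hD] at h

lemma exists_sum_omegaWeight_le (c : ℝ) (N : ℕ) {ε : ℝ} (hε : 0 < ε) :
    ∃ C : ℕ, ∀ D : Finset ℕ, (∀ d ∈ D, d ∈ N.smoothNumbers ∧ C < d) →
      ∑ d ∈ D, omegaWeight c d ≤ ε := by
  obtain ⟨s, hs⟩ := summable_iff_vanishing_norm.1
    (summable_hasSum_omegaWeight_smoothNumbers c N).1 ε hε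
  refine ⟨s.sup (fun m ↦ (m : ℕ)), fun D hD ↦ ?_⟩
  have h := hs (D.subtype (· ∈ N.smoothNumbers)) (by
    rw [disjoint_left]
    intro x hx hxs
    have h1 := (hD x (by simpa using hx)).2
    have h2 := le_sup (f := fun m : N.smoothNumbers ↦ (m : ℕ)) hxs
    omega)
  rw [sum_subtype_of_mem (omegaWeight c) fun d hd ↦ (hD d hd).1] at h
  exact (le_abs_self _).trans h.le

lemma omegaWeight_two_lcm_le {m n : ℕ} (hm : m ≠ 0) (hn : n ≠ 0) :
    omegaWeight 2 (m.lcm n) ≤ omegaWeight 4 (m.gcd n) * omegaWeight 4 (m / m.gcd n) *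
      omegaWeight 4 (n / m.gcd n) := by
  obtain ⟨g, a, b, hg, hab, rfl, rfl⟩ := Nat.exists_coprime' (m := m) (n := n)
    (Nat.gcd_pos_of_pos_left _ (Nat.pos_of_ne_zero hm))
  have ha : a ≠ 0 := by rintro rfl; simp at hm
  have hb : b ≠ 0 := by rintro rfl; simp at hn
  have hgcd : (a * g).gcd (b * g) = g := by
    rw [Nat.gcd_mul_right, hab.gcd_eq_one, one_mul]
  have hlcm : (a * g).lcm (b * g) = a * b * g := by
    rw [Nat.lcm_mul_right, hab.lcm_eq_mul]
  rw [hgcd, hlcm, Nat.mul_div_cancel _ hg, Nat.mul_div_cancel _ hg]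
  unfold omegaWeight
  have hcard : (a * b * g).primeFactors.card ≤
      g.primeFactors.card + a.primeFactors.card + b.primeFactors.card := by
    rw [Nat.primeFactors_mul (by positivity) hg.ne', Nat.primeFactors_mul ha hb]
    calc _ ≤ (a.primeFactors ∪ b.primeFactors).card + g.primeFactors.card := card_union_le _ _
      _ ≤ a.primeFactors.card + b.primeFactors.card + g.primeFactors.card := by
        gcongr; exact card_union_le _ _
      _ = _ := by ring
  have hden : (((a * b * g : ℕ) : ℕ) : ℝ) = g * a * b := by push_cast; ring
  rw [hden, div_mul_div_comm, div_mul_div_comm, ← pow_add, ← pow_add]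
  gcongr
  calc (2 : ℝ) ^ (a * b * g).primeFactors.card
      ≤ 2 ^ (g.primeFactors.card + a.primeFactors.card + b.primeFactors.card) :=
        pow_le_pow_right₀ (by norm_num) hcard
    _ ≤ _ := by gcongr; norm_num

lemma exists_primeCounting_le_linear {ε : ℝ} (hε : 0 < ε) :
    ∃ C : ℝ, 0 ≤ C ∧ ∀ n : ℕ, (Nat.primeCounting n : ℝ) ≤ ε * n + C := by
  have h1 := Chebyshev.eventually_primeCounting_le one_pos
  have h2 : ∀ᶠ x : ℝ in Filter.atTop, (Real.log 4 + 1) / ε ≤ Real.log x :=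
    Real.tendsto_log_atTop.eventually_ge_atTop _
  obtain ⟨X, hX⟩ := ((h1.and h2).and (Filter.eventually_gt_atTop 1)).exists_forall_of_atTop
  refine ⟨Nat.primeCounting ⌈X⌉₊, by positivity, fun n ↦ ?_⟩
  rcases le_total X n with hn | hn
  · obtain ⟨⟨ha, hb⟩, hc⟩ := hX n hn
    have hlog : 0 < Real.log n := Real.log_pos hc
    rw [Nat.floor_natCast] at ha
    have : (Real.log 4 + 1) * n / Real.log n ≤ ε * n := by
      rw [div_le_iff₀ hlog]
      rw [div_le_iff₀ hε] at hb
      have : (0 : ℝ) ≤ n := by positivity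
      nlinarith
    have h3 : (0 : ℝ) ≤ Nat.primeCounting ⌈X⌉₊ := by positivity
    linarith
  · have : Nat.primeCounting n ≤ Nat.primeCounting ⌈X⌉₊ :=
      Nat.monotone_primeCounting (by exact_mod_cast hn.trans (Nat.le_ceil X))
    have h4 : (Nat.primeCounting n : ℝ) ≤ Nat.primeCounting ⌈X⌉₊ := by exact_mod_cast this
    have : 0 ≤ ε * n := by positivity
    linarith

lemma exists_sum_primesBelow_two_pow_inv_le {ε : ℝ} (hε : 0 < ε) :
    ∃ C : ℝ, 0 ≤ C ∧ ∀ k : ℕ, ∑ p ∈ Nat.primesBelow (2 ^ k), (p : ℝ)⁻¹ ≤ ε * k + C := by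
  obtain ⟨C, hC, h⟩ := exists_primeCounting_le_linear (half_pos hε)
  suffices H : ∀ k : ℕ, ∑ p ∈ Nat.primesBelow (2 ^ k), (p : ℝ)⁻¹ ≤
      ε * k + C * ∑ i ∈ range k, (1 / 2 : ℝ) ^ i by
    refine ⟨C * 2, by positivity, fun k ↦ (H k).trans ?_⟩
    gcongr
    exact sum_geometric_two_le k
  intro k
  induction k with
  | zero => simp [Nat.primesBelow, filter_singleton, Nat.not_prime_zero]
  | succ k ih =>
    have hsplit : (Nat.primesBelow (2 ^ (k + 1))) ⊆ Nat.primesBelow (2 ^ k) ∪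
        {p ∈ Nat.primesBelow (2 ^ (k + 1)) | 2 ^ k ≤ p} := by
      intro p hp
      simp only [Nat.primesBelow, mem_union, mem_filter, mem_range] at hp ⊢
      rcases lt_or_ge p (2 ^ k) with h | h
      · exact Or.inl ⟨h, hp.2⟩
      · exact Or.inr ⟨hp, h⟩
    have hcard : (#(Nat.primesBelow (2 ^ (k + 1))) : ℝ) ≤ ε * 2 ^ k + C := by
      have h1 := h (2 ^ (k + 1))
      have h2 : (Nat.primesBelow (2 ^ (k + 1))).card ≤ Nat.primeCounting (2 ^ (k + 1)) := by
        rw [Nat.primesBelow_card_eq_primeCounting']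
        exact Nat.monotone_primeCounting' (Nat.le_succ _)
      have h3 : (#(Nat.primesBelow (2 ^ (k + 1))) : ℝ) ≤ Nat.primeCounting (2 ^ (k + 1)) := by
        exact_mod_cast h2
      push_cast at h1
      rw [pow_succ (2 : ℝ)] at h1
      linarith
    calc ∑ p ∈ Nat.primesBelow (2 ^ (k + 1)), (p : ℝ)⁻¹
        ≤ ∑ p ∈ Nat.primesBelow (2 ^ k) ∪ {p ∈ Nat.primesBelow (2 ^ (k + 1)) | 2 ^ k ≤ p},
            (p : ℝ)⁻¹ :=
          sum_le_sum_of_subset_of_nonneg hsplit fun _ _ _ ↦ by positivity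
      _ ≤ ∑ p ∈ Nat.primesBelow (2 ^ k), (p : ℝ)⁻¹ +
          ∑ p ∈ Nat.primesBelow (2 ^ (k + 1)) with 2 ^ k ≤ p, (p : ℝ)⁻¹ := by
          rw [← sum_union_inter]
          exact le_add_of_nonneg_right (sum_nonneg fun _ _ ↦ by positivity)
      _ ≤ (ε * k + C * ∑ i ∈ range k, (1 / 2 : ℝ) ^ i) + (ε + C * (1 / 2) ^ k) := by
          gcongr
          calc ∑ p ∈ Nat.primesBelow (2 ^ (k + 1)) with 2 ^ k ≤ p, (p : ℝ)⁻¹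
              ≤ ∑ p ∈ Nat.primesBelow (2 ^ (k + 1)) with 2 ^ k ≤ p, ((2 : ℝ) ^ k)⁻¹ := by
                refine sum_le_sum fun p hp ↦ ?_
                have : (2 : ℝ) ^ k ≤ p := by exact_mod_cast (mem_filter.1 hp).2
                gcongr
            _ ≤ (Nat.primesBelow (2 ^ (k + 1))).card * ((2 : ℝ) ^ k)⁻¹ := by
                rw [sum_const, nsmul_eq_mul]
                gcongr
                exact filter_subset _ _
            _ ≤ (ε * 2 ^ k + C) * ((2 : ℝ) ^ k)⁻¹ := by gcongr
            _ = _ := by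
                rw [one_div, inv_pow]; field_simp
      _ = _ := by rw [sum_range_succ]; push_cast; ring

lemma exists_prod_primesBelow_le (c : ℝ) (hc : 0 < c) :
    ∃ K : ℝ, 0 ≤ K ∧ ∀ n : ℕ, 1 ≤ n →
      ∏ p ∈ n.primesBelow, (1 + c / ((p : ℝ) - 1)) ≤ K * (n : ℝ) ^ (1 / 6 : ℝ) := by
  obtain ⟨C, hC, h⟩ := exists_sum_primesBelow_two_pow_inv_le
    (ε := Real.log 2 / (12 * c)) (by positivity)
  have hlog2 : 0 < Real.log 2 := Real.log_pos one_lt_two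
  refine ⟨Real.exp (2 * c * (Real.log 2 / (12 * c) + C)), by positivity, fun n hn ↦ ?_⟩
  have hn0 : (0 : ℝ) < n := by exact_mod_cast hn
  have hfac : ∏ p ∈ n.primesBelow, (1 + c / ((p : ℝ) - 1)) ≤
      Real.exp (2 * c * ∑ p ∈ n.primesBelow, (p : ℝ)⁻¹) := by
    rw [mul_sum, Real.exp_sum]
    refine prod_le_prod (fun p hp ↦ ?_) fun p hp ↦ ?_
    all_goals
      have hp2 : (2 : ℝ) ≤ p := by exact_mod_cast (Nat.prime_of_mem_primesBelow hp).two_le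
    · have : 0 ≤ c / ((p : ℝ) - 1) := div_nonneg hc.le (by linarith)
      linarith
    · have h1 : c / ((p : ℝ) - 1) ≤ 2 * c * (p : ℝ)⁻¹ := by
        rw [← div_eq_mul_inv, div_le_div_iff₀ (by linarith) (by linarith)]
        nlinarith
      have := Real.add_one_le_exp (2 * c * (p : ℝ)⁻¹)
      linarith
  have hk : (Nat.log 2 n : ℝ) * Real.log 2 ≤ Real.log n := by
    rw [← Real.log_pow]
    apply Real.log_le_log (by positivity)
    exact_mod_cast Nat.pow_log_le_self 2 (by omega)
  have hsum : ∑ p ∈ n.primesBelow, (p : ℝ)⁻¹ ≤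
      Real.log 2 / (12 * c) * (Nat.log 2 n + 1 : ℕ) + C := by
    refine le_trans (sum_le_sum_of_subset_of_nonneg ?_ fun _ _ _ ↦ by positivity) (h _)
    intro p hp
    simp only [Nat.primesBelow, mem_filter, mem_range] at hp ⊢
    exact ⟨hp.1.trans (Nat.lt_pow_succ_log_self one_lt_two n), hp.2⟩
  refine hfac.trans ?_
  rw [Real.rpow_def_of_pos hn0, ← Real.exp_add]
  apply Real.exp_le_exp.2
  calc 2 * c * ∑ p ∈ n.primesBelow, (p : ℝ)⁻¹
      ≤ 2 * c * (Real.log 2 / (12 * c) * (Nat.log 2 n + 1 : ℕ) + C) := by gcongr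
    _ = 2 * c * (Real.log 2 / (12 * c) + C) + Nat.log 2 n * Real.log 2 * (1 / 6) := by
        push_cast; field_simp; ring
    _ ≤ _ := by gcongr

lemma sum_comp_le_sum_of_injOn {ι κ : Type*} {s : Finset ι} {t : Finset κ} {j : ι → κ}
    {f : κ → ℝ} (hf : ∀ y, 0 ≤ f y) (hj : Set.InjOn j s) (ht : ∀ x ∈ s, j x ∈ t) :
    ∑ x ∈ s, f (j x) ≤ ∑ y ∈ t, f y := by
  classical
  rw [← sum_image hj]
  exact sum_le_sum_of_subset_of_nonneg (image_subset_iff.2 ht) fun y _ _ ↦ hf y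

lemma sum_omegaWeight_lcm_le {N : ℕ} {M : Finset ℕ} (hM : ∀ m ∈ M, m ∈ N.smoothNumbers) :
    ∑ m ∈ M, ∑ n ∈ M, omegaWeight 2 (m.lcm n) ≤
      (∏ p ∈ N.primesBelow, (1 + 4 / ((p : ℝ) - 1))) ^ 3 := by
  have h4 : ∀ m, 0 ≤ omegaWeight 4 m := omegaWeight_nonneg (by norm_num)
  have hM0 : ∀ m ∈ M, m ≠ 0 := fun m hm ↦ Nat.ne_zero_of_mem_smoothNumbers (hM m hm)
  set G := M.biUnion Nat.divisors with hG
  have hmem : ∀ m ∈ M, ∀ d, d ∣ m → d ∈ G := fun m hm d hd ↦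
    mem_biUnion.2 ⟨m, hm, Nat.mem_divisors.2 ⟨hd, hM0 m hm⟩⟩
  have hGs : ∀ d ∈ G, d ∈ N.smoothNumbers := by
    intro d hd
    obtain ⟨m, hm, hdm⟩ := mem_biUnion.1 hd
    exact Nat.mem_smoothNumbers_of_dvd (hM m hm) (Nat.dvd_of_mem_divisors hdm)
  calc ∑ m ∈ M, ∑ n ∈ M, omegaWeight 2 (m.lcm n)
      ≤ ∑ x ∈ M ×ˢ M, omegaWeight 4 (x.1.gcd x.2) * omegaWeight 4 (x.1 / x.1.gcd x.2) *
          omegaWeight 4 (x.2 / x.1.gcd x.2) := by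
        rw [← sum_product']
        refine sum_le_sum fun x hx ↦ ?_
        rw [mem_product] at hx
        exact omegaWeight_two_lcm_le (hM0 _ hx.1) (hM0 _ hx.2)
    _ ≤ ∑ y ∈ (G ×ˢ G) ×ˢ G, omegaWeight 4 y.1.1 * omegaWeight 4 y.1.2 * omegaWeight 4 y.2 := by
        refine sum_comp_le_sum_of_injOn (j := fun x : ℕ × ℕ ↦
          ((x.1.gcd x.2, x.1 / x.1.gcd x.2), x.2 / x.1.gcd x.2))
          (f := fun y : (ℕ × ℕ) × ℕ ↦ omegaWeight 4 y.1.1 * omegaWeight 4 y.1.2 * omegaWeight 4 y.2)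
          (fun y ↦ mul_nonneg (mul_nonneg (h4 _) (h4 _)) (h4 _)) ?_ ?_
        · rintro ⟨m, n⟩ - ⟨m', n'⟩ - h
          simp only [Prod.mk.injEq] at h ⊢
          obtain ⟨⟨hg, ha⟩, hb⟩ := h
          exact ⟨(Nat.div_mul_cancel (Nat.gcd_dvd_left m n)).symm.trans
              ((congrArg₂ (· * ·) ha hg).trans (Nat.div_mul_cancel (Nat.gcd_dvd_left m' n'))),
            (Nat.div_mul_cancel (Nat.gcd_dvd_right m n)).symm.trans
              ((congrArg₂ (· * ·) hb hg).trans (Nat.div_mul_cancel (Nat.gcd_dvd_right m' n')))⟩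
        · rintro ⟨m, n⟩ hx
          rw [mem_product] at hx
          simp only [mem_product]
          exact ⟨⟨hmem m hx.1 _ (Nat.gcd_dvd_left _ _),
            hmem m hx.1 _ (Nat.div_dvd_of_dvd (Nat.gcd_dvd_left _ _))⟩,
            hmem n hx.2 _ (Nat.div_dvd_of_dvd (Nat.gcd_dvd_right _ _))⟩
    _ = (∑ d ∈ G, omegaWeight 4 d) ^ 3 := by
        rw [sum_product, sum_product]
        simp_rw [← mul_sum, ← sum_mul]
        rw [← sum_mul_sum]
        ring
    _ ≤ _ := by
        gcongr
        · exact sum_nonneg fun d _ ↦ h4 d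
        · exact sum_omegaWeight_le_prod (by norm_num) N G hGs

lemma sum_Icc_inv_pow_le {p : ℕ} (hp : 2 ≤ p) (K : ℕ) :
    ∑ k ∈ Icc 1 K, ((p : ℝ) ^ k)⁻¹ ≤ 2 / p := by
  have hp' : (2 : ℝ) ≤ p := by exact_mod_cast hp
  have hr : (p : ℝ)⁻¹ < 1 := inv_lt_one_of_one_lt₀ (by linarith)
  have hr2 : (p : ℝ)⁻¹ ≤ 1 / 2 := by rw [one_div]; gcongr
  have hgeom : ∑ k ∈ range K, (p : ℝ)⁻¹ ^ k ≤ 2 := by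
    refine (sum_le_sum fun k _ ↦ pow_le_pow_left₀ (by positivity) hr2 k).trans ?_
    exact sum_geometric_two_le K
  calc ∑ k ∈ Icc 1 K, ((p : ℝ) ^ k)⁻¹ = (p : ℝ)⁻¹ * ∑ k ∈ range K, (p : ℝ)⁻¹ ^ k := by
        induction K with
        | zero => simp
        | succ K ih =>
          rw [sum_Icc_succ_top (by lia), ih ?_, sum_range_succ, mul_add, ← pow_succ', inv_pow]
          exact (sum_le_sum_of_subset_of_nonneg (range_mono K.le_succ)
            fun k _ _ ↦ by positivity).trans hgeom
    _ ≤ (p : ℝ)⁻¹ * 2 := by gcongr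
    _ = 2 / p := by ring

lemma sum_inv_ordProj_mul_omegaWeight_lcm_le {p : ℕ} (hp : p.Prime) {T : Finset ℕ}
    (hT : ∀ d ∈ T, p ∣ d ∧ d ∈ (p + 1).smoothNumbers) :
    ∑ d ∈ T, ∑ e ∈ T, ((p : ℝ) ^ d.factorization p)⁻¹ * ((p : ℝ) ^ e.factorization p)⁻¹ *
        omegaWeight 2 ((ordCompl[p] d).lcm (ordCompl[p] e)) ≤
      (2 / p) ^ 2 * (∏ q ∈ p.primesBelow, (1 + 4 / ((q : ℝ) - 1))) ^ 3 := by
  have hT0 : ∀ d ∈ T, d ≠ 0 := fun d hd ↦ Nat.ne_zero_of_mem_smoothNumbers (hT d hd).2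
  set K := T.sup (fun d ↦ d.factorization p)
  set M := T.image (fun d ↦ ordCompl[p] d)
  have hM : ∀ m ∈ M, m ∈ p.smoothNumbers := by
    intro m hm
    obtain ⟨d, hd, rfl⟩ := mem_image.1 hm
    rw [Nat.mem_smoothNumbers']
    intro q hq hqd
    have h1 := Nat.mem_smoothNumbers'.1 (hT d hd).2 q hq (hqd.trans (Nat.ordCompl_dvd d p))
    refine lt_of_le_of_ne (Nat.lt_succ_iff.1 h1) ?_
    rintro rfl
    exact hq.coprime_iff_not_dvd.1 (Nat.coprime_ordCompl hq (hT0 d hd)) hqd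
  have hinj : Set.InjOn (fun d ↦ (d.factorization p, ordCompl[p] d)) (T : Set ℕ) := by
    intro d _ e _ h
    simp only [Prod.mk.injEq] at h
    exact (Nat.ordProj_mul_ordCompl_eq_self d p).symm.trans
      ((congrArg₂ (fun k l ↦ p ^ k * l) h.1 h.2).trans (Nat.ordProj_mul_ordCompl_eq_self e p))
  have hmap : ∀ d ∈ T, (d.factorization p, ordCompl[p] d) ∈ Icc 1 K ×ˢ M := fun d hd ↦
    mem_product.2 ⟨mem_Icc.2 ⟨hp.factorization_pos_of_dvd (hT0 d hd) (hT d hd).1,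
      le_sup (f := fun d ↦ d.factorization p) hd⟩, mem_image_of_mem _ hd⟩
  have hnn : ∀ m, 0 ≤ omegaWeight 2 m := omegaWeight_nonneg (by norm_num)
  let f : (ℕ × ℕ) × (ℕ × ℕ) → ℝ := fun y ↦
    ((p : ℝ) ^ y.1.1)⁻¹ * ((p : ℝ) ^ y.2.1)⁻¹ * omegaWeight 2 (y.1.2.lcm y.2.2)
  calc _ = ∑ x ∈ T ×ˢ T, f ((x.1.factorization p, ordCompl[p] x.1),
          (x.2.factorization p, ordCompl[p] x.2)) := by rw [sum_product]
    _ ≤ ∑ y ∈ (Icc 1 K ×ˢ M) ×ˢ (Icc 1 K ×ˢ M), f y := by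
        refine sum_comp_le_sum_of_injOn (f := f) (j := fun x : ℕ × ℕ ↦
          ((x.1.factorization p, ordCompl[p] x.1), (x.2.factorization p, ordCompl[p] x.2)))
          (fun y ↦ mul_nonneg (by positivity) (hnn _)) ?_ ?_
        · rintro ⟨d, e⟩ hx ⟨d', e'⟩ hx' h
          rw [mem_coe, mem_product] at hx hx'
          rw [Prod.mk.injEq] at h
          rw [Prod.mk.injEq]
          exact ⟨hinj hx.1 hx'.1 h.1, hinj hx.2 hx'.2 h.2⟩
        · rintro ⟨d, e⟩ hx
          rw [mem_product] at hx
          exact mem_product.2 ⟨hmap d hx.1, hmap e hx.2⟩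
    _ = (∑ k ∈ Icc 1 K, ((p : ℝ) ^ k)⁻¹) ^ 2 * ∑ m ∈ M, ∑ n ∈ M, omegaWeight 2 (m.lcm n) := by
        simp only [f, sum_product]
        rw [sq, sum_mul_sum, sum_mul]
        refine sum_congr rfl fun k _ ↦ ?_
        rw [sum_comm, sum_mul]
        refine sum_congr rfl fun l _ ↦ ?_
        rw [mul_sum]
        refine sum_congr rfl fun m _ ↦ ?_
        rw [mul_sum]
    _ ≤ _ := by
        gcongr
        · exact sum_nonneg fun m _ ↦ sum_nonneg fun n _ ↦ hnn _
        · exact sum_Icc_inv_pow_le hp.two_le K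
        · exact sum_omegaWeight_lcm_le hM

section Distortion

variable {Q : ℕ}

/-- The average of `f` over the translates of `x` in the `p`-primary part of `ZMod Q`. -/
noncomputable def fiberAvg (p : ℕ) (f : ZMod Q → ℝ) (x : ZMod Q) : ℝ :=
  (∑ t ∈ range (ordProj[p] Q), f (x + t * (ordCompl[p] Q : ℕ))) / (ordProj[p] Q : ℕ)

/-- `f` is invariant under translation by the `p`-primary part of `ZMod Q`. -/
def FiberInvariant (p : ℕ) (f : ZMod Q → ℝ) : Prop :=
  ∀ x, f (x + (ordCompl[p] Q : ℕ)) = f x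

lemma FiberInvariant.add_mul {p : ℕ} {f : ZMod Q → ℝ} (hf : FiberInvariant p f) (x : ZMod Q)
    (t : ℕ) : f (x + t * (ordCompl[p] Q : ℕ)) = f x := by
  induction t with
  | zero => simp
  | succ t ih =>
    rw [← ih, ← hf (x + t * _)]
    congr 1
    push_cast
    ring

lemma fiberInvariant_of_ordProj_eq_one {p : ℕ} (h : ordProj[p] Q = 1) (f : ZMod Q → ℝ) :
    FiberInvariant p f := by
  intro x
  rw [h, Nat.div_one, ZMod.natCast_self, add_zero]

lemma fiberInvariant_of_not_prime {p : ℕ} (h : ¬ p.Prime) (f : ZMod Q → ℝ) :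
    FiberInvariant p f :=
  fiberInvariant_of_ordProj_eq_one (by simp [Nat.factorization_eq_zero_of_not_prime _ h]) f

lemma ordProj_pos' [NeZero Q] (p : ℕ) : (0 : ℝ) < (ordProj[p] Q : ℕ) := by
  exact_mod_cast Nat.ordProj_pos Q p

lemma fiberInvariant_fiberAvg [NeZero Q] (p : ℕ) (f : ZMod Q → ℝ) :
    FiberInvariant p (fiberAvg p f) := by
  intro x
  unfold fiberAvg
  congr 1
  have h := (sum_range_succ' (fun t : ℕ ↦ f (x + t * (ordCompl[p] Q : ℕ)))
    (ordProj[p] Q)).symm.trans (sum_range_succ _ _)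
  have hQ : ((ordProj[p] Q : ℕ) : ZMod Q) * (ordCompl[p] Q : ℕ) = 0 := by
    rw [← Nat.cast_mul, Nat.ordProj_mul_ordCompl_eq_self, ZMod.natCast_self]
  rw [hQ, Nat.cast_zero, zero_mul] at h
  rw [← add_right_cancel h]
  refine sum_congr rfl fun t _ ↦ ?_
  congr 1
  push_cast
  ring

lemma FiberInvariant.fiberAvg {p : ℕ} (q : ℕ) {f : ZMod Q → ℝ} (hf : FiberInvariant p f) :
    FiberInvariant p (fiberAvg q f) := by
  intro x
  unfold CoveringSystem.fiberAvg
  congr 1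
  refine sum_congr rfl fun t _ ↦ ?_
  rw [← hf (x + t * _)]
  congr 1
  ring

lemma fiberAvg_congr {p : ℕ} {f g : ZMod Q → ℝ} {x : ZMod Q}
    (h : ∀ t : ℕ, f (x + t * (ordCompl[p] Q : ℕ)) = g (x + t * (ordCompl[p] Q : ℕ))) :
    fiberAvg p f x = fiberAvg p g x := by
  unfold fiberAvg
  rw [sum_congr rfl fun t _ ↦ h t]

lemma fiberAvg_mul {p : ℕ} {f : ZMod Q → ℝ} (hf : FiberInvariant p f)
    (g : ZMod Q → ℝ) (x : ZMod Q) :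
    fiberAvg p (fun y ↦ f y * g y) x = f x * fiberAvg p g x := by
  unfold fiberAvg
  simp_rw [hf.add_mul, ← mul_sum, mul_div_assoc]

lemma fiberAvg_of_invariant [NeZero Q] {p : ℕ} {f : ZMod Q → ℝ} (hf : FiberInvariant p f)
    (x : ZMod Q) : fiberAvg p f x = f x := by
  have h := (ordProj_pos' (Q := Q) p).ne'
  unfold fiberAvg
  simp_rw [hf.add_mul, sum_const, card_range, nsmul_eq_mul]
  field_simp

lemma fiberAvg_mono [NeZero Q] (p : ℕ) {f g : ZMod Q → ℝ} (h : ∀ x, f x ≤ g x) (x : ZMod Q) :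
    fiberAvg p f x ≤ fiberAvg p g x := by
  unfold fiberAvg
  gcongr
  exact h _

lemma fiberAvg_add (p : ℕ) (f g : ZMod Q → ℝ) (x : ZMod Q) :
    fiberAvg p (fun y ↦ f y + g y) x = fiberAvg p f x + fiberAvg p g x := by
  unfold fiberAvg
  rw [sum_add_distrib, add_div]

lemma fiberAvg_sum {ι : Type*} (s : Finset ι) (p : ℕ) (f : ι → ZMod Q → ℝ) (x : ZMod Q) :
    fiberAvg p (fun y ↦ ∑ i ∈ s, f i y) x = ∑ i ∈ s, fiberAvg p (f i) x := by
  unfold fiberAvg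
  rw [sum_comm, sum_div]

lemma sum_fiberAvg [NeZero Q] (p : ℕ) (f : ZMod Q → ℝ) :
    ∑ x, fiberAvg p f x = ∑ x, f x := by
  have h := (ordProj_pos' (Q := Q) p).ne'
  unfold fiberAvg
  rw [← sum_div, sum_comm]
  have htrans : ∀ t : ℕ, ∑ x, f (x + t * (ordCompl[p] Q : ℕ)) = ∑ x, f x := fun t ↦
    Equiv.sum_comp (Equiv.addRight ((t : ZMod Q) * (ordCompl[p] Q : ℕ))) f
  simp_rw [htrans]
  rw [sum_const, card_range, nsmul_eq_mul]
  field_simp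

/-- The distortion factor applied to a point of a fibre in which the set to be avoided, with
indicator value `b` at the point, has density `α`. -/
noncomputable def distortion (α b : ℝ) : ℝ :=
  if α < 1 / 2 then (1 - b) / (1 - α) else (2 * α - b) / α

lemma distortion_nonneg {α b : ℝ} (hb : b ≤ 1) : 0 ≤ distortion α b := by
  unfold distortion
  split_ifs with h
  · exact div_nonneg (by linarith) (by linarith)
  · exact div_nonneg (by linarith) (by linarith)

lemma distortion_le_two {α b : ℝ} (hb : 0 ≤ b) : distortion α b ≤ 2 := by
  unfold distortion
  split_ifs with h
  · rw [div_le_iff₀ (by linarith)]; linarith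
  · rw [div_le_iff₀ (by linarith)]; linarith

lemma distortion_one_le {α : ℝ} (hα : α ≤ 1) : distortion α 1 ≤ 1 := by
  unfold distortion
  split_ifs with h
  · simp
  · rw [div_le_iff₀ (by linarith)]; linarith

lemma mul_distortion_one_le (α : ℝ) : α * distortion α 1 ≤ α ^ 2 := by
  unfold distortion
  split_ifs with h
  · simp; positivity
  · rw [mul_div_cancel₀ _ (by linarith)]; nlinarith [sq_nonneg (α - 1)]

/-- The weight obtained from the uniform one by distorting it along the fibres of
`0, 1, …, n - 1` successively, so that the sets with indicators `b 0, …, b (n - 1)` get small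
weight. -/
noncomputable def weight (b : ℕ → ZMod Q → ℝ) : ℕ → ZMod Q → ℝ
  | 0, _ => 1
  | n + 1, x => weight b n x * distortion (fiberAvg n (b n) x) (b n x)

variable {b : ℕ → ZMod Q → ℝ}

lemma fiberAvg_mem_Icc [NeZero Q] {p : ℕ} {f : ZMod Q → ℝ} (hf : ∀ x, f x = 0 ∨ f x = 1)
    (x : ZMod Q) : 0 ≤ fiberAvg p f x ∧ fiberAvg p f x ≤ 1 := by
  have hpos := ordProj_pos' (Q := Q) p
  unfold fiberAvg
  refine ⟨div_nonneg (sum_nonneg fun t _ ↦ ?_) hpos.le, (div_le_one hpos).2 ?_⟩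
  · rcases hf (x + t * (ordCompl[p] Q : ℕ)) with h | h <;> simp [h]
  · refine (sum_le_card_nsmul _ _ 1 fun t _ ↦ ?_).trans (by simp)
    rcases hf (x + t * (ordCompl[p] Q : ℕ)) with h | h <;> simp [h]

section Invariant

variable (hinv : ∀ n p, n < p → FiberInvariant p (b n))

include hinv

lemma fiberInvariant_weight (n p : ℕ) (h : n ≤ p) : FiberInvariant p (weight b n) := by
  induction n with
  | zero => exact fun _ ↦ rfl
  | succ n ih =>
    intro x
    rw [weight, weight, ih (by omega) x, (hinv n p (by omega)).fiberAvg n x,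
      hinv n p (by omega) x]

lemma fiberAvg_weight_succ [NeZero Q] (n : ℕ) (x : ZMod Q) :
    fiberAvg n (weight b (n + 1)) x = weight b n x := by
  have h1 : fiberAvg n (weight b (n + 1)) x = weight b n x *
      fiberAvg n (fun y ↦ distortion (fiberAvg n (b n) y) (b n y)) x :=
    fiberAvg_mul (fiberInvariant_weight hinv n n le_rfl) _ x
  rw [h1]
  suffices H : fiberAvg n (fun y ↦ distortion (fiberAvg n (b n) y) (b n y)) x = 1 by
    rw [H, mul_one]
  have hstep : fiberAvg n (fun y ↦ distortion (fiberAvg n (b n) y) (b n y)) x =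
      fiberAvg n (fun y ↦ distortion (fiberAvg n (b n) x) (b n y)) x :=
    fiberAvg_congr fun t ↦ by rw [(fiberInvariant_fiberAvg n (b n)).add_mul]
  rw [hstep]
  set α := fiberAvg n (b n) x with hdef
  have hlin : ∀ c d : ℝ, fiberAvg n (fun y ↦ c + d * b n y) x = c + d * α := by
    intro c d
    rw [fiberAvg_add, fiberAvg_mul (f := fun _ ↦ d) (fun _ ↦ rfl),
      fiberAvg_of_invariant (f := fun _ ↦ c) (fun _ ↦ rfl)]
  by_cases h : α < 1 / 2
  · have : (fun y ↦ distortion α (b n y)) = fun y ↦ 1 / (1 - α) + (-1 / (1 - α)) * b n y := by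
      funext y; rw [distortion, if_pos h]; ring
    rw [this, hlin]
    have : 1 - α ≠ 0 := by linarith
    field_simp
    ring
  · have : (fun y ↦ distortion α (b n y)) = fun y ↦ 2 * α / α + (-1 / α) * b n y := by
      funext y; rw [distortion, if_neg h]; ring
    rw [this, hlin]
    have : α ≠ 0 := by linarith
    field_simp
    ring

lemma sum_weight_succ_mul [NeZero Q] {n : ℕ} {f : ZMod Q → ℝ} (hf : FiberInvariant n f) :
    ∑ x, weight b (n + 1) x * f x = ∑ x, weight b n x * f x := by
  rw [← sum_fiberAvg n]
  refine sum_congr rfl fun x _ ↦ ?_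
  simp_rw [mul_comm _ (f _)]
  rw [fiberAvg_mul hf, fiberAvg_weight_succ hinv]

lemma sum_weight_mul_fiberAvg [NeZero Q] (n : ℕ) (f : ZMod Q → ℝ) :
    ∑ x, weight b n x * f x = ∑ x, weight b n x * fiberAvg n f x := by
  rw [← sum_fiberAvg n]
  exact sum_congr rfl fun x _ ↦ fiberAvg_mul (fiberInvariant_weight hinv n n le_rfl) _ x

lemma sum_weight_mul_of_lt [NeZero Q] {n N : ℕ} (h : n < N) :
    ∑ x, weight b N x * b n x = ∑ x, weight b (n + 1) x * b n x := by
  induction N, h using Nat.le_induction with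
  | base => rfl
  | succ N hN ih => rw [sum_weight_succ_mul hinv (hinv n N hN), ih]

lemma sum_weight [NeZero Q] (n : ℕ) : ∑ x, weight b n x = Q := by
  induction n with
  | zero => simp [weight, ZMod.card]
  | succ n ih =>
    rw [← ih]
    simpa using sum_weight_succ_mul hinv (n := n) (f := fun _ ↦ 1) fun _ ↦ rfl

end Invariant

section Indicator

variable (hb : ∀ n x, b n x = 0 ∨ b n x = 1)

include hb

lemma weight_nonneg (n : ℕ) (x : ZMod Q) : 0 ≤ weight b n x := by
  induction n with
  | zero => simp [weight]
  | succ n ih =>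
    refine mul_nonneg ih (distortion_nonneg ?_)
    rcases hb n x with h | h <;> simp [h]

lemma weight_succ_le (n : ℕ) (x : ZMod Q) : weight b (n + 1) x ≤ 2 * weight b n x := by
  rw [weight, mul_comm]
  refine mul_le_mul_of_nonneg_right (distortion_le_two ?_) (weight_nonneg hb n x)
  rcases hb n x with h | h <;> simp [h]

lemma sum_weight_succ_mul_self_le [NeZero Q] (n : ℕ) :
    ∑ x, weight b (n + 1) x * b n x ≤ ∑ x, weight b n x * b n x := by
  refine sum_le_sum fun x _ ↦ ?_
  rw [weight]
  rcases hb n x with h | h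
  · simp [h]
  · rw [h, mul_one, mul_one]
    exact mul_le_of_le_one_right (weight_nonneg hb n x)
      (distortion_one_le (fiberAvg_mem_Icc (hb n) x).2)

variable (hinv : ∀ n p, n < p → FiberInvariant p (b n))

include hinv

lemma sum_weight_succ_mul_self_le_sq [NeZero Q] (n : ℕ) :
    ∑ x, weight b (n + 1) x * b n x ≤ ∑ x, weight b n x * fiberAvg n (b n) x ^ 2 := by
  have h1 : ∀ x, weight b (n + 1) x * b n x =
      weight b n x * (distortion (fiberAvg n (b n) x) 1 * b n x) := by
    intro x
    rw [weight]
    rcases hb n x with h | h <;> simp [h]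
  simp_rw [h1]
  rw [sum_weight_mul_fiberAvg hinv]
  refine sum_le_sum fun x _ ↦ mul_le_mul_of_nonneg_left ?_ (weight_nonneg hb n x)
  have hI : FiberInvariant n fun y ↦ distortion (fiberAvg n (b n) y) 1 := by
    intro y
    dsimp only
    rw [fiberInvariant_fiberAvg n (b n) y]
  rw [fiberAvg_mul hI, mul_comm]
  exact mul_distortion_one_le _

/-- If the total weight of the sets with indicators `b 0, …, b (N - 1)` is less than the total
weight, then these sets do not cover `ZMod Q`. -/
lemma exists_forall_eq_zero [NeZero Q] (N : ℕ)
    (h : ∑ n ∈ range N, ∑ x, weight b (n + 1) x * b n x < Q) :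
    ∃ x, ∀ n < N, b n x = 0 := by
  by_contra! hcon
  refine h.not_ge ?_
  rw [sum_congr rfl fun n hn ↦ (sum_weight_mul_of_lt hinv (mem_range.1 hn)).symm,
    sum_comm, ← sum_weight hinv N]
  refine sum_le_sum fun x _ ↦ ?_
  rw [← mul_sum]
  obtain ⟨n, hn, hne⟩ := hcon x
  refine le_mul_of_one_le_right (weight_nonneg hb N x) ?_
  calc (1 : ℝ) = b n x := ((hb n x).resolve_left hne).symm
    _ ≤ _ := single_le_sum (f := fun n ↦ b n x)
      (fun i _ ↦ by rcases hb i x with h | h <;> simp [h]) (mem_range.2 hn)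

end Indicator

lemma natCast_dvd_intCast_iff {m : ℕ} (hm : m ∣ Q) (z : ℤ) :
    (m : ZMod Q) ∣ (z : ZMod Q) ↔ (m : ℤ) ∣ z := by
  constructor
  · rintro ⟨c, hc⟩
    obtain ⟨c, rfl⟩ := ZMod.intCast_surjective c
    have h : ((z - m * c : ℤ) : ZMod Q) = 0 := by
      push_cast
      rw [hc, sub_self]
    have h1 := (Int.natCast_dvd_natCast.2 hm).trans ((ZMod.intCast_zmod_eq_zero_iff_dvd _ _).1 h)
    exact (dvd_sub_left (dvd_mul_right _ _)).1 h1
  · rintro ⟨c, rfl⟩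
    exact ⟨c, by push_cast; rfl⟩

open Classical in
/-- The indicator function of the residue class of `a` modulo `m` in `ZMod Q`. -/
noncomputable def classIndicator (m : ℕ) (a x : ZMod Q) : ℝ :=
  if (m : ZMod Q) ∣ x - a then 1 else 0

lemma classIndicator_nonneg (m : ℕ) (a x : ZMod Q) : 0 ≤ classIndicator m a x := by
  unfold classIndicator; split_ifs <;> norm_num

lemma classIndicator_le_one (m : ℕ) (a x : ZMod Q) : classIndicator m a x ≤ 1 := by
  unfold classIndicator; split_ifs <;> norm_num

lemma fiberInvariant_classIndicator {m p : ℕ} (hp : p.Prime) (hpm : ¬ p ∣ m) (hm : m ∣ Q)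
    (a : ZMod Q) : FiberInvariant p (classIndicator m a) := by
  intro x
  have h : m ∣ ordCompl[p] Q :=
    (Nat.Coprime.pow_right _ ((hp.coprime_iff_not_dvd.2 hpm).symm)).dvd_of_dvd_mul_left
      ((Nat.ordProj_mul_ordCompl_eq_self Q p).symm ▸ hm)
  have h' : (m : ZMod Q) ∣ (ordCompl[p] Q : ℕ) := Nat.cast_dvd_cast h
  unfold classIndicator
  rw [show x + (ordCompl[p] Q : ℕ) - a = x - a + (ordCompl[p] Q : ℕ) by ring, dvd_add_left h']

lemma card_filter_dvd_translate_le [NeZero Q] {p k : ℕ} (hp : p.Prime) (hk : p ^ k ∣ Q)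
    (y : ZMod Q) [DecidablePred fun t : ℕ ↦
      ((p ^ k : ℕ) : ZMod Q) ∣ y + t * (ordCompl[p] Q : ℕ)] :
    #{t ∈ range (ordProj[p] Q) | ((p ^ k : ℕ) : ZMod Q) ∣ y + (t : ℕ) * (ordCompl[p] Q : ℕ)} ≤
      ordProj[p] Q / p ^ k := by
  rcases (Finset.filter (fun t : ℕ ↦ ((p ^ k : ℕ) : ZMod Q) ∣ y + t * (ordCompl[p] Q : ℕ))
    (range (ordProj[p] Q))).eq_empty_or_nonempty with h | ⟨t₀, ht₀⟩
  · rw [h]; simp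
  have hkf : p ^ k ∣ ordProj[p] Q :=
    pow_dvd_pow _ ((hp.pow_dvd_iff_le_factorization (NeZero.ne Q)).1 hk)
  have hcount := Nat.count_modEq_card (ordProj[p] Q) (pow_pos hp.pos k) t₀
  rw [Nat.mod_eq_zero_of_dvd hkf, if_neg (Nat.not_lt_zero _), add_zero,
    Nat.count_eq_card_filter_range] at hcount
  rw [← hcount]
  refine card_le_card fun t ht ↦ ?_
  rw [mem_filter] at ht ht₀ ⊢
  refine ⟨ht.1, ?_⟩
  have h1 := dvd_sub ht.2 ht₀.2
  rw [show y + (t : ZMod Q) * (ordCompl[p] Q : ℕ) - (y + t₀ * (ordCompl[p] Q : ℕ)) =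
    (((t - t₀ : ℤ) * (ordCompl[p] Q : ℕ) : ℤ) : ZMod Q) by
      simp only [Int.cast_mul, Int.cast_sub, Int.cast_natCast]; ring,
    natCast_dvd_intCast_iff hk] at h1
  have hcop : IsCoprime ((p ^ k : ℕ) : ℤ) ((ordCompl[p] Q : ℕ) : ℤ) :=
    Nat.isCoprime_iff_coprime.2 ((Nat.coprime_ordCompl hp (NeZero.ne Q)).pow_left k)
  exact ((Nat.modEq_iff_dvd).2 (hcop.dvd_of_dvd_mul_right h1)).symm

lemma fiberAvg_classIndicator_le [NeZero Q] {m p k : ℕ} (hp : p.Prime) (hpm : ¬ p ∣ m)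
    (hm : p ^ k * m ∣ Q) (a x : ZMod Q) :
    fiberAvg p (classIndicator (p ^ k * m) a) x ≤ ((p : ℝ) ^ k)⁻¹ * classIndicator m a x := by
  classical
  have hpos := ordProj_pos' (Q := Q) p
  have hkQ : p ^ k ∣ Q := (dvd_mul_right _ _).trans hm
  have hkf : p ^ k ∣ ordProj[p] Q :=
    pow_dvd_pow _ ((hp.pow_dvd_iff_le_factorization (NeZero.ne Q)).1 hkQ)
  have hinv := fiberInvariant_classIndicator hp hpm ((dvd_mul_left _ _).trans hm) a
  have hle : ∀ y, classIndicator (p ^ k * m) a y ≤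
      classIndicator m a y * classIndicator (p ^ k) a y := by
    intro y
    unfold classIndicator
    by_cases h : ((p ^ k * m : ℕ) : ZMod Q) ∣ y - a
    · simp only [h, (Nat.cast_dvd_cast (dvd_mul_right (p ^ k) m)).trans h,
        (Nat.cast_dvd_cast (dvd_mul_left m (p ^ k))).trans h, if_true, mul_one, le_refl]
    · rw [if_neg h]
      split_ifs <;> norm_num
  refine (fiberAvg_mono p hle x).trans ?_
  rw [fiberAvg_mul hinv, mul_comm]
  refine mul_le_mul_of_nonneg_right ?_ (classIndicator_nonneg _ _ _)
  have hcard := card_filter_dvd_translate_le hp hkQ (x - a)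
  have hsum : ∑ t ∈ range (ordProj[p] Q), classIndicator (p ^ k) a (x + t * (ordCompl[p] Q : ℕ)) =
      (#{t ∈ range (ordProj[p] Q) |
        ((p ^ k : ℕ) : ZMod Q) ∣ x - a + (t : ℕ) * (ordCompl[p] Q : ℕ)} : ℕ) := by
    rw [card_filter, Nat.cast_sum]
    refine sum_congr rfl fun t _ ↦ ?_
    unfold classIndicator
    rw [add_sub_right_comm]
    split_ifs <;> simp
  unfold fiberAvg
  rw [hsum, div_le_iff₀ hpos]
  refine (Nat.cast_le.2 hcard).trans ?_
  have hpk : ((p ^ k : ℕ) : ℝ) ≠ 0 := by exact_mod_cast (pow_pos hp.pos k).ne'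
  rw [Nat.cast_div hkf hpk, div_eq_inv_mul]
  push_cast
  rfl

lemma ordCompl_not_dvd {p m : ℕ} (hp : p.Prime) (hm : m ≠ 0) : ¬ p ∣ ordCompl[p] m :=
  hp.coprime_iff_not_dvd.1 (Nat.coprime_ordCompl hp hm)

lemma fiberAvg_classIndicator_le_ordCompl [NeZero Q] {p m : ℕ} (hp : p.Prime) (hm : m ∣ Q)
    (a x : ZMod Q) :
    fiberAvg p (classIndicator m a) x ≤
      ((p : ℝ) ^ m.factorization p)⁻¹ * classIndicator (ordCompl[p] m) a x := by
  have h := fiberAvg_classIndicator_le (m := ordCompl[p] m) (k := m.factorization p) hp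
    (ordCompl_not_dvd hp (ne_zero_of_dvd_ne_zero (NeZero.ne Q) hm))
    (by rwa [Nat.ordProj_mul_ordCompl_eq_self]) a x
  rwa [Nat.ordProj_mul_ordCompl_eq_self] at h

lemma omegaWeight_eq_mul_ordCompl (c : ℝ) {p m : ℕ} (hp : p.Prime) (hm : m ≠ 0) (hpm : p ∣ m) :
    omegaWeight c m = c * ((p : ℝ) ^ m.factorization p)⁻¹ * omegaWeight c (ordCompl[p] m) := by
  conv_lhs => rw [← Nat.ordProj_mul_ordCompl_eq_self m p]
  rw [omegaWeight_mul_of_coprime c ((Nat.coprime_ordCompl hp hm).pow_left _),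
    omegaWeight_prime_pow c hp (hp.factorization_pos_of_dvd hm hpm).ne', div_eq_mul_inv]

lemma sum_classIndicator_le [NeZero Q] {m : ℕ} (hm : m ∣ Q) (a : ZMod Q) :
    ∑ x, classIndicator m a x ≤ Q * omegaWeight 2 m := by
  induction m using Nat.strong_induction_on with
  | _ m ih =>
    have hm0 := ne_zero_of_dvd_ne_zero (NeZero.ne Q) hm
    rcases eq_or_ne m 1 with rfl | h1
    · rw [omegaWeight_one, mul_one]
      refine (sum_le_card_nsmul _ _ 1 fun x _ ↦ classIndicator_le_one 1 a x).trans ?_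
      simp [ZMod.card]
    · obtain ⟨p, hp, hpm⟩ := Nat.exists_prime_and_dvd h1
      have hlt : ordCompl[p] m < m :=
        Nat.div_lt_self (Nat.pos_of_ne_zero hm0)
          (Nat.one_lt_pow (hp.factorization_pos_of_dvd hm0 hpm).ne' hp.one_lt)
      rw [← sum_fiberAvg p]
      refine (sum_le_sum fun x _ ↦ fiberAvg_classIndicator_le_ordCompl hp hm a x).trans ?_
      rw [← mul_sum, omegaWeight_eq_mul_ordCompl 2 hp hm0 hpm]
      have h := ih _ hlt ((Nat.ordCompl_dvd m p).trans hm)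
      have hnn := omegaWeight_nonneg zero_le_two (ordCompl[p] m)
      have hQ : (0 : ℝ) ≤ Q := by positivity
      calc _ ≤ ((p : ℝ) ^ m.factorization p)⁻¹ * (Q * omegaWeight 2 (ordCompl[p] m)) := by gcongr
        _ = 1 * (((p : ℝ) ^ m.factorization p)⁻¹ * (Q * omegaWeight 2 (ordCompl[p] m))) := by ring
        _ ≤ 2 * (((p : ℝ) ^ m.factorization p)⁻¹ * (Q * omegaWeight 2 (ordCompl[p] m))) := by
          gcongr; norm_num
        _ = _ := by ring

section ClassWeight

variable (hb : ∀ n x, b n x = 0 ∨ b n x = 1)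
  (hinv : ∀ n p, n < p → FiberInvariant p (b n))

include hb hinv

lemma sum_weight_mul_classIndicator_le [NeZero Q] (n : ℕ) {m : ℕ} (hm : m ∣ Q) (a : ZMod Q) :
    ∑ x, weight b n x * classIndicator m a x ≤ Q * omegaWeight 2 m := by
  induction n generalizing m with
  | zero => simpa [weight] using sum_classIndicator_le hm a
  | succ n ih =>
    by_cases hn : n.Prime ∧ n ∣ m
    · obtain ⟨hp, hnm⟩ := hn
      have hm0 := ne_zero_of_dvd_ne_zero (NeZero.ne Q) hm
      calc ∑ x, weight b (n + 1) x * classIndicator m a x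
          ≤ ∑ x, 2 * (weight b n x * classIndicator m a x) := by
            refine sum_le_sum fun x _ ↦ ?_
            rw [← mul_assoc]
            exact mul_le_mul_of_nonneg_right (weight_succ_le hb n x) (classIndicator_nonneg _ _ _)
        _ = 2 * ∑ x, weight b n x * fiberAvg n (classIndicator m a) x := by
            rw [← mul_sum, sum_weight_mul_fiberAvg hinv]
        _ ≤ 2 * ∑ x, weight b n x * (((n : ℝ) ^ m.factorization n)⁻¹ *
              classIndicator (ordCompl[n] m) a x) := by
            gcongr with x
            · exact weight_nonneg hb n x
            · exact fiberAvg_classIndicator_le_ordCompl hp hm a x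
        _ = 2 * ((n : ℝ) ^ m.factorization n)⁻¹ *
              ∑ x, weight b n x * classIndicator (ordCompl[n] m) a x := by
            rw [mul_assoc, mul_sum (a := ((n : ℝ) ^ m.factorization n)⁻¹)]
            congr 1
            exact sum_congr rfl fun x _ ↦ by ring
        _ ≤ 2 * ((n : ℝ) ^ m.factorization n)⁻¹ * (Q * omegaWeight 2 (ordCompl[n] m)) := by
            gcongr
            exact ih ((Nat.ordCompl_dvd m n).trans hm)
        _ = _ := by rw [omegaWeight_eq_mul_ordCompl 2 hp hm0 hnm]; ring
    · rw [sum_weight_succ_mul hinv]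
      · exact ih hm
      · by_cases hp : n.Prime
        · exact fiberInvariant_classIndicator hp (fun h ↦ hn ⟨hp, h⟩) hm a
        · exact fiberInvariant_of_not_prime hp _

lemma sum_weight_mul_classIndicator_mul_le [NeZero Q] (n : ℕ) {m m' : ℕ} (hm : m ∣ Q)
    (hm' : m' ∣ Q) (a a' : ZMod Q) :
    ∑ x, weight b n x * (classIndicator m a x * classIndicator m' a' x) ≤
      Q * omegaWeight 2 (m.lcm m') := by
  by_cases h : ∃ y : ZMod Q, (m : ZMod Q) ∣ y - a ∧ (m' : ZMod Q) ∣ y - a'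
  · obtain ⟨y, hy, hy'⟩ := h
    refine le_trans (sum_le_sum fun x _ ↦ mul_le_mul_of_nonneg_left ?_ (weight_nonneg hb n x))
      (sum_weight_mul_classIndicator_le hb hinv n (Nat.lcm_dvd hm hm') y)
    by_cases hx : (m : ZMod Q) ∣ x - a ∧ (m' : ZMod Q) ∣ x - a'
    · have h1 := dvd_sub hx.1 hy
      have h2 := dvd_sub hx.2 hy'
      rw [sub_sub_sub_cancel_right] at h1 h2
      have h3 : ((m.lcm m' : ℕ) : ZMod Q) ∣ x - y := by
        obtain ⟨z, hz⟩ := ZMod.intCast_surjective (x - y)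
        rw [← hz] at h1 h2 ⊢
        rw [natCast_dvd_intCast_iff hm] at h1
        rw [natCast_dvd_intCast_iff hm'] at h2
        rw [natCast_dvd_intCast_iff (Nat.lcm_dvd hm hm')]
        exact Int.natCast_dvd.2 (Nat.lcm_dvd (Int.natCast_dvd.1 h1) (Int.natCast_dvd.1 h2))
      simp [classIndicator, hx, h3]
    · refine le_trans (le_of_eq ?_) (classIndicator_nonneg _ _ _)
      rw [not_and_or] at hx
      unfold classIndicator
      rcases hx with hx | hx <;> simp [hx]
  · refine (sum_eq_zero fun x _ ↦ ?_).trans_le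
      (mul_nonneg (Nat.cast_nonneg _) (omegaWeight_nonneg zero_le_two _))
    have hx : ¬ ((m : ZMod Q) ∣ x - a ∧ (m' : ZMod Q) ∣ x - a') := fun hx ↦ h ⟨x, hx⟩
    rw [not_and_or] at hx
    unfold classIndicator
    rcases hx with hx | hx <;> simp [hx]

end ClassWeight

open Classical in
/-- The indicator function of the union of the residue classes of `a d i` modulo `d`, over all
`d ∈ T` and `i < s`. -/
noncomputable def unionIndicator (T : Finset ℕ) (s : ℕ) (a : ℕ → ℕ → ℤ) (x : ZMod Q) : ℝ :=
  if ∃ d ∈ T, ∃ i < s, (d : ZMod Q) ∣ x - a d i then 1 else 0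

lemma unionIndicator_eq_zero_or_one (T : Finset ℕ) (s : ℕ) (a : ℕ → ℕ → ℤ) (x : ZMod Q) :
    unionIndicator T s a x = 0 ∨ unionIndicator T s a x = 1 := by
  unfold unionIndicator; split_ifs <;> simp

lemma unionIndicator_le_sum (T : Finset ℕ) (s : ℕ) (a : ℕ → ℕ → ℤ) (x : ZMod Q) :
    unionIndicator T s a x ≤ ∑ u ∈ T ×ˢ range s, classIndicator u.1 (a u.1 u.2 : ZMod Q) x := by
  have hnn : ∀ u ∈ T ×ˢ range s, 0 ≤ classIndicator u.1 (a u.1 u.2 : ZMod Q) x :=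
    fun u _ ↦ classIndicator_nonneg _ _ _
  unfold unionIndicator
  split_ifs with h
  · obtain ⟨d, hd, i, hi, hx⟩ := h
    refine le_trans (le_of_eq ?_) (single_le_sum hnn
      (mem_product.2 ⟨hd, mem_range.2 hi⟩ : (d, i) ∈ T ×ˢ range s))
    simp [classIndicator, hx]
  · exact sum_nonneg hnn

lemma fiberInvariant_unionIndicator {T : Finset ℕ} {p : ℕ} (hT : ∀ d ∈ T, d ∣ Q)
    (hp : p.Prime → ∀ d ∈ T, ¬ p ∣ d) (s : ℕ) (a : ℕ → ℕ → ℤ) :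
    FiberInvariant p (unionIndicator (Q := Q) T s a) := by
  by_cases hpp : p.Prime
  · intro x
    have key : ∀ d ∈ T, ∀ i, (d : ZMod Q) ∣ x + (ordCompl[p] Q : ℕ) - a d i ↔
        (d : ZMod Q) ∣ x - a d i := by
      intro d hd i
      have h := fiberInvariant_classIndicator hpp (hp hpp d hd) (hT d hd) (a d i : ZMod Q) x
      unfold classIndicator at h
      split_ifs at h with h1 h2 h2
      · exact iff_of_true h1 h2
      · norm_num at h
      · norm_num at h
      · exact iff_of_false h1 h2
    unfold unionIndicator
    congr 1
    refine propext (exists_congr fun d ↦ and_congr_right fun hd ↦ exists_congr fun i ↦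
      and_congr_right fun _ ↦ key d hd i)
  · exact fiberInvariant_of_not_prime hpp _

section UnionWeight

variable (hb : ∀ n x, b n x = 0 ∨ b n x = 1)
  (hinv : ∀ n p, n < p → FiberInvariant p (b n))

include hb hinv

lemma sum_weight_mul_unionIndicator_le [NeZero Q] (n : ℕ) {T : Finset ℕ} (hT : ∀ d ∈ T, d ∣ Q)
    (s : ℕ) (a : ℕ → ℕ → ℤ) :
    ∑ x, weight b n x * unionIndicator T s a x ≤ Q * (s * ∑ d ∈ T, omegaWeight 2 d) := by
  calc ∑ x, weight b n x * unionIndicator T s a x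
      ≤ ∑ x, weight b n x * ∑ u ∈ T ×ˢ range s, classIndicator u.1 (a u.1 u.2 : ZMod Q) x := by
        gcongr with x
        · exact weight_nonneg hb n x
        · exact unionIndicator_le_sum T s a x
    _ = ∑ u ∈ T ×ˢ range s, ∑ x, weight b n x * classIndicator u.1 (a u.1 u.2 : ZMod Q) x := by
        simp_rw [mul_sum]
        exact sum_comm
    _ ≤ ∑ u ∈ T ×ˢ range s, Q * omegaWeight 2 u.1 :=
        sum_le_sum fun u hu ↦
          sum_weight_mul_classIndicator_le hb hinv n (hT _ (mem_product.1 hu).1) _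
    _ = _ := by
        rw [sum_product]
        simp only [sum_const, card_range, nsmul_eq_mul]
        simp_rw [mul_sum]
        exact sum_congr rfl fun d _ ↦ by ring

lemma sum_weight_mul_sq_fiberAvg_unionIndicator_le [NeZero Q] (n : ℕ) {p : ℕ} (hp : p.Prime)
    {T : Finset ℕ} (hTQ : ∀ d ∈ T, d ∣ Q) (hT : ∀ d ∈ T, p ∣ d ∧ d ∈ (p + 1).smoothNumbers)
    (s : ℕ) (a : ℕ → ℕ → ℤ) :
    ∑ x, weight b n x * fiberAvg p (unionIndicator T s a) x ^ 2 ≤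
      Q * (s ^ 2 * ((2 / p) ^ 2 * (∏ q ∈ p.primesBelow, (1 + 4 / ((q : ℝ) - 1))) ^ 3)) := by
  set c : ℕ → ℝ := fun d ↦ ((p : ℝ) ^ d.factorization p)⁻¹ with hc
  have hc0 : ∀ d, 0 ≤ c d := fun d ↦ by positivity
  set g : ℕ × ℕ → ZMod Q → ℝ := fun u ↦ classIndicator (ordCompl[p] u.1) (a u.1 u.2 : ZMod Q)
    with hg
  have hfib : ∀ x, fiberAvg p (unionIndicator T s a) x ≤ ∑ u ∈ T ×ˢ range s, c u.1 * g u x := by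
    intro x
    refine (fiberAvg_mono p (unionIndicator_le_sum T s a) x).trans ?_
    rw [fiberAvg_sum]
    exact sum_le_sum fun u hu ↦
      fiberAvg_classIndicator_le_ordCompl hp (hTQ _ (mem_product.1 hu).1) _ x
  have hfib0 : ∀ x, 0 ≤ fiberAvg p (unionIndicator (Q := Q) T s a) x := fun x ↦
    (fiberAvg_mem_Icc (unionIndicator_eq_zero_or_one T s a) x).1
  have hdvd : ∀ u ∈ T ×ˢ range s, ordCompl[p] u.1 ∣ Q := fun u hu ↦
    (Nat.ordCompl_dvd _ p).trans (hTQ _ (mem_product.1 hu).1)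
  calc ∑ x, weight b n x * fiberAvg p (unionIndicator T s a) x ^ 2
      ≤ ∑ x, weight b n x * (∑ u ∈ T ×ˢ range s, c u.1 * g u x) ^ 2 := by
        gcongr with x
        · exact weight_nonneg hb n x
        · exact hfib0 x
        · exact hfib x
    _ = ∑ u ∈ T ×ˢ range s, ∑ v ∈ T ×ˢ range s,
          c u.1 * c v.1 * ∑ x, weight b n x * (g u x * g v x) := by
        simp_rw [sq, sum_mul_sum, mul_sum]
        rw [sum_comm]
        refine sum_congr rfl fun u _ ↦ ?_
        rw [sum_comm]
        exact sum_congr rfl fun v _ ↦ sum_congr rfl fun x _ ↦ by ring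
    _ ≤ ∑ u ∈ T ×ˢ range s, ∑ v ∈ T ×ˢ range s,
          c u.1 * c v.1 * (Q * omegaWeight 2 ((ordCompl[p] u.1).lcm (ordCompl[p] v.1))) := by
        refine sum_le_sum fun u hu ↦ sum_le_sum fun v hv ↦ ?_
        exact mul_le_mul_of_nonneg_left
          (sum_weight_mul_classIndicator_mul_le hb hinv n (hdvd u hu) (hdvd v hv) _ _)
          (mul_nonneg (hc0 _) (hc0 _))
    _ = Q * (s ^ 2 * ∑ d ∈ T, ∑ e ∈ T, c d * c e *
          omegaWeight 2 ((ordCompl[p] d).lcm (ordCompl[p] e))) := by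
        simp only [sum_product, sum_const, card_range, nsmul_eq_mul, mul_sum]
        exact sum_congr rfl fun d _ ↦ sum_congr rfl fun e _ ↦ by ring
    _ ≤ _ := by
        gcongr
        exact sum_inv_ordProj_mul_omegaWeight_lcm_le hp hT

end UnionWeight

end Distortion

/-- The largest prime factor of `d`, with value `0` if `d ≤ 1`. -/
def maxPrimeFactor (d : ℕ) : ℕ := d.primeFactors.sup id

lemma le_maxPrimeFactor {d p : ℕ} (hd : d ≠ 0) (hp : p.Prime) (hpd : p ∣ d) :
    p ≤ maxPrimeFactor d :=
  le_sup (f := id) (Nat.mem_primeFactors.2 ⟨hp, hpd, hd⟩)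

lemma maxPrimeFactor_mem_primeFactors {d : ℕ} (hd : 1 < d) :
    maxPrimeFactor d ∈ d.primeFactors := by
  obtain ⟨p, hp, h⟩ := exists_mem_eq_sup d.primeFactors (Nat.nonempty_primeFactors.2 hd) id
  rw [maxPrimeFactor, h]
  exact hp

lemma mem_smoothNumbers_of_maxPrimeFactor_lt {d N : ℕ} (hd : d ≠ 0) (h : maxPrimeFactor d < N) :
    d ∈ N.smoothNumbers :=
  Nat.mem_smoothNumbers_of_primeFactors_subset hd fun _ hp ↦ mem_range.2
    ((le_maxPrimeFactor hd (Nat.prime_of_mem_primeFactors hp)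
      (Nat.dvd_of_mem_primeFactors hp)).trans_lt h)

lemma exists_sum_rpow_neg_three_halves_le {ε : ℝ} (hε : 0 < ε) :
    ∃ N : ℕ, ∀ T : Finset ℕ, (∀ n ∈ T, N ≤ n) → ∑ n ∈ T, (n : ℝ) ^ (-(3 / 2) : ℝ) ≤ ε := by
  have hs : Summable fun n : ℕ ↦ (n : ℝ) ^ (-(3 / 2) : ℝ) :=
    Real.summable_nat_rpow.2 (by norm_num)
  obtain ⟨s, hs⟩ := summable_iff_vanishing_norm.1 hs ε hε
  refine ⟨s.sup id + 1, fun T hT ↦ ?_⟩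
  refine (Real.le_norm_self _).trans (hs T ?_).le
  rw [disjoint_left]
  intro n hn hns
  have h1 := hT n hn
  have h2 := le_sup (f := id) hns
  simp only [id] at h1 h2
  lia

lemma exists_sq_mul_prod_primesBelow_le :
    ∃ K : ℝ, 0 ≤ K ∧ ∀ p : ℕ, 1 ≤ p →
      (2 / (p : ℝ)) ^ 2 * (∏ q ∈ p.primesBelow, (1 + 4 / ((q : ℝ) - 1))) ^ 3 ≤
        K * (p : ℝ) ^ (-(3 / 2) : ℝ) := by
  obtain ⟨K, hK, h⟩ := exists_prod_primesBelow_le 4 (by norm_num)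
  refine ⟨4 * K ^ 3, by positivity, fun p hp ↦ ?_⟩
  have hp0 : (0 : ℝ) < p := by exact_mod_cast hp
  have hprod : 0 ≤ ∏ q ∈ p.primesBelow, (1 + 4 / ((q : ℝ) - 1)) := by
    refine prod_nonneg fun q hq ↦ ?_
    have : (1 : ℝ) ≤ q := by exact_mod_cast (Nat.prime_of_mem_primesBelow hq).one_le
    have : 0 ≤ 4 / ((q : ℝ) - 1) := div_nonneg (by norm_num) (by linarith)
    linarith
  calc _ ≤ (2 / (p : ℝ)) ^ 2 * (K * (p : ℝ) ^ (1 / 6 : ℝ)) ^ 3 := by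
        gcongr
        exact h p hp
    _ = 4 * K ^ 3 * (((p : ℝ) ^ (2 : ℕ))⁻¹ * ((p : ℝ) ^ (1 / 6 : ℝ)) ^ 3) := by ring
    _ = _ := by
        congr 1
        rw [← Real.rpow_natCast ((p : ℝ) ^ (1 / 6 : ℝ)), ← Real.rpow_mul hp0.le,
          ← Real.rpow_natCast (p : ℝ), ← Real.rpow_neg hp0.le, ← Real.rpow_add hp0]
        norm_num

/-- If all moduli are sufficiently large in terms of `s`, then a family of congruences in which
each modulus is used at most `s` times does not cover the integers. -/
theorem exists_forall_not_dvd_sub (s : ℕ) :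
    ∃ C : ℕ, ∀ S : Finset ℕ, (∀ d ∈ S, C < d) → ∀ a : ℕ → ℕ → ℤ,
      ∃ x : ℤ, ∀ d ∈ S, ∀ i < s, ¬ (d : ℤ) ∣ x - a d i := by
  obtain ⟨K, hK, hprod⟩ := exists_sq_mul_prod_primesBelow_le
  obtain ⟨p₀, hp₀⟩ := exists_sum_rpow_neg_three_halves_le
    (ε := 1 / (4 * (s ^ 2 * K + 1))) (by positivity)
  obtain ⟨C, hC⟩ := exists_sum_omegaWeight_le 2 p₀ (ε := 1 / (4 * (s + 1))) (by positivity)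
  refine ⟨C + 1, fun S hS a ↦ ?_⟩
  have hS1 : ∀ d ∈ S, 1 < d := fun d hd ↦ by have := hS d hd; lia
  have hS0 : ∀ d ∈ S, d ≠ 0 := fun d hd ↦ by have := hS1 d hd; lia
  set Q := ∏ d ∈ S, d with hQ
  have : NeZero Q := ⟨prod_ne_zero_iff.2 hS0⟩
  have hQ0 : (0 : ℝ) < Q := by exact_mod_cast Nat.pos_of_ne_zero (NeZero.ne Q)
  let T : ℕ → Finset ℕ := fun n ↦ {d ∈ S | maxPrimeFactor d = n}
  have hTS : ∀ n, ∀ d ∈ T n, d ∈ S ∧ maxPrimeFactor d = n := fun n d hd ↦ mem_filter.1 hd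
  have hTQ : ∀ n, ∀ d ∈ T n, d ∣ Q := fun n d hd ↦ dvd_prod_of_mem _ (hTS n d hd).1
  let b : ℕ → ZMod Q → ℝ := fun n ↦ unionIndicator (T n) s a
  have hb : ∀ n x, b n x = 0 ∨ b n x = 1 := fun n ↦ unionIndicator_eq_zero_or_one _ _ _
  have hinv : ∀ n p, n < p → FiberInvariant p (b n) := by
    refine fun n p hnp ↦ fiberInvariant_unionIndicator (hTQ n) (fun hp d hd hpd ↦ ?_) s a
    obtain ⟨hdS, rfl⟩ := hTS n d hd
    exact hnp.not_ge (le_maxPrimeFactor (hS0 d hdS) hp hpd)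
  have hnn : ∀ m, 0 ≤ omegaWeight 2 m := omegaWeight_nonneg (by norm_num)
  have hfirst : ∀ n, ∑ x, weight b (n + 1) x * b n x ≤
      Q * (s * ∑ d ∈ T n, omegaWeight 2 d) := fun n ↦
    (sum_weight_succ_mul_self_le hb n).trans
      (sum_weight_mul_unionIndicator_le hb hinv n (hTQ n) s a)
  have hsecond : ∀ n, ∑ x, weight b (n + 1) x * b n x ≤
      Q * (s ^ 2 * (K * (n : ℝ) ^ (-(3 / 2) : ℝ))) := by
    intro n
    rcases (T n).eq_empty_or_nonempty with hn | ⟨d, hd⟩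
    · refine (hfirst n).trans ?_
      rw [hn, sum_empty, mul_zero, mul_zero]
      positivity
    · obtain ⟨hdS, hdn⟩ := hTS n d hd
      have hp : n.Prime :=
        Nat.prime_of_mem_primeFactors (hdn ▸ maxPrimeFactor_mem_primeFactors (hS1 d hdS))
      refine (sum_weight_succ_mul_self_le_sq hb hinv n).trans ?_
      refine (sum_weight_mul_sq_fiberAvg_unionIndicator_le hb hinv n hp (hTQ n) ?_ s a).trans ?_
      · intro e he
        obtain ⟨heS, rfl⟩ := hTS n e he
        exact ⟨Nat.dvd_of_mem_primeFactors (maxPrimeFactor_mem_primeFactors (hS1 e heS)),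
          mem_smoothNumbers_of_maxPrimeFactor_lt (hS0 e heS) (Nat.lt_succ_self _)⟩
      · exact mul_le_mul_of_nonneg_left (mul_le_mul_of_nonneg_left (hprod n hp.one_le)
          (by positivity)) hQ0.le
  set N := S.sup maxPrimeFactor + 1
  have hsmall : ∑ n ∈ range N with n < p₀, ∑ x, weight b (n + 1) x * b n x ≤ Q * (1 / 4) := by
    have h1 : ∑ n ∈ range N with n < p₀, ∑ d ∈ T n, omegaWeight 2 d ≤ 1 / (4 * (s + 1)) := by
      rw [sum_fiberwise_eq_sum_filter]
      refine hC _ fun d hd ↦ ?_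
      simp only [mem_filter] at hd
      exact ⟨mem_smoothNumbers_of_maxPrimeFactor_lt (hS0 d hd.1) hd.2.2,
        (Nat.lt_succ_self C).trans (hS d hd.1)⟩
    refine (sum_le_sum fun n _ ↦ hfirst n).trans ?_
    rw [← mul_sum, ← mul_sum]
    gcongr
    refine (mul_le_mul_of_nonneg_left h1 (Nat.cast_nonneg s)).trans ?_
    rw [mul_one_div, div_le_div_iff₀ (by positivity) (by norm_num)]
    linarith
  have hlarge : ∑ n ∈ range N with ¬ n < p₀, ∑ x, weight b (n + 1) x * b n x ≤
      Q * (1 / 4) := by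
    have h1 := hp₀ {n ∈ range N | ¬ n < p₀} fun n hn ↦ not_lt.1 (mem_filter.1 hn).2
    refine (sum_le_sum fun n _ ↦ hsecond n).trans ?_
    simp_rw [← mul_assoc ((s : ℝ) ^ 2)]
    rw [← mul_sum, ← mul_sum]
    gcongr
    refine (mul_le_mul_of_nonneg_left h1 (by positivity)).trans ?_
    rw [mul_one_div, div_le_div_iff₀ (by positivity) (by norm_num)]
    linarith
  obtain ⟨x, hx⟩ := exists_forall_eq_zero hb hinv N (by
    rw [← sum_filter_add_sum_filter_not (range N) (· < p₀)]
    linarith)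
  obtain ⟨x, rfl⟩ := ZMod.intCast_surjective x
  refine ⟨x, fun d hd i hi hdvd ↦ ?_⟩
  have h := hx (maxPrimeFactor d) (Nat.lt_succ_of_le (le_sup hd))
  have hdT : d ∈ T (maxPrimeFactor d) := mem_filter.2 ⟨hd, rfl⟩
  have hdvd' := (natCast_dvd_intCast_iff (dvd_prod_of_mem _ hd : d ∣ Q) _).2 hdvd
  push_cast at hdvd'
  exact one_ne_zero ((if_pos ⟨d, hdT, i, hi, hdvd'⟩).symm.trans h)

/-- Congruences with distinct, sufficiently large moduli in terms of `L` cannot cover a residue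
class modulo `L`. -/
theorem exists_modulus_le_of_covers_arithmetic_progression {L : ℕ} (hL : 0 < L) :
    ∃ B : ℕ, ∀ (r : ℕ) (a : Fin r → ℤ) (m : Fin r → ℕ), Function.Injective m → ∀ x₀ : ℤ,
      ∃ t : ℤ, ∀ j, x₀ + L * t ≡ a j [ZMOD (m j)] → m j ≤ B := by
  classical
  obtain ⟨C, hC⟩ := exists_forall_not_dvd_sub (L + 1)
  refine ⟨C * L, fun r a m hinj x₀ ↦ ?_⟩
  let P : ℕ → ℕ → ℤ → Prop := fun d g t ↦
    ∃ j, m j = d * g ∧ (m j).gcd L = g ∧ x₀ + L * t ≡ a j [ZMOD (m j)]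
  let a' : ℕ → ℕ → ℤ := fun d g ↦ if h : ∃ t, P d g t then h.choose else 0
  obtain ⟨t, ht⟩ := hC
    (({j | C * L < m j} : Finset (Fin r)).image fun j ↦ m j / (m j).gcd L) (by
      intro d hd
      obtain ⟨j, hj, rfl⟩ := mem_image.1 hd
      refine lt_of_not_ge fun hle ↦ (mem_filter.1 hj).2.not_ge ?_
      calc m j = m j / (m j).gcd L * (m j).gcd L :=
            (Nat.div_mul_cancel (Nat.gcd_dvd_left _ _)).symm
        _ ≤ C * L := Nat.mul_le_mul hle (Nat.gcd_le_right _ hL)) a'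
  refine ⟨t, fun j hj ↦ not_lt.1 fun hlt ↦ ?_⟩
  have hgL : (m j).gcd L ∣ L := Nat.gcd_dvd_right _ _
  have hmul : m j = m j / (m j).gcd L * (m j).gcd L :=
    (Nat.div_mul_cancel (Nat.gcd_dvd_left _ _)).symm
  refine ht _ (mem_image_of_mem _ (mem_filter.2 ⟨mem_univ j, hlt⟩)) ((m j).gcd L)
    (Nat.lt_succ_of_le (Nat.gcd_le_right _ hL)) ?_
  have hex : ∃ t, P (m j / (m j).gcd L) ((m j).gcd L) t := ⟨t, j, hmul, rfl, hj⟩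
  have ha' : a' (m j / (m j).gcd L) ((m j).gcd L) = hex.choose := dif_pos hex
  obtain ⟨j', hj', -, hcong⟩ := hex.choose_spec
  rw [ha']
  generalize hex.choose = t₀ at hcong
  obtain rfl : j' = j := hinj (hj'.trans hmul.symm)
  have hdvd : ((m j' : ℕ) : ℤ) ∣ L * (t - t₀) := by
    have h := (hcong.trans hj.symm).dvd
    rwa [show x₀ + L * t - (x₀ + L * t₀) = L * (t - t₀) by ring] at h
  have hcop : IsCoprime ((m j' / (m j').gcd L : ℕ) : ℤ) ((L / (m j').gcd L : ℕ) : ℤ) :=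
    Nat.isCoprime_iff_coprime.2
      (Nat.coprime_div_gcd_div_gcd (Nat.gcd_pos_of_pos_right _ hL))
  refine hcop.dvd_of_dvd_mul_left ?_
  have hg0 : (((m j').gcd L : ℕ) : ℤ) ≠ 0 := by
    exact_mod_cast (Nat.gcd_pos_of_pos_right _ hL).ne'
  refine Int.dvd_of_mul_dvd_mul_right hg0 ?_
  rw [← Nat.cast_mul, Nat.div_mul_cancel (Nat.gcd_dvd_left _ _), mul_right_comm, ← Nat.cast_mul,
    Nat.div_mul_cancel hgL]
  exact hdvd

end CoveringSystem

/-- **Theorem 2 (Cummings–Filaseta–Trifonov).**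
For every nonnegative integer `k` there is a bound `B` (the paper's `B(k+1)`)
such that: whenever `x ≡ a j (mod m j)`, `j : Fin r`, is a covering system with
distinct moduli `m 0 < m 1 < ⋯ < m (r-1)`, `r ≥ k + 1`, and the first `k`
congruences do not by themselves cover all the integers, the `(k+1)`-st
smallest modulus `m k` is at most `B`. -/
theorem kth_smallest_modulus_bounded (k : ℕ) :
    ∃ B : ℕ, ∀ (r : ℕ) (a : Fin r → ℤ) (m : Fin r → ℕ),
      (∀ j, 0 < m j) →
      StrictMono m →
      (∀ x : ℤ, ∃ j, x ≡ a j [ZMOD (m j)]) →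
      (¬ ∀ x : ℤ, ∃ j : Fin r, (j : ℕ) < k ∧ x ≡ a j [ZMOD (m j)]) →
      ∀ (hk : k < r), m ⟨k, hk⟩ ≤ B := by
  induction k using Nat.strong_induction_on with
  | _ k ih =>
    choose! M hM using ih
    set L := ((Finset.range k).sup M).factorial
    obtain ⟨B, hB⟩ :=
      CoveringSystem.exists_modulus_le_of_covers_arithmetic_progression (Nat.factorial_pos
        ((Finset.range k).sup M))
    refine ⟨B, fun r a m hpos hmono hcov hncov hk ↦ ?_⟩
    have hdvd : ∀ j : Fin r, (j : ℕ) < k → m j ∣ L := fun j hj ↦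
      Nat.dvd_factorial (hpos j) <| (hM j hj r a m hpos hmono hcov (fun h ↦ hncov fun x ↦
        (h x).imp fun i hi ↦ ⟨hi.1.trans hj, hi.2⟩) j.2).trans
        (Finset.le_sup (f := M) (Finset.mem_range.2 hj))
    push Not at hncov
    obtain ⟨x₀, hx₀⟩ := hncov
    obtain ⟨t, ht⟩ := hB r a m hmono.injective x₀
    obtain ⟨j, hj⟩ := hcov (x₀ + L * t)
    refine le_trans (hmono.monotone (Fin.mk_le_of_le_val (not_lt.1 fun hjk ↦ ?_))) (ht j hj)
    refine hx₀ j hjk (Int.ModEq.trans ?_ hj)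
    exact Int.modEq_iff_dvd.2 ((Int.natCast_dvd_natCast.2 (hdvd j hjk)).trans ⟨t, by ring⟩)
end

section
/- Let S_1, S_2, … be an infinite sequence of finite sets, each of size at least 2, with liminf_{k→∞} |S_k|/k > 3. Then there is a positive integer C such that the following holds: for every positive integer n and every collection 𝒜 of hyperplanes in Q = S_1 × ⋯ × S_n that covers Q (every element of Q lies on some hyperplane in 𝒜), if no two hyperplanes in 𝒜 are parallel, then there exists a hyperplane A ∈ 𝒜 with F(A) ⊆ {1, …, C}. -/
open Finset
open scoped Classical ENNReal

/-- A hyperplane in `S_1 × ⋯ × S_n`.  Coordinates are 0-indexed in Lean: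
coordinate `j : ℕ`, `j < n`, corresponds to the paper's coordinate `j + 1`,
so the paper's set `S_j` is `S (j - 1)` here.  A hyperplane is recorded by its
finite set `F` of fixed coordinates together with the fixed value at each
fixed coordinate (on the non-fixed coordinates it is all of `S j`). -/
structure Hyp (S : ℕ → Type) (n : ℕ) where
  F : Finset ℕ
  hF : ∀ j ∈ F, j < n
  val : ∀ j ∈ F, S j

/-- The stage of a hyperplane: in the paper's 1-based labelling,
`A.stage = max F(A)`; in the 0-based labelling it is `(sup of A.F) + 1`. -/
def Hyp.stage {S : ℕ → Type} {n : ℕ} (A : Hyp S n) : ℕ := A.F.sup id + 1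

/-- `Qp S k` is the paper's `Q_k = S_1 × ⋯ × S_k` (in 0-based indexing,
`S 0 × ⋯ × S (k-1)`).  `Qp S 0` is a one-element type. -/
abbrev Qp (S : ℕ → Type) (k : ℕ) := ∀ j : Fin k, S j

/-- `x ∈ Q_k` lies on (the projection to `Q_k` of) the hyperplane `A`;
this is the correct notion of membership whenever `F(A) ⊆ {1, …, k}`. -/
def memH {S : ℕ → Type} {n : ℕ} (A : Hyp S n) {k : ℕ} (x : Qp S k) : Prop :=
  ∀ (j : Fin k) (h : (j : ℕ) ∈ A.F), x j = A.val j h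

/-- Membership in `B_k = ⋃_{A ∈ 𝒜_k} A`, viewed as a subset of `Q_k`, where
`𝒜_k = {A ∈ 𝒜 : max F(A) = k}` (1-based `k`). -/
def memB {S : ℕ → Type} {n : ℕ} {ι : Type} (𝓐 : ι → Hyp S n) (k : ℕ) (x : Qp S k) : Prop :=
  ∃ i, (𝓐 i).stage = k ∧ memH (𝓐 i) x

/-- `alpha 𝓐 k x` is the paper's `α_{k+1}(x)` for `x ∈ Q_k`: the proportion of
the fiber `F_x` covered by `B_{k+1}`. -/
noncomputable def alpha {S : ℕ → Type} [∀ j, Fintype (S j)] {n : ℕ} {ι : Type}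
    (𝓐 : ι → Hyp S n) (k : ℕ) (x : Qp S k) : ℝ :=
  ((univ.filter fun y : S k => memB 𝓐 (k + 1) (Fin.snoc x y)).card : ℝ) /
    (Fintype.card (S k))

/-- The weights `w_k : Q_k → ℝ`, defined inductively:  `w_0 ≡ 1`, and `w_(k+1)`
is obtained from `w_k` by the distortion rule with parameter `δ_{k+1} = δ k`.
(The paper's `δ_j` is `δ (j - 1)` here.) -/
noncomputable def w {S : ℕ → Type} [∀ j, Fintype (S j)] {n : ℕ} {ι : Type}
    (𝓐 : ι → Hyp S n) (δ : ℕ → ℝ) : (k : ℕ) → Qp S k → ℝ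
  | 0, _ => 1
  | (k + 1), x =>
      let x' : Qp S k := fun j => x j.castSucc
      let a : ℝ := alpha 𝓐 k x'
      if memB 𝓐 (k + 1) x then
        if a ≤ δ k then 0
        else ((a - δ k) / (a * (1 - δ k))) * (w 𝓐 δ k x' / (Fintype.card (S k)))
      else
        if a ≤ δ k then (1 / (1 - a)) * (w 𝓐 δ k x' / (Fintype.card (S k)))
        else (1 / (1 - δ k)) * (w 𝓐 δ k x' / (Fintype.card (S k)))

/-- `w_k(B_k)` (1-based `k`). -/
noncomputable def wB {S : ℕ → Type} [∀ j, Fintype (S j)] {n : ℕ} {ι : Type}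
    (𝓐 : ι → Hyp S n) (δ : ℕ → ℝ) (k : ℕ) : ℝ :=
  ∑ x ∈ univ.filter (memB 𝓐 k), w 𝓐 δ k x

/-- `w_k(A)`: the weight of the projection to `Q_k` of a hyperplane `A`
(meaningful when `F(A) ⊆ {1, …, k}`). -/
noncomputable def wH {S : ℕ → Type} [∀ j, Fintype (S j)] {n : ℕ} {ι : Type}
    (𝓐 : ι → Hyp S n) (δ : ℕ → ℝ) (k : ℕ) (A : Hyp S n) : ℝ :=
  ∑ x ∈ univ.filter (fun x : Qp S k => memH A x), w 𝓐 δ k x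

/-- `ν(J) = ∏_{j ∈ J} 1 / ((1 - δ_j)|S_j|)` (0-based `J`). -/
noncomputable def nu (S : ℕ → Type) [∀ j, Fintype (S j)] (δ : ℕ → ℝ) (J : Finset ℕ) : ℝ :=
  ∏ j ∈ J, 1 / ((1 - δ j) * (Fintype.card (S j)))

/-- `‖J‖ = ∏_{j ∈ J} |S_j|` (0-based `J`). -/
noncomputable def normJ (S : ℕ → Type) [∀ j, Fintype (S j)] (J : Finset ℕ) : ℝ :=
  ∏ j ∈ J, (Fintype.card (S j) : ℝ)

/-- `Ew 𝓐 δ k` is the paper's `E_k = E_{(k+1)-1} = ∑_{x ∈ Q_k} α_{k+1}(x)² w_k(x)`. -/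
noncomputable def Ew {S : ℕ → Type} [∀ j, Fintype (S j)] {n : ℕ} {ι : Type}
    (𝓐 : ι → Hyp S n) (δ : ℕ → ℝ) (k : ℕ) : ℝ :=
  ∑ x : Qp S k, (alpha 𝓐 k x) ^ 2 * w 𝓐 δ k x

/-- A distribution on a finite set which avoids a subset `B` as far as possible subject to having
density at most `1 / (1 - δ)`. -/
theorem exists_distorted_density {Y : Type*} [Fintype Y] [Nonempty Y] (B : Y → Prop) {δ : ℝ}
    (hδ : 0 < δ) (hδ' : δ < 1) :
    ∃ g : Y → ℝ, (∀ y, 0 ≤ g y) ∧ (∀ y, g y ≤ 1 / ((1 - δ) * Fintype.card Y)) ∧ ∑ y, g y = 1 ∧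
      (∑ y, if B y then g y else 0) ≤
        1 / (4 * δ * (1 - δ)) * ((#{y | B y} : ℝ) / Fintype.card Y) ^ 2 := by
  have hN : (0 : ℝ) < Fintype.card Y := by exact_mod_cast Fintype.card_pos
  set N := (Fintype.card Y : ℝ) with hNdef
  set b := (#{y | B y} : ℝ) with hb
  have hb0 : 0 ≤ b := by positivity
  have hδ1 : 0 < 1 - δ := by linarith
  have hsum (s t : ℝ) : ∑ y, (if B y then s else t) = b * s + (N - b) * t := by
    have hc : (#{y | ¬ B y} : ℝ) = N - b := by
      have := Finset.card_filter_add_card_filter_not (s := (univ : Finset Y)) B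
      rw [Finset.card_univ] at this
      rw [hb, hNdef, ← this]
      push_cast
      ring
    rw [Finset.sum_ite, Finset.sum_const, Finset.sum_const, nsmul_eq_mul, nsmul_eq_mul, hc]
  rcases le_or_gt b (δ * N) with h | h
  · have hNb : 0 < N - b := by nlinarith
    refine ⟨fun y => if B y then 0 else 1 / (N - b), fun y => ?_, fun y => ?_, ?_, ?_⟩
    · dsimp only; split_ifs <;> positivity
    · dsimp only; split_ifs
      · positivity
      · apply one_div_le_one_div_of_le (by positivity)
        linarith
    · rw [hsum]
      field_simp
      ring
    · have : ∀ y, (if B y then (if B y then 0 else 1 / (N - b)) else (0 : ℝ)) = 0 := by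
        intro y; split_ifs <;> rfl
      simp only [this, Finset.sum_const_zero]
      positivity
  · have hbpos : 0 < b := lt_trans (by positivity) h
    have hs : 0 ≤ (b - δ * N) / (b * ((1 - δ) * N)) :=
      div_nonneg (by linarith) (by positivity)
    refine ⟨fun y => if B y then (b - δ * N) / (b * ((1 - δ) * N)) else 1 / ((1 - δ) * N),
      fun y => ?_, fun y => ?_, ?_, ?_⟩
    · dsimp only; split_ifs <;> positivity
    · dsimp only; split_ifs
      · rw [div_le_div_iff₀ (by positivity) (by positivity)]
        have : 0 < (1 - δ) * N := by positivity
        nlinarith [mul_pos hδ hN]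
      · exact le_rfl
    · rw [hsum]
      field_simp
      ring
    · have : ∀ y, (if B y then (if B y then (b - δ * N) / (b * ((1 - δ) * N))
          else 1 / ((1 - δ) * N)) else (0 : ℝ)) =
          if B y then (b - δ * N) / (b * ((1 - δ) * N)) else 0 := by
        intro y; split_ifs <;> rfl
      simp only [this]
      rw [hsum]
      have e : b * ((b - δ * N) / (b * ((1 - δ) * N))) + (N - b) * 0
          = 1 / (4 * δ * (1 - δ)) * ((4 * δ * N * (b - δ * N)) / N ^ 2) := by
        field_simp
        ring
      rw [e, div_pow]
      gcongr
      nlinarith [sq_nonneg (b - 2 * (δ * N))]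

theorem sum_powerset_sum_powerset_prod_union {α R : Type*} [DecidableEq α] [CommRing R] (s : Finset α)
    (p : α → R) :
    ∑ I ∈ s.powerset, ∑ J ∈ s.powerset, ∏ j ∈ I ∪ J, p j = ∏ j ∈ s, (1 + 3 * p j) := by
  induction s using Finset.induction_on with
  | empty => simp
  | insert a s ha ih =>
    have key : ∀ I ∈ s.powerset, ∀ J ∈ s.powerset,
        ∏ j ∈ insert a (I ∪ J), p j = p a * ∏ j ∈ I ∪ J, p j := by
      intro I hI J hJ
      rw [Finset.mem_powerset] at hI hJ
      exact Finset.prod_insert fun h => ha (Finset.union_subset hI hJ h)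
    rw [Finset.prod_insert ha, ← ih, Finset.sum_powerset_insert ha]
    simp only [Finset.sum_powerset_insert ha, Finset.insert_union, Finset.union_insert,
      Finset.insert_idem]
    simp only [Finset.sum_add_distrib]
    have key' : ∑ I ∈ s.powerset, ∑ J ∈ s.powerset, ∏ j ∈ insert a (I ∪ J), p j
        = p a * ∑ I ∈ s.powerset, ∑ J ∈ s.powerset, ∏ j ∈ I ∪ J, p j := by
      simp only [Finset.mul_sum]
      exact Finset.sum_congr rfl fun I hI => Finset.sum_congr rfl fun J hJ => key I hI J hJ
    rw [key']
    ring

/-- If `T (m + 1) ≤ T m * (1 + θ / (m + 1))` eventually, with `θ < 1`, then `T m` grows slowly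
enough for `T m / (m + 1) ^ 2` to be summable. -/
theorem summable_div_sq_of_le_mul_one_add {T : ℕ → ℝ} {θ : ℝ} (hθ : θ < 1) (hT : ∀ m, 0 ≤ T m)
    (h : ∀ᶠ m : ℕ in Filter.atTop, T (m + 1) ≤ T m * (1 + θ / (m + 1))) :
    Summable fun m : ℕ => T m / ((m : ℝ) + 1) ^ 2 := by
  obtain ⟨N, hN⟩ := Filter.eventually_atTop.1 h
  rw [← summable_nat_add_iff (N + 1)]
  have hθ' : 0 < 1 - θ := by linarith
  have step : ∀ m : ℕ, N + 1 ≤ m →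
      T m / ((m : ℝ) + 1) ^ 2 ≤ 1 / (1 - θ) * (T m / m - T (m + 1) / ((m : ℝ) + 1)) := by
    intro m hm
    have hm0 : (0 : ℝ) < m := by exact_mod_cast (by omega : 0 < m)
    have h1 : T (m + 1) / ((m : ℝ) + 1) ≤ T m * (1 + θ / (m + 1)) / (m + 1) := by
      gcongr
      exact hN m (by omega)
    have h2 : T m / m - T m * (1 + θ / (m + 1)) / (m + 1)
        = (1 - θ) * (T m / ((m : ℝ) + 1) ^ 2) + T m / (m * ((m : ℝ) + 1) ^ 2) := by
      field_simp
      ring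
    have h3 : 0 ≤ T m / (m * ((m : ℝ) + 1) ^ 2) := by have := hT m; positivity
    rw [one_div, ← div_eq_inv_mul, le_div_iff₀ hθ']
    linarith
  have hpart : ∀ n : ℕ, ∑ i ∈ range n, T (i + (N + 1)) / (((i + (N + 1) : ℕ) : ℝ) + 1) ^ 2 ≤
      1 / (1 - θ) * (T (N + 1) / (N + 1 : ℕ) - T (n + (N + 1)) / ((n + (N + 1) : ℕ) : ℝ)) := by
    intro n
    induction n with
    | zero => simp
    | succ n ih =>
      rw [Finset.sum_range_succ]
      have := step (n + (N + 1)) (by omega)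
      have e : n + 1 + (N + 1) = n + (N + 1) + 1 := by omega
      rw [e, Nat.cast_succ (n + (N + 1))]
      linarith
  refine summable_of_sum_range_le (c := 1 / (1 - θ) * (T (N + 1) / (N + 1 : ℕ)))
    (fun n => ?_) fun n => (hpart n).trans ?_
  · have := hT (n + (N + 1)); positivity
  · have : 0 ≤ T (n + (N + 1)) / ((n + (N + 1) : ℕ) : ℝ) := by
      have := hT (n + (N + 1)); positivity
    gcongr
    linarith

section Hyperplanes

variable {S : ℕ → Type}

/-- Append a coordinate to a point of `Q_m`. -/
def Qp.snoc {m : ℕ} (x : Qp S m) (y : S m) : Qp S (m + 1) :=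
  Fin.snoc (α := fun j : Fin (m + 1) => S j) x y

theorem Qp.sum_succ [∀ j, Fintype (S j)] {m : ℕ} (f : Qp S (m + 1) → ℝ) :
    ∑ x, f x = ∑ x : Qp S m, ∑ y : S m, f (x.snoc y) := by
  rw [← Fintype.sum_prod_type' (f := fun (x : Qp S m) (y : S m) => f (x.snoc y))]
  exact (Fintype.sum_equiv ((Equiv.prodComm (Qp S m) (S m)).trans
    (Fin.snocEquiv fun j : Fin (m + 1) => S j)) _ _ fun _ => rfl).symm

theorem Qp.forall_snoc {m : ℕ} (x : Qp S m) (y : S m) (P : ∀ j : ℕ, S j → Prop) :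
    (∀ j : Fin (m + 1), P j (x.snoc y j)) ↔ (∀ j : Fin m, P j (x j)) ∧ P m y := by
  rw [Fin.forall_fin_succ']
  refine and_congr (forall_congr' fun j => ?_) ?_
  · simp [Qp.snoc]
  · have : x.snoc y (Fin.last m) = y := by simp [Qp.snoc]
    rw [this]; rfl

theorem memH_snoc {n m : ℕ} (A : Hyp S n) (x : Qp S m) (y : S m) :
    memH A (x.snoc y) ↔ memH A x ∧ ∀ h : m ∈ A.F, y = A.val m h :=
  Qp.forall_snoc x y fun j z => ∀ h : j ∈ A.F, z = A.val j h

variable [∀ j, Fintype (S j)]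

/-- Distinct hyperplanes of `𝒜` have distinct sets of fixed coordinates, so for given `x` each set
 `insert m J` accounts for at most one bad `y`. -/
theorem card_fiber_le {n m : ℕ} {𝒜 : Set (Hyp S n)}
    (hpar : ∀ A ∈ 𝒜, ∀ A' ∈ 𝒜, A.F = A'.F → A = A') (x : Qp S m) :
    (#{y : S m | ∃ A ∈ 𝒜, m ∈ A.F ∧ (∀ j ∈ A.F, j < m + 1) ∧ memH A (x.snoc y)} : ℝ) ≤
      ∑ J ∈ (range m).powerset, if ∃ A ∈ 𝒜, A.F = insert m J ∧ memH A x then 1 else 0 := by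
  have hsub : ({y : S m | ∃ A ∈ 𝒜, m ∈ A.F ∧ (∀ j ∈ A.F, j < m + 1) ∧ memH A (x.snoc y)} :
      Finset (S m)) ⊆ (range m).powerset.biUnion
        fun J => {y : S m | ∃ A ∈ 𝒜, A.F = insert m J ∧ memH A (x.snoc y)} := by
    intro y hy
    obtain ⟨A, hA, hm, hlt, hmem⟩ := (Finset.mem_filter.1 hy).2
    refine Finset.mem_biUnion.2 ⟨A.F.erase m, ?_, ?_⟩
    · rw [Finset.mem_powerset]
      intro j hj
      have := hlt j (Finset.mem_of_mem_erase hj)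
      have := Finset.ne_of_mem_erase hj
      exact Finset.mem_range.2 (by omega)
    · exact Finset.mem_filter.2 ⟨Finset.mem_univ _, A, hA, (Finset.insert_erase hm).symm, hmem⟩
  have hcard : ∀ J : Finset ℕ,
      #{y : S m | ∃ A ∈ 𝒜, A.F = insert m J ∧ memH A (x.snoc y)} ≤
        if ∃ A ∈ 𝒜, A.F = insert m J ∧ memH A x then 1 else 0 := by
    intro J
    split_ifs with h
    · rw [Finset.card_le_one]
      intro y hy z hz
      obtain ⟨A, hA, hF, hmem⟩ := (Finset.mem_filter.1 hy).2
      obtain ⟨A', hA', hF', hmem'⟩ := (Finset.mem_filter.1 hz).2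
      obtain rfl := hpar A hA A' hA' (hF.trans hF'.symm)
      have hm : m ∈ A.F := hF ▸ Finset.mem_insert_self m J
      rw [((memH_snoc A x y).1 hmem).2 hm, ((memH_snoc A x z).1 hmem').2 hm]
    · rw [Nat.le_zero, Finset.card_eq_zero, Finset.filter_eq_empty_iff]
      rintro y - ⟨A, hA, hF, hmem⟩
      exact h ⟨A, hA, hF, ((memH_snoc A x y).1 hmem).1⟩
  have := (Finset.card_le_card hsub).trans
    (Finset.card_biUnion_le.trans (Finset.sum_le_sum fun J _ => hcard J))
  exact_mod_cast this

/-- The second moment bound: `W` gives every cylinder `F = J` mass at most `∏ j ∈ J, p j`. -/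
theorem second_moment_le [∀ j, Nonempty (S j)] {n m : ℕ} {𝒜 : Set (Hyp S n)}
    (hpar : ∀ A ∈ 𝒜, ∀ A' ∈ 𝒜, A.F = A'.F → A = A') {W : Qp S m → ℝ} (hW : ∀ x, 0 ≤ W x)
    {p : ℕ → ℝ} (hp : ∀ j, 0 ≤ p j)
    (hcyl : ∀ J ⊆ range m, ∀ v : ∀ j, S j,
      (∑ x : Qp S m, if ∀ j : Fin m, (j : ℕ) ∈ J → x j = v j then W x else 0) ≤ ∏ j ∈ J, p j) :
    ∑ x : Qp S m, (#{y : S m | ∃ A ∈ 𝒜, m ∈ A.F ∧ (∀ j ∈ A.F, j < m + 1) ∧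
      memH A (x.snoc y)} : ℝ) ^ 2 * W x ≤ ∏ j ∈ range m, (1 + 3 * p j) := by
  set U : Finset ℕ → Qp S m → Prop := fun J x => ∃ A ∈ 𝒜, A.F = insert m J ∧ memH A x with hU
  have hpair : ∀ I ∈ (range m).powerset, ∀ J ∈ (range m).powerset,
      (∑ x : Qp S m, if U I x ∧ U J x then W x else 0) ≤ ∏ j ∈ I ∪ J, p j := by
    intro I hI J hJ
    rw [Finset.mem_powerset] at hI hJ
    by_cases h : (∃ A ∈ 𝒜, A.F = insert m I) ∧ ∃ A ∈ 𝒜, A.F = insert m J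
    · obtain ⟨⟨A, hA, hAF⟩, A', hA', hAF'⟩ := h
      refine le_trans (Finset.sum_le_sum fun x _ => ?_) (hcyl (I ∪ J) (Finset.union_subset hI hJ)
        fun j => if h : j ∈ A.F then A.val j h else if h : j ∈ A'.F then A'.val j h
          else Classical.arbitrary _)
      by_cases hx : U I x ∧ U J x
      · rw [if_pos hx, if_pos]
        obtain ⟨⟨D, hD, hDF, hDx⟩, D', hD', hDF', hDx'⟩ := hx
        obtain rfl := hpar A hA D hD (hAF.trans hDF.symm)
        obtain rfl := hpar A' hA' D' hD' (hAF'.trans hDF'.symm)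
        intro j hj
        by_cases h1 : (j : ℕ) ∈ A.F
        · rw [dif_pos h1]; exact hDx j h1
        · have h2 : (j : ℕ) ∈ A'.F := by
            rw [hAF] at h1
            rw [hAF']
            rcases Finset.mem_union.1 hj with hj | hj
            · exact absurd (Finset.mem_insert_of_mem hj) h1
            · exact Finset.mem_insert_of_mem hj
          rw [dif_neg h1, dif_pos h2]; exact hDx' j h2
      · rw [if_neg hx]
        split_ifs
        · exact hW x
        · exact le_rfl
    · rw [Finset.sum_eq_zero]
      · exact Finset.prod_nonneg fun j _ => hp j
      · intro x _
        rw [if_neg]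
        rintro ⟨⟨A, hA, hF, -⟩, A', hA', hF', -⟩
        exact h ⟨⟨A, hA, hF⟩, A', hA', hF'⟩
  rw [← sum_powerset_sum_powerset_prod_union]
  refine le_trans ?_ (Finset.sum_le_sum fun I hI => Finset.sum_le_sum fun J hJ => hpair I hI J hJ)
  have hswap : ∑ I ∈ (range m).powerset, ∑ J ∈ (range m).powerset,
      (∑ x : Qp S m, if U I x ∧ U J x then W x else 0) =
      ∑ x : Qp S m, (∑ J ∈ (range m).powerset, if U J x then (1 : ℝ) else 0) ^ 2 * W x := by
    rw [Finset.sum_congr rfl fun I _ => Finset.sum_comm, Finset.sum_comm]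
    refine Finset.sum_congr rfl fun x _ => ?_
    rw [sq, Finset.sum_mul_sum, Finset.sum_mul]
    refine Finset.sum_congr rfl fun I _ => ?_
    rw [Finset.sum_mul]
    refine Finset.sum_congr rfl fun J _ => ?_
    by_cases h1 : U I x <;> by_cases h2 : U J x <;> simp [h1, h2]
  rw [hswap]
  refine Finset.sum_le_sum fun x _ => mul_le_mul_of_nonneg_right ?_ (hW x)
  exact pow_le_pow_left₀ (by positivity) (card_fiber_le hpar x) 2

/-- The distortion method: a probability weight on `Q_m` giving small mass to the union of the
hyperplanes of `𝒜` whose fixed coordinates are all below `m`. -/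
theorem exists_distorted_weight [∀ j, Nonempty (S j)] {n C : ℕ} {𝒜 : Set (Hyp S n)}
    (hpar : ∀ A ∈ 𝒜, ∀ A' ∈ 𝒜, A.F = A'.F → A = A') (hC : ∀ A ∈ 𝒜, ∃ j ∈ A.F, C ≤ j)
    {δ : ℝ} (hδ : 0 < δ) (hδ' : δ < 1) (m : ℕ) :
    ∃ W : Qp S m → ℝ, (∀ x, 0 ≤ W x) ∧ ∑ x, W x = 1 ∧
      (∀ J ⊆ range m, ∀ v : ∀ j, S j,
        (∑ x : Qp S m, if ∀ j : Fin m, (j : ℕ) ∈ J → x j = v j then W x else 0) ≤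
          ∏ j ∈ J, 1 / ((1 - δ) * Fintype.card (S j))) ∧
      (∑ x : Qp S m, if ∃ A ∈ 𝒜, (∀ j ∈ A.F, j < m) ∧ memH A x then W x else 0) ≤
        ∑ k ∈ range m, if C ≤ k then
          1 / (4 * δ * (1 - δ)) * ((∏ j ∈ range k, (1 + 3 * (1 / ((1 - δ) * Fintype.card (S j))))) /
            (Fintype.card (S k) : ℝ) ^ 2) else 0 := by
  have hδ1 : 0 < 1 - δ := by linarith
  induction m with
  | zero =>
    refine ⟨fun _ => 1, fun _ => zero_le_one, by simp, fun J hJ v => ?_, ?_⟩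
    · obtain rfl : J = ∅ := by simpa using hJ
      simp
    · rw [Finset.range_zero, Finset.sum_empty]
      refine (Finset.sum_eq_zero fun x _ => if_neg ?_).le
      rintro ⟨A, hA, hlt, -⟩
      obtain ⟨j, hj, -⟩ := hC A hA
      exact absurd (hlt j hj) (Nat.not_lt_zero j)
  | succ m ih =>
    obtain ⟨W, hW, hW1, hcyl, hbad⟩ := ih
    set B : Qp S m → S m → Prop := fun x y =>
      ∃ A ∈ 𝒜, m ∈ A.F ∧ (∀ j ∈ A.F, j < m + 1) ∧ memH A (x.snoc y) with hB
    choose g hg0 hg1 hgs hgB using fun x : Qp S m => exists_distorted_density (B x) hδ hδ'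
    set W' : Qp S (m + 1) → ℝ := fun z =>
      W (fun j => z j.castSucc) * g (fun j => z j.castSucc) (z (Fin.last m)) with hW'
    have hW's : ∀ (x : Qp S m) (y : S m), W' (x.snoc y) = W x * g x y := by
      intro x y
      have h1 : (fun j : Fin m => x.snoc y j.castSucc) = x := by
        funext j; simp [Qp.snoc]
      have h2 : x.snoc y (Fin.last m) = y := by simp [Qp.snoc]
      change W (fun j : Fin m => x.snoc y j.castSucc) *
        g (fun j : Fin m => x.snoc y j.castSucc) (x.snoc y (Fin.last m)) = _
      rw [h2]
      exact congrArg (fun t : Qp S m => W t * g t y) h1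
    have hmarg : ∀ (P : Qp S m → Prop) [DecidablePred P], (∑ x : Qp S m, ∑ y : S m, if P x then W x * g x y else 0) =
        ∑ x : Qp S m, if P x then W x else 0 := by
      intro P _
      refine Finset.sum_congr rfl fun x _ => ?_
      split_ifs
      · rw [← Finset.mul_sum, hgs, mul_one]
      · simp
    refine ⟨W', fun z => mul_nonneg (hW _) (hg0 _ _), ?_, fun J hJ v => ?_, ?_⟩
    · simpa [Qp.sum_succ, hW's, hW1] using hmarg fun _ => True
    · rw [Qp.sum_succ]
      simp only [hW's, Qp.forall_snoc _ _ fun j z => j ∈ J → z = v j]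
      by_cases hm : m ∈ J
      · have hJ' : J.erase m ⊆ range m := by
          intro j hj
          have := Finset.mem_range.1 (hJ (Finset.mem_of_mem_erase hj))
          have := Finset.ne_of_mem_erase hj
          exact Finset.mem_range.2 (by omega)
        rw [← Finset.mul_prod_erase J _ hm]
        refine le_trans ?_ (mul_le_mul_of_nonneg_left (hcyl _ hJ' v) (by positivity))
        rw [Finset.mul_sum]
        refine Finset.sum_le_sum fun x _ => ?_
        have hiff : (∀ j : Fin m, (j : ℕ) ∈ J → x j = v j) ↔
            ∀ j : Fin m, (j : ℕ) ∈ J.erase m → x j = v j :=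
          forall_congr' fun j => by simp [j.2.ne]
        rw [Finset.sum_eq_single (v m)]
        · by_cases h : ∀ j : Fin m, (j : ℕ) ∈ J → x j = v j
          · rw [if_pos ⟨h, fun _ => rfl⟩, if_pos (hiff.1 h), mul_comm]
            exact mul_le_mul_of_nonneg_right (hg1 x _) (hW x)
          · rw [if_neg fun h' => h h'.1, if_neg fun h' => h (hiff.2 h'), mul_zero]
        · intro y _ hy
          exact if_neg fun h => hy (h.2 hm)
        · exact fun h => absurd (Finset.mem_univ _) h
      · have hJ' : J ⊆ range m := by
          intro j hj
          have := Finset.mem_range.1 (hJ hj)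
          have : j ≠ m := fun h => hm (h ▸ hj)
          exact Finset.mem_range.2 (by omega)
        simp only [hm, false_imp_iff, and_true]
        rw [hmarg]
        exact hcyl J hJ' v
    · rw [Qp.sum_succ, Finset.sum_range_succ]
      have hsplit : ∀ (x : Qp S m) (y : S m),
          (if ∃ A ∈ 𝒜, (∀ j ∈ A.F, j < m + 1) ∧ memH A (x.snoc y) then W' (x.snoc y) else 0) ≤
          (if ∃ A ∈ 𝒜, (∀ j ∈ A.F, j < m) ∧ memH A x then W x * g x y else 0) +
            W x * (if B x y then g x y else 0) := by
        intro x y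
        have h0 : 0 ≤ W x * g x y := mul_nonneg (hW x) (hg0 x y)
        rw [hW's, mul_ite, mul_zero]
        by_cases h1 : B x y
        · rw [if_pos h1]
          split_ifs <;> linarith
        · rw [if_neg h1, add_zero]
          by_cases h2 : ∃ A ∈ 𝒜, (∀ j ∈ A.F, j < m + 1) ∧ memH A (x.snoc y)
          · rw [if_pos h2, if_pos]
            obtain ⟨A, hA, hlt, hmem⟩ := h2
            have hm : m ∉ A.F := fun hm => h1 ⟨A, hA, hm, hlt, hmem⟩
            refine ⟨A, hA, fun j hj => ?_, ((memH_snoc A x y).1 hmem).1⟩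
            have := hlt j hj
            have : j ≠ m := fun h => hm (h ▸ hj)
            omega
          · rw [if_neg h2]
            split_ifs
            · exact h0
            · exact le_rfl
      refine (Finset.sum_le_sum fun x _ => Finset.sum_le_sum fun y _ => hsplit x y).trans ?_
      simp only [Finset.sum_add_distrib]
      rw [hmarg]
      refine add_le_add hbad ?_
      split_ifs with hCm
      · have hsecond := second_moment_le hpar hW (fun j => by positivity) hcyl
        have hc0 : (0 : ℝ) < Fintype.card (S m) := by exact_mod_cast Fintype.card_pos
        calc ∑ x : Qp S m, ∑ y : S m, W x * (if B x y then g x y else 0)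
            ≤ ∑ x : Qp S m, W x * (1 / (4 * δ * (1 - δ)) *
                ((#{y | B x y} : ℝ) / Fintype.card (S m)) ^ 2) := by
              refine Finset.sum_le_sum fun x _ => ?_
              rw [← Finset.mul_sum]
              exact mul_le_mul_of_nonneg_left (hgB x) (hW x)
          _ = 1 / (4 * δ * (1 - δ)) * ((∑ x : Qp S m, (#{y | B x y} : ℝ) ^ 2 * W x) /
                (Fintype.card (S m) : ℝ) ^ 2) := by
              rw [Finset.sum_div, Finset.mul_sum]
              refine Finset.sum_congr rfl fun x _ => ?_
              rw [div_pow]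
              ring
          _ ≤ _ := by gcongr
      · refine (Finset.sum_eq_zero fun x _ => Finset.sum_eq_zero fun y _ => ?_).le
        rw [if_neg, mul_zero]
        rintro ⟨A, hA, -, hlt, -⟩
        obtain ⟨j, hj, hCj⟩ := hC A hA
        have := hlt j hj
        omega

end Hyperplanes

/-- **Theorem 3 (Balister–Bollobás–Morris–Sahasrabudhe–Tiba).**
For every sequence of finite sets `S_1, S_2, …`, each of size at least `2`,
with `liminf_{k → ∞} |S_k| / k > 3`, there is a positive integer `C` such
that: for every `n ≥ 1` and every collection `𝒜` of pairwise non-parallel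
hyperplanes covering `Q = S_1 × ⋯ × S_n`, some `A ∈ 𝒜` has
`F(A) ⊆ {1, …, C}`.  (Indices are 0-based in Lean, so the paper's `|S_k| / k`
is `card (S (k - 1)) / k = card (S k) / (k + 1)` here, and
`F(A) ⊆ {1, …, C}` reads `∀ j ∈ A.F, j < C`.  Non-parallel means that
distinct hyperplanes of `𝒜` have distinct sets of fixed coordinates.) -/
theorem hyperplane_covering_bounded_fixed_coordinates
    (S : ℕ → Type) [∀ j, Fintype (S j)]
    (hcard : ∀ j, 2 ≤ Fintype.card (S j))
    (hliminf : 3 < Filter.liminf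
      (fun k : ℕ => (Fintype.card (S k) : ℝ≥0∞) / ((k : ℝ≥0∞) + 1)) Filter.atTop) :
    ∃ C : ℕ, 0 < C ∧ ∀ n : ℕ, 0 < n → ∀ 𝒜 : Set (Hyp S n),
      (∀ x : Qp S n, ∃ A ∈ 𝒜, memH A x) →
      (∀ A ∈ 𝒜, ∀ A' ∈ 𝒜, A.F = A'.F → A = A') →
      ∃ A ∈ 𝒜, ∀ j ∈ A.F, j < C := by
  have hne : ∀ j, Nonempty (S j) := fun j =>
    Fintype.card_pos_iff.1 (lt_of_lt_of_le two_pos (hcard j))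
  obtain ⟨c, hc3, hc⟩ := exists_between hliminf
  have hctop : c ≠ ⊤ := (lt_of_lt_of_le hc le_top).ne
  set r : ℝ := c.toReal with hr
  have hr3 : 3 < r := by
    have := (ENNReal.toReal_lt_toReal (by norm_num) hctop).2 hc3
    simpa using this
  have hlarge : ∀ᶠ k : ℕ in Filter.atTop, r * (k + 1) ≤ Fintype.card (S k) := by
    filter_upwards [Filter.eventually_lt_of_lt_liminf hc] with k hk
    have h1 : c * ((k : ℝ≥0∞) + 1) ≤ Fintype.card (S k) :=
      (ENNReal.le_div_iff_mul_le (Or.inl (by simp)) (Or.inl (by simp))).1 hk.le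
    have h2 := ENNReal.toReal_mono (by simp) h1
    rw [ENNReal.toReal_mul, ENNReal.toReal_add (by simp) (by simp)] at h2
    simpa using h2
  set δ : ℝ := (r - 3) / (2 * r) with hδdef
  have hδ : 0 < δ := div_pos (by linarith) (by linarith)
  have hδ' : 1 - δ = (r + 3) / (2 * r) := by
    rw [hδdef]
    field_simp
    ring
  have hδ1 : 0 < 1 - δ := by rw [hδ']; positivity
  have hcpos : ∀ k, (0 : ℝ) < Fintype.card (S k) := fun k => by exact_mod_cast Fintype.card_pos
  set T : ℕ → ℝ := fun k => ∏ j ∈ range k, (1 + 3 * (1 / ((1 - δ) * Fintype.card (S j)))) with hT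
  have hT0 : ∀ k, 0 ≤ T k := fun k => Finset.prod_nonneg fun j _ => by
    have := hcpos j
    positivity
  have hTsum : Summable fun k : ℕ => T k / ((k : ℝ) + 1) ^ 2 := by
    refine summable_div_sq_of_le_mul_one_add (θ := 6 / (r + 3)) ?_ hT0 ?_
    · rw [div_lt_one (by linarith)]
      linarith
    · filter_upwards [hlarge] with k hk
      rw [hT]
      simp only [Finset.prod_range_succ]
      refine mul_le_mul_of_nonneg_left (add_le_add_right ?_ 1) (hT0 k)
      have h1 : (r + 3) / 2 * ((k : ℝ) + 1) ≤ (1 - δ) * Fintype.card (S k) := by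
        calc (r + 3) / 2 * ((k : ℝ) + 1) = (1 - δ) * (r * (k + 1)) := by
              rw [hδ']
              field_simp
          _ ≤ _ := by gcongr
      calc 3 * (1 / ((1 - δ) * Fintype.card (S k)))
          ≤ 3 * (1 / ((r + 3) / 2 * ((k : ℝ) + 1))) := by gcongr
        _ = 6 / (r + 3) / (k + 1) := by
          field_simp
          ring
  set b : ℕ → ℝ := fun k => 1 / (4 * δ * (1 - δ)) * (T k / (Fintype.card (S k) : ℝ) ^ 2) with hb
  have hb0 : ∀ k, 0 ≤ b k := fun k => by
    have := hT0 k
    positivity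
  have hbsum : Summable b := by
    refine Summable.mul_left _ ?_
    refine summable_of_isBigO_nat hTsum (Asymptotics.IsBigO.of_bound 1 ?_)
    filter_upwards [hlarge] with k hk
    have := hT0 k
    rw [one_mul, Real.norm_of_nonneg (by positivity), Real.norm_of_nonneg (by positivity)]
    gcongr
    nlinarith [(Nat.cast_nonneg k : (0 : ℝ) ≤ k)]
  obtain ⟨C, hC0, hC⟩ : ∃ C : ℕ, 0 < C ∧ ∑' k, b (k + C) < 1 :=
    ((Filter.eventually_gt_atTop 0).and
      ((tendsto_sum_nat_add b).eventually_lt_const one_pos)).exists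
  refine ⟨C, hC0, fun n _ 𝒜 hcover hpar => ?_⟩
  by_contra! hno
  obtain ⟨W, -, hW1, -, hbad⟩ := exists_distorted_weight hpar hno hδ (by linarith) n
  have hall : ∀ x : Qp S n, ∃ A ∈ 𝒜, (∀ j ∈ A.F, j < n) ∧ memH A x := fun x => by
    obtain ⟨A, hA, hx⟩ := hcover x
    exact ⟨A, hA, A.hF, hx⟩
  simp only [hall, if_true, hW1] at hbad
  have htail : (∑ k ∈ range n, if C ≤ k then b k else 0) ≤ ∑' k, b (k + C) := by
    rw [← Finset.sum_filter]
    have hshift : Summable fun k => b (k + C) := (summable_nat_add_iff C).2 hbsum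
    calc ∑ k ∈ range n with C ≤ k, b k
        ≤ ∑ k ∈ (range n).image (· + C), b k := by
          refine Finset.sum_le_sum_of_subset_of_nonneg (fun k hk => ?_) fun k _ _ => hb0 k
          obtain ⟨hk, hCk⟩ := Finset.mem_filter.1 hk
          have := Finset.mem_range.1 hk
          exact Finset.mem_image.2 ⟨k - C, Finset.mem_range.2 (by omega), by omega⟩
      _ = ∑ k ∈ range n, b (k + C) := Finset.sum_image fun _ _ _ _ h => Nat.add_right_cancel h
      _ ≤ ∑' k, b (k + C) := hshift.sum_le_tsum _ fun k _ => hb0 _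
  linarith [hbad.trans htail]
end

section
/- For every k with 0 ≤ k ≤ n, the total weight is 1: ∑_{x ∈ Q_k} w_k(x) = 1. -/
open Finset
open scoped Classical

/-- Averaging a two-valued function over a finite type: if it takes the value `u * c` on `P` and
`v * c` off `P`, its sum is determined by the density of `P`. -/
theorem sum_ite_mul_div_card {α : Type*} [Fintype α] [Nonempty α] (P : α → Prop) (u v c : ℝ) :
    ∑ y : α, (if P y then u * (c / Fintype.card α) else v * (c / Fintype.card α)) =
      (((univ.filter P).card : ℝ) / Fintype.card α * u +
        (1 - ((univ.filter P).card : ℝ) / Fintype.card α) * v) * c := by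
  have hN : (Fintype.card α : ℝ) ≠ 0 := by exact_mod_cast Fintype.card_ne_zero
  have hcard : ((univ.filter P).card : ℝ) + ((univ.filter fun y => ¬P y).card : ℝ) =
      Fintype.card α := by
    exact_mod_cast card_filter_add_card_filter_not (s := (univ : Finset α)) P
  rw [sum_ite, sum_const, sum_const, nsmul_eq_mul, nsmul_eq_mul, eq_sub_of_add_eq' hcard]
  field_simp

/-- The distortion rule preserves the mass of each fiber. -/
theorem sum_w_snoc {S : ℕ → Type} [∀ j, Fintype (S j)] {n : ℕ} {ι : Type} (𝓐 : ι → Hyp S n)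
    (δ : ℕ → ℝ) (k : ℕ) [Nonempty (S k)] (hδ₀ : 0 ≤ δ k) (hδ₁ : δ k < 1) (x : Qp S k) :
    ∑ y : S k, w 𝓐 δ (k + 1) (Fin.snoc x y) = w 𝓐 δ k x := by
  have hinit (y : S k) : (fun j : Fin k =>
      (Fin.snoc x y : Qp S (k + 1)) j.castSucc) = x :=
    funext fun j => Fin.snoc_castSucc (α := fun j : Fin (k + 1) => S j) y x j
  simp only [w, hinit]
  have hδ : 1 - δ k ≠ 0 := (sub_pos.2 hδ₁).ne'
  by_cases ha : alpha 𝓐 k x ≤ δ k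
  · have ha₁ : 1 - alpha 𝓐 k x ≠ 0 := (sub_pos.2 (ha.trans_lt hδ₁)).ne'
    have h := sum_ite_mul_div_card (fun y : S k => memB 𝓐 (k + 1) (Fin.snoc x y)) 0
      (1 / (1 - alpha 𝓐 k x)) (w 𝓐 δ k x)
    simp only [zero_mul] at h
    simp only [ha, if_true]
    refine h.trans ?_
    change (alpha 𝓐 k x * 0 + (1 - alpha 𝓐 k x) * (1 / (1 - alpha 𝓐 k x))) * _ = _
    field_simp
    ring
  · have ha₀ : alpha 𝓐 k x ≠ 0 := (hδ₀.trans_lt (not_le.1 ha)).ne'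
    simp only [ha, if_false]
    refine (sum_ite_mul_div_card (fun y : S k => memB 𝓐 (k + 1) (Fin.snoc x y)) _ _ _).trans ?_
    change (alpha 𝓐 k x * _ + (1 - alpha 𝓐 k x) * _) * _ = _
    field_simp
    ring

/-- For every `k` with `0 ≤ k ≤ n`, the total weight is `1`:
`∑_{x ∈ Q_k} w_k(x) = 1`. -/
theorem total_weight_eq_one
    (S : ℕ → Type) [∀ j, Fintype (S j)] (n : ℕ) (hn : 0 < n)
    (hcard : ∀ j, j < n → 2 ≤ Fintype.card (S j))
    (δ : ℕ → ℝ) (hδ : ∀ j, j < n → δ j ∈ Set.Icc (0 : ℝ) (1 / 2))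
    (ι : Type) [Fintype ι] (𝓐 : ι → Hyp S n)
    (hFne : ∀ i, (𝓐 i).F.Nonempty)
    (k : ℕ) (hk : k ≤ n) :
    ∑ x : Qp S k, w 𝓐 δ k x = 1 := by
  induction k with
  | zero => simp [w]
  | succ k ih =>
    have hk' : k < n := hk
    have : Nonempty (S k) :=
      Fintype.card_pos_iff.1 (two_pos.trans_le (hcard k hk'))
    rw [← (Fin.snocEquiv fun j : Fin (k + 1) => S j).sum_comp, Fintype.sum_prod_type_right,
      ← ih hk'.le]
    exact sum_congr rfl fun x _ =>
      sum_w_snoc 𝓐 δ k (hδ k hk').1 ((hδ k hk').2.trans_lt (by norm_num)) x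
end
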